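/- There exist universal constants κ > 0 and C > 0 such that for every real Z ≥ 1 and every α > 0 with Zα² ≤ κ, the grand-canonical ground state energies of the magnetic Schrödinger model satisfy E^{nf,S}_Z ≥ E^{cl,S}_{Z,α} ≥ E^{nf,S}_Z − C·Z^{7/3 − 1/63}. -/

import Mathlib

open MeasureTheory

noncomputable section

/-- Euclidean norm on ℝ³ (encoded as `Fin 3 → ℝ`). -/
def enorm3 (x : Fin 3 → ℝ) : ℝ := Real.sqrt (∑ k, x k ^ 2)

/-- The Pauli matrices σ₁, σ₂, σ₃. -/
def pauli : Fin 3 → Matrix (Fin 2) (Fin 2) ℂ :=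
  ![!![0, 1; 1, 0], !![0, -Complex.I; Complex.I, 0], !![1, 0; 0, -1]]

/-- The partial derivative ∂ᵢ Aⱼ of a vector field on ℝ³. -/
def pdVec (A : (Fin 3 → ℝ) → Fin 3 → ℝ) (i j : Fin 3) (x : Fin 3 → ℝ) : ℝ :=
  fderiv ℝ A x (Pi.single i 1) j

/-- The curl ∇×A of a vector field on ℝ³. -/
def curl3 (A : (Fin 3 → ℝ) → Fin 3 → ℝ) (x : Fin 3 → ℝ) : Fin 3 → ℝ :=
  ![pdVec A 1 2 x - pdVec A 2 1 x, pdVec A 2 0 x - pdVec A 0 2 x,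
    pdVec A 0 1 x - pdVec A 1 0 x]

/-- |∇×A|²(x). -/
def curlSq (A : (Fin 3 → ℝ) → Fin 3 → ℝ) (x : Fin 3 → ℝ) : ℝ :=
  ∑ k, (curl3 A x k) ^ 2

/-- |∇⊗A|²(x) = Σᵢⱼ |∂ᵢAⱼ|². -/
def gradSq (A : (Fin 3 → ℝ) → Fin 3 → ℝ) (x : Fin 3 → ℝ) : ℝ :=
  ∑ i, ∑ j, (pdVec A i j x) ^ 2

/-- A divergence-free smooth compactly supported vector potential. -/
def IsVecPot (A : (Fin 3 → ℝ) → Fin 3 → ℝ) : Prop :=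
  ContDiff ℝ (⊤ : ℕ∞) A ∧ HasCompactSupport A ∧ ∀ x, ∑ k, pdVec A k k x = 0

/-- The unit basis vector of the configuration space (ℝ³)^N in direction
(particle j, coordinate k). -/
def eVec (N : ℕ) (j : Fin N) (k : Fin 3) : Fin N → Fin 3 → ℝ :=
  Pi.single j (Pi.single k 1)

/-- A normalized `N`-electron wave function: smooth, compactly supported,
antisymmetric under simultaneous permutation of position-spin pairs, L²-normalized. -/
structure IsWaveFun (N : ℕ) (Ψ : (Fin N → Fin 3 → ℝ) → (Fin N → Fin 2) → ℂ) : Prop where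
  smooth : ∀ s, ContDiff ℝ (⊤ : ℕ∞) fun x => Ψ x s
  compactSupport : ∀ s, HasCompactSupport fun x => Ψ x s
  antisymm : ∀ (π : Equiv.Perm (Fin N)) (x : Fin N → Fin 3 → ℝ) (s : Fin N → Fin 2),
    Ψ (fun i => x (π i)) (fun i => s (π i)) = ((Equiv.Perm.sign π : ℤ) : ℂ) * Ψ x s
  normalized : ∑ s : Fin N → Fin 2, ∫ x : Fin N → Fin 3 → ℝ, ‖Ψ x s‖ ^ 2 = 1

/-- The expectation ∫ W |Ψ|² of a multiplication operator, including spin summation. -/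
def potInt (N : ℕ) (W : (Fin N → Fin 3 → ℝ) → ℝ)
    (Ψ : (Fin N → Fin 3 → ℝ) → (Fin N → Fin 2) → ℂ) : ℝ :=
  ∑ s : Fin N → Fin 2, ∫ x : Fin N → Fin 3 → ℝ, W x * ‖Ψ x s‖ ^ 2

/-- The Pauli kinetic form t_A^{(j)}[Ψ] = ‖σ^{(j)}·(−i∇_{x_j} + A(x_j))Ψ‖². -/
def pauliKin (N : ℕ) (A : (Fin 3 → ℝ) → Fin 3 → ℝ) (j : Fin N)
    (Ψ : (Fin N → Fin 3 → ℝ) → (Fin N → Fin 2) → ℂ) : ℝ :=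
  ∑ s : Fin N → Fin 2, ∫ x : Fin N → Fin 3 → ℝ,
    ‖∑ k : Fin 3, ∑ t : Fin 2, pauli k (s j) t *
      (-Complex.I * fderiv ℝ (fun y => Ψ y (Function.update s j t)) x (eVec N j k)
        + (A (x j) k : ℂ) * Ψ x (Function.update s j t))‖ ^ 2

/-- The magnetic Schrödinger kinetic form k_A^{(j)}[Ψ] = ‖(−i∇_{x_j} + A(x_j))Ψ‖²
(no Pauli spin coupling). -/
def schKin (N : ℕ) (A : (Fin 3 → ℝ) → Fin 3 → ℝ) (j : Fin N)
    (Ψ : (Fin N → Fin 3 → ℝ) → (Fin N → Fin 2) → ℂ) : ℝ :=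
  ∑ s : Fin N → Fin 2, ∫ x : Fin N → Fin 3 → ℝ, ∑ k : Fin 3,
    ‖-Complex.I * fderiv ℝ (fun y => Ψ y s) x (eVec N j k) + (A (x j) k : ℂ) * Ψ x s‖ ^ 2

/-- The classical-field magnetic Schrödinger energy functional 𝓔^{cl,S}_{N,Z,α}[Ψ,A]. -/
def clSchEnergy (N : ℕ) (Z α : ℝ) (A : (Fin 3 → ℝ) → Fin 3 → ℝ)
    (Ψ : (Fin N → Fin 3 → ℝ) → (Fin N → Fin 2) → ℂ) : ℝ :=
  (∑ j : Fin N, (schKin N A j Ψ - Z * potInt N (fun x => (enorm3 (x j))⁻¹) Ψ))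
    + (∑ i : Fin N, ∑ j : Fin N,
        if i < j then potInt N (fun x => (enorm3 (x i - x j))⁻¹) Ψ else 0)
    + (8 * Real.pi * α ^ 2)⁻¹ * ∫ x : Fin 3 → ℝ, curlSq A x

/-- All values of the classical-field Schrödinger energy functional. -/
def clSchSet (Z α : ℝ) : Set ℝ :=
  {E | ∃ N : ℕ, 1 ≤ N ∧ ∃ A, IsVecPot A ∧
    ∃ Ψ, IsWaveFun N Ψ ∧ E = clSchEnergy N Z α A Ψ}

/-- All values of the Schrödinger energy functional with no magnetic field (A ≡ 0). -/
def nfSchSet (Z α : ℝ) : Set ℝ :=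
  {E | ∃ N : ℕ, 1 ≤ N ∧ ∃ Ψ, IsWaveFun N Ψ ∧ E = clSchEnergy N Z α (fun _ => 0) Ψ}

/-- Three-dimensional space. -/
abbrev E3 := Fin 3 → ℝ

/-- Insert the position `y` of particle `j` into the configuration `x` of the other particles. -/
def ins {n : ℕ} (j : Fin (n + 1)) (y : E3) (x : Fin n → E3) : Fin (n + 1) → E3 :=
  Fin.insertNth (α := fun _ => E3) j y x

/-- The configuration of the particles other than `j`. -/
def rem {n : ℕ} (j : Fin (n + 1)) (x : Fin (n + 1) → E3) : Fin n → E3 :=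
  fun i => x (j.succAbove i)

@[simp] lemma ins_same {n : ℕ} (j : Fin (n + 1)) (y : E3) (x : Fin n → E3) : ins j y x j = y := by
  simp [ins]

@[simp] lemma ins_rem {n : ℕ} (j : Fin (n + 1)) (x : Fin (n + 1) → E3) :
    ins j (x j) (rem j x) = x := by
  ext1 i
  refine Fin.succAboveCases j ?_ ?_ i <;> simp [ins, rem]

@[simp] lemma rem_ins {n : ℕ} (j : Fin (n + 1)) (y : E3) (x : Fin n → E3) :
    rem j (ins j y x) = x := by
  ext1 i; simp [ins, rem]

lemma ins_rem_eq_update {n : ℕ} (j : Fin (n + 1)) (y : E3) (x : Fin (n + 1) → E3) :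
    ins j y (rem j x) = Function.update x j y := by
  ext1 i
  refine Fin.succAboveCases j ?_ ?_ i <;> simp [ins, rem]

lemma ins_of_ne {n : ℕ} {i j : Fin (n + 1)} (h : i ≠ j) (y y' : E3) (x : Fin n → E3) :
    ins j y x i = ins j y' x i := by
  obtain ⟨k, rfl⟩ := Fin.exists_succAbove_eq h
  simp [ins]

lemma continuous_ins {n : ℕ} (j : Fin (n + 1)) :
    Continuous fun p : E3 × (Fin n → E3) => ins j p.1 p.2 := by
  unfold ins
  exact continuous_fst.finInsertNth (A := fun _ => E3) j continuous_snd

lemma continuous_rem {n : ℕ} (j : Fin (n + 1)) :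
    Continuous (rem j) := by
  unfold rem
  fun_prop

lemma measurePreserving_ins {n : ℕ} (j : Fin (n + 1)) :
    MeasurePreserving (fun p : E3 × (Fin n → E3) => ins j p.1 p.2)
      (volume.prod volume) volume :=
  (volume_preserving_piFinSuccAbove (fun _ : Fin (n + 1) => E3) j).symm _

lemma measurableEmbedding_ins {n : ℕ} (j : Fin (n + 1)) :
    MeasurableEmbedding (fun p : E3 × (Fin n → E3) => ins j p.1 p.2) :=
  (MeasurableEquiv.piFinSuccAbove (fun _ : Fin (n + 1) => E3) j).symm.measurableEmbedding

lemma integrable_ins {n : ℕ} (j : Fin (n + 1)) {G : Type*} [NormedAddCommGroup G]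
    {F : (Fin (n + 1) → E3) → G} (hF : Integrable F) :
    Integrable (fun p : E3 × (Fin n → E3) => F (ins j p.1 p.2)) (volume.prod volume) :=
  ((measurePreserving_ins j).integrable_comp_emb (measurableEmbedding_ins j)).2 hF

lemma integral_slice {n : ℕ} (j : Fin (n + 1)) {G : Type*} [NormedAddCommGroup G] [NormedSpace ℝ G]
    {F : (Fin (n + 1) → E3) → G} (hF : Integrable F) :
    ∫ x, F x = ∫ x' : Fin n → E3, ∫ y : E3, F (ins j y x') := by
  rw [← (measurePreserving_ins j).integral_comp (measurableEmbedding_ins j)]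
  exact integral_prod_symm _ (integrable_ins j hF)

lemma lintegral_slice {n : ℕ} (j : Fin (n + 1)) {F : (Fin (n + 1) → E3) → ENNReal}
    (hF : Measurable F) :
    ∫⁻ x, F x = ∫⁻ x' : Fin n → E3, ∫⁻ y : E3, F (ins j y x') := by
  rw [← (measurePreserving_ins j).lintegral_comp_emb (measurableEmbedding_ins j)]
  exact lintegral_prod_symm' _ (hF.comp (continuous_ins j).measurable)

/-- The partial inner product of a wave function with the orbital `conj u` in the variable `j`. -/
def slot {n : ℕ} (Φ : (Fin (n + 1) → E3) → ℂ) (u : E3 → ℂ) (j : Fin (n + 1))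
    (x : Fin n → E3) : ℂ := ∫ y, u y * Φ (ins j y x)

lemma continuous_slot {n : ℕ} {Φ : (Fin (n + 1) → E3) → ℂ} {u : E3 → ℂ} (hΦ : Continuous Φ)
    (hu : Continuous u) (hc : HasCompactSupport u) (j : Fin (n + 1)) :
    Continuous (slot Φ u j) := by
  have : slot Φ u j = fun x => ∫ y in tsupport u, u y * Φ (ins j y x) := by
    ext x
    rw [setIntegral_eq_integral_of_forall_compl_eq_zero]
    · rfl
    · intro y hy
      rw [image_eq_zero_of_notMem_tsupport hy, zero_mul]
  rw [this]
  apply continuous_parametric_integral_of_continuous _ hc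
  have h := continuous_ins (n := n) j
  exact (hu.comp continuous_snd).mul (hΦ.comp (h.comp (continuous_snd.prodMk continuous_fst)))

/-- The projection of a wave function onto the orbital `conj u` in the variable `j`. -/
def proj {n : ℕ} (Φ : (Fin (n + 1) → E3) → ℂ) (u : E3 → ℂ) (j : Fin (n + 1))
    (x : Fin (n + 1) → E3) : ℂ := (starRingEnd ℂ) (u (x j)) * slot Φ u j (rem j x)

lemma continuous_proj {n : ℕ} {Φ : (Fin (n + 1) → E3) → ℂ} {u : E3 → ℂ} (hΦ : Continuous Φ)
    (hu : Continuous u) (hc : HasCompactSupport u) (j : Fin (n + 1)) :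
    Continuous (proj Φ u j) := by
  unfold proj
  exact (Complex.continuous_conj.comp (hu.comp (continuous_apply j))).mul
    ((continuous_slot hΦ hu hc j).comp (continuous_rem j))

lemma slot_eq_zero {n : ℕ} {Φ : (Fin (n + 1) → E3) → ℂ} {u : E3 → ℂ} {j : Fin (n + 1)}
    {x : Fin n → E3} (hx : x ∉ rem j '' tsupport Φ) : slot Φ u j x = 0 := by
  unfold slot
  have : ∀ y, u y * Φ (ins j y x) = 0 := by
    intro y
    have h0 : Φ (ins j y x) = 0 :=
      image_eq_zero_of_notMem_tsupport fun h => hx ⟨_, h, by simp⟩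
    rw [h0, mul_zero]
  simp [this]

lemma hasCompactSupport_slot {n : ℕ} {Φ : (Fin (n + 1) → E3) → ℂ} {u : E3 → ℂ}
    (hcΦ : HasCompactSupport Φ) (j : Fin (n + 1)) :
    HasCompactSupport (slot Φ u j) :=
  HasCompactSupport.intro (IsCompact.image hcΦ (continuous_rem j)) fun _ hx => slot_eq_zero hx

lemma hasCompactSupport_proj {n : ℕ} {Φ : (Fin (n + 1) → E3) → ℂ} {u : E3 → ℂ}
    (hcΦ : HasCompactSupport Φ) (hc : HasCompactSupport u) (j : Fin (n + 1)) :
    HasCompactSupport (proj Φ u j) := by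
  have hK : IsCompact ((fun p : E3 × (Fin n → E3) => ins j p.1 p.2) ''
      (tsupport u ×ˢ (rem j '' tsupport Φ))) :=
    (IsCompact.prod hc (IsCompact.image hcΦ (continuous_rem j))).image (continuous_ins j)
  refine HasCompactSupport.intro hK fun x hx => ?_
  unfold proj
  by_contra hne
  apply hx
  refine ⟨(x j, rem j x), ⟨?_, ?_⟩, by simp⟩
  · by_contra h
    exact hne (by simp [image_eq_zero_of_notMem_tsupport h])
  · by_contra h
    exact hne (by simp [slot_eq_zero h])

lemma integral_conj_proj_mul_self {n : ℕ} {Φ : (Fin (n + 1) → E3) → ℂ} {u : E3 → ℂ}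
    (hΦ : Continuous Φ) (hcΦ : HasCompactSupport Φ)
    (hu : Continuous u) (hc : HasCompactSupport u) (j : Fin (n + 1)) :
    ∫ x, (starRingEnd ℂ) (proj Φ u j x) * Φ x = ((∫ x, ‖slot Φ u j x‖ ^ 2 : ℝ) : ℂ) := by
  have hint : Integrable fun x => (starRingEnd ℂ) (proj Φ u j x) * Φ x :=
    Continuous.integrable_of_hasCompactSupport
      ((Complex.continuous_conj.comp (continuous_proj hΦ hu hc j)).mul hΦ) hcΦ.mul_left
  rw [integral_slice j hint, ← integral_complex_ofReal]
  congr 1; ext x'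
  simp only [proj, ins_same, rem_ins, map_mul, Complex.conj_conj]
  have : ∀ y, u y * (starRingEnd ℂ) (slot Φ u j x') * Φ (ins j y x') =
      (starRingEnd ℂ) (slot Φ u j x') * (u y * Φ (ins j y x')) := fun y => by ring
  simp only [this]
  rw [integral_const_mul]
  change (starRingEnd ℂ) (slot Φ u j x') * slot Φ u j x' = _
  rw [mul_comm, Complex.mul_conj, Complex.normSq_eq_norm_sq]

lemma integral_conj_proj_mul_proj_self {n : ℕ} {Φ : (Fin (n + 1) → E3) → ℂ} {u : E3 → ℂ}
    (hΦ : Continuous Φ) (hcΦ : HasCompactSupport Φ)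
    (hu : Continuous u) (hc : HasCompactSupport u) (j : Fin (n + 1)) :
    ∫ x, (starRingEnd ℂ) (proj Φ u j x) * proj Φ u j x =
      (((∫ y, ‖u y‖ ^ 2) * ∫ x, ‖slot Φ u j x‖ ^ 2 : ℝ) : ℂ) := by
  have hint : Integrable fun x => (starRingEnd ℂ) (proj Φ u j x) * proj Φ u j x :=
    Continuous.integrable_of_hasCompactSupport
      ((Complex.continuous_conj.comp (continuous_proj hΦ hu hc j)).mul
        (continuous_proj hΦ hu hc j)) (hasCompactSupport_proj hcΦ hc j).mul_left
  rw [integral_slice j hint, ← integral_const_mul, ← integral_complex_ofReal]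
  congr 1; ext x'
  simp only [proj, ins_same, rem_ins, map_mul, Complex.conj_conj]
  have : ∀ y, u y * (starRingEnd ℂ) (slot Φ u j x') * ((starRingEnd ℂ) (u y) * slot Φ u j x') =
      ((‖u y‖ ^ 2 : ℝ) : ℂ) * ((‖slot Φ u j x'‖ ^ 2 : ℝ) : ℂ) := fun y => by
    rw [← Complex.normSq_eq_norm_sq, ← Complex.normSq_eq_norm_sq, ← Complex.mul_conj,
      ← Complex.mul_conj]
    ring
  simp only [this]
  rw [integral_mul_const, integral_complex_ofReal]
  push_cast
  ring

lemma integral_conj_proj_mul_proj_of_ne {n : ℕ} {Φ : (Fin (n + 1) → E3) → ℂ} {u : E3 → ℂ}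
    (hΦ : Continuous Φ) (hcΦ : HasCompactSupport Φ)
    (hu : Continuous u) (hc : HasCompactSupport u) {i j : Fin (n + 1)} (hij : i ≠ j)
    (hanti : ∀ x : Fin (n + 1) → E3, Φ (fun k => x (Equiv.swap i j k)) = - Φ x) :
    ∫ x, (starRingEnd ℂ) (proj Φ u i x) * proj Φ u j x = 0 := by
  have hint : Integrable fun x => (starRingEnd ℂ) (proj Φ u i x) * proj Φ u j x :=
    Continuous.integrable_of_hasCompactSupport
      ((Complex.continuous_conj.comp (continuous_proj hΦ hu hc i)).mul
        (continuous_proj hΦ hu hc j)) (hasCompactSupport_proj hcΦ hc j).mul_left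
  rw [integral_slice i hint]
  refine integral_eq_zero_of_ae (Filter.Eventually.of_forall fun x' => ?_)
  simp only [proj, ins_same, rem_ins, map_mul, Complex.conj_conj, Pi.zero_apply]
  set b := ins i 0 x' j
  have hb : ∀ y, ins i y x' j = b := fun y => ins_of_ne hij.symm _ _ _
  have : ∀ y, u y * (starRingEnd ℂ) (slot Φ u i x') *
      ((starRingEnd ℂ) (u (ins i y x' j)) * slot Φ u j (rem j (ins i y x'))) =
      ((starRingEnd ℂ) (slot Φ u i x') * (starRingEnd ℂ) (u b)) *
        ∫ z, u y * (u z * Φ (Function.update (ins i y x') j z)) := fun y => by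
    rw [hb, integral_const_mul, slot.eq_def _ _ j]
    simp only [ins_rem_eq_update]
    ring
  simp only [this]
  rw [integral_const_mul]
  have hcont : Continuous fun p : E3 × E3 =>
      u p.1 * (u p.2 * Φ (Function.update (ins i p.1 x') j p.2)) := by
    refine (hu.comp continuous_fst).mul ((hu.comp continuous_snd).mul (hΦ.comp ?_))
    exact Continuous.update ((continuous_ins i).comp (continuous_fst.prodMk continuous_const)) j
      continuous_snd
  have hint2 : Integrable (fun p : E3 × E3 =>
      u p.1 * (u p.2 * Φ (Function.update (ins i p.1 x') j p.2))) (volume.prod volume) := by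
    refine Continuous.integrable_of_hasCompactSupport hcont ?_
    refine HasCompactSupport.intro (IsCompact.prod hc hc) fun p hp => ?_
    by_contra hne
    apply hp
    constructor
    · by_contra h
      exact hne (by simp [image_eq_zero_of_notMem_tsupport h])
    · by_contra h
      exact hne (by simp [image_eq_zero_of_notMem_tsupport h])
  have hswap := integral_integral_swap
    (f := fun y z => u y * (u z * Φ (Function.update (ins i y x') j z))) hint2
  have hanti2 : ∀ y z, Φ (Function.update (ins i z x') j y) =
      - Φ (Function.update (ins i y x') j z) := by
    intro y z
    rw [← hanti]
    congr 1
    ext1 k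
    by_cases hki : k = i
    · subst hki
      rw [Equiv.swap_apply_left, Function.update_self, Function.update_of_ne hij, ins_same]
    · by_cases hkj : k = j
      · subst hkj
        rw [Equiv.swap_apply_right, Function.update_self, Function.update_of_ne hij, ins_same]
      · rw [Equiv.swap_apply_of_ne_of_ne hki hkj, Function.update_of_ne hkj,
          Function.update_of_ne hkj]
        exact ins_of_ne hki _ _ _
  have hz : (∫ y, ∫ z, u y * (u z * Φ (Function.update (ins i y x') j z))) =
      - ∫ y, ∫ z, u y * (u z * Φ (Function.update (ins i y x') j z)) := by
    conv_lhs => rw [hswap]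
    rw [← integral_neg]
    congr 1; ext y
    rw [← integral_neg]
    congr 1; ext z
    rw [hanti2]
    ring
  have := self_eq_neg.1 hz
  rw [this, mul_zero]

/-- The part of the projections acting on the particles with spin `σ`. -/
def spinProj {n : ℕ} (Ψ : (Fin (n + 1) → E3) → (Fin (n + 1) → Fin 2) → ℂ) (u : E3 → ℂ) (σ : Fin 2)
    (s : Fin (n + 1) → Fin 2) (j : Fin (n + 1)) (x : Fin (n + 1) → E3) : ℂ :=
  if s j = σ then proj (fun x => Ψ x s) u j x else 0

lemma integral_norm_sub_sq {X : Type*} [MeasurableSpace X] [TopologicalSpace X] [BorelSpace X]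
    {μ : Measure X} [IsFiniteMeasureOnCompacts μ] [SecondCountableTopology X]
    {n : ℕ} {Φ : X → ℂ} {w : Fin n → X → ℂ}
    (hΦ : Continuous Φ) (hcΦ : HasCompactSupport Φ) (hw : ∀ j, Continuous (w j))
    (hcw : ∀ j, HasCompactSupport (w j)) (q : Fin n → ℝ) (L : ℝ)
    (h1 : ∀ j, ∫ x, (starRingEnd ℂ) (w j x) * Φ x ∂μ = (q j : ℂ))
    (h2 : ∀ i j, ∫ x, (starRingEnd ℂ) (w i x) * w j x ∂μ = if i = j then (L * q i : ℂ) else 0)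
    (t : ℝ) :
    ∫ x, ‖Φ x - t * ∑ j, w j x‖ ^ 2 ∂μ =
      ∫ x, ‖Φ x‖ ^ 2 ∂μ - 2 * t * ∑ j, q j + t ^ 2 * L * ∑ j, q j := by
  have hpt : ∀ x, ‖Φ x - t * ∑ j, w j x‖ ^ 2 = ‖Φ x‖ ^ 2
      - 2 * t * ∑ j, ((starRingEnd ℂ) (w j x) * Φ x).re
      + t ^ 2 * ∑ i, ∑ j, ((starRingEnd ℂ) (w i x) * w j x).re := by
    intro x
    have e1 : ∑ j, ((starRingEnd ℂ) (w j x) * Φ x).re =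
        ((starRingEnd ℂ) (∑ j, w j x) * Φ x).re := by
      rw [map_sum, Finset.sum_mul, Complex.re_sum]
    have e2 : ∑ i, ∑ j, ((starRingEnd ℂ) (w i x) * w j x).re =
        ((starRingEnd ℂ) (∑ j, w j x) * ∑ j, w j x).re := by
      rw [map_sum, Finset.sum_mul_sum, Complex.re_sum]
      simp only [Complex.re_sum]
    rw [e1, e2]
    generalize (∑ j, w j x) = W
    rw [← Complex.normSq_eq_norm_sq, ← Complex.normSq_eq_norm_sq]
    simp only [Complex.normSq_apply, Complex.mul_re, Complex.sub_re, Complex.sub_im,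
      Complex.conj_re, Complex.conj_im, Complex.mul_im, Complex.ofReal_re, Complex.ofReal_im]
    ring
  have i0 : Integrable (fun x => ‖Φ x‖ ^ 2) μ := by
    apply Continuous.integrable_of_hasCompactSupport (by fun_prop)
    exact hcΦ.comp_left (g := fun z : ℂ => ‖z‖ ^ 2) (by simp)
  have i1 : ∀ j, Integrable (fun x => (starRingEnd ℂ) (w j x) * Φ x) μ := fun j =>
    Continuous.integrable_of_hasCompactSupport
      ((Complex.continuous_conj.comp (hw j)).mul hΦ) hcΦ.mul_left
  have i2 : ∀ i j, Integrable (fun x => (starRingEnd ℂ) (w i x) * w j x) μ := fun i j =>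
    Continuous.integrable_of_hasCompactSupport
      ((Complex.continuous_conj.comp (hw i)).mul (hw j)) (hcw j).mul_left
  have r1 : ∀ j, ∫ x, ((starRingEnd ℂ) (w j x) * Φ x).re ∂μ = q j := fun j => by
    have := integral_re (i1 j)
    simp only [RCLike.re_to_complex] at this
    rw [this, h1]; simp
  have r2 : ∀ i j, ∫ x, ((starRingEnd ℂ) (w i x) * w j x).re ∂μ = if i = j then L * q i else 0 :=
    fun i j => by
    have := integral_re (i2 i j)
    simp only [RCLike.re_to_complex] at this
    rw [this, h2]; split_ifs <;> simp
  simp only [hpt]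
  rw [integral_add, integral_sub, integral_const_mul, integral_const_mul, integral_finsetSum,
    integral_finsetSum]
  · simp only [r1]
    congr 1
    rw [mul_assoc]
    congr 1
    rw [Finset.mul_sum]
    refine Finset.sum_congr rfl fun i _ => ?_
    rw [integral_finsetSum]
    · simp only [r2]
      simp
    · exact fun j _ => (i2 i j).re
  · exact fun i _ => integrable_finsetSum _ fun j _ => (i2 i j).re
  · exact fun i _ => (i1 i).re
  · exact i0
  · exact (integrable_finsetSum _ fun i _ => (i1 i).re).const_mul _
  · exact i0.sub ((integrable_finsetSum _ fun i _ => (i1 i).re).const_mul _)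
  · exact (integrable_finsetSum _ fun i _ =>
      integrable_finsetSum _ fun j _ => (i2 i j).re).const_mul _

lemma exclusion_spin {n : ℕ} {Ψ : (Fin (n + 1) → E3) → (Fin (n + 1) → Fin 2) → ℂ}
    (hΨ : IsWaveFun (n + 1) Ψ) {u : E3 → ℂ} (hu : Continuous u) (hc : HasCompactSupport u)
    (σ : Fin 2) :
    ∑ s, ∑ j, (if s j = σ then ∫ x, ‖slot (fun x => Ψ x s) u j x‖ ^ 2 else 0) ≤
      ∫ y, ‖u y‖ ^ 2 := by
  set L := ∫ y, ‖u y‖ ^ 2 with hL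
  set q : (Fin (n + 1) → Fin 2) → Fin (n + 1) → ℝ := fun s j =>
    if s j = σ then ∫ x, ‖slot (fun x => Ψ x s) u j x‖ ^ 2 else 0 with hq
  set Q := ∑ s, ∑ j, q s j with hQ
  have hL0 : 0 ≤ L := integral_nonneg fun _ => by positivity
  have hcont : ∀ s, Continuous fun x => Ψ x s := fun s => (hΨ.smooth s).continuous
  have key : ∀ t : ℝ, 0 ≤ 1 - 2 * t * Q + t ^ 2 * L * Q := by
    intro t
    have hs : ∀ s, ∫ x, ‖Ψ x s - t * ∑ j, spinProj Ψ u σ s j x‖ ^ 2 =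
        (∫ x, ‖Ψ x s‖ ^ 2) - 2 * t * ∑ j, q s j + t ^ 2 * L * ∑ j, q s j := by
      intro s
      refine integral_norm_sub_sq (w := spinProj Ψ u σ s) (hcont s) (hΨ.compactSupport s)
        ?_ ?_ (q s) L ?_ ?_ t
      · intro j
        unfold spinProj
        split_ifs
        · exact continuous_proj (hcont s) hu hc j
        · exact continuous_const
      · intro j
        unfold spinProj
        split_ifs
        · exact hasCompactSupport_proj (hΨ.compactSupport s) hc j
        · exact HasCompactSupport.zero
      · intro j
        simp only [spinProj, hq]
        split_ifs
        · exact integral_conj_proj_mul_self (hcont s) (hΨ.compactSupport s) hu hc j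
        · simp
      · intro i j
        simp only [spinProj, hq]
        by_cases hij : i = j
        · subst hij
          by_cases hi : s i = σ
          · simp only [hi, if_true]
            rw [integral_conj_proj_mul_proj_self (hcont s) (hΨ.compactSupport s) hu hc i]
            push_cast
            rfl
          · simp [hi]
        · by_cases hi : s i = σ
          · by_cases hj : s j = σ
            · simp only [hi, hj, hij, if_true, if_false]
              refine integral_conj_proj_mul_proj_of_ne (hcont s) (hΨ.compactSupport s) hu hc hij ?_
              intro x
              have h := hΨ.antisymm (Equiv.swap i j) x s
              rw [Equiv.Perm.sign_swap hij] at h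
              have hss : (fun k => s (Equiv.swap i j k)) = s := by
                ext1 k
                by_cases hk : k = i
                · subst hk; rw [Equiv.swap_apply_left, hi, hj]
                · by_cases hk' : k = j
                  · subst hk'; rw [Equiv.swap_apply_right, hi, hj]
                  · rw [Equiv.swap_apply_of_ne_of_ne hk hk']
              rw [hss] at h
              simpa using h
            · simp [hj, hij]
          · simp [hi, hij]
    have h0 : 0 ≤ ∑ s, ∫ x, ‖Ψ x s - t * ∑ j, spinProj Ψ u σ s j x‖ ^ 2 :=
      Finset.sum_nonneg fun s _ => integral_nonneg fun _ => by positivity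
    simp only [hs] at h0
    rw [Finset.sum_add_distrib, Finset.sum_sub_distrib, ← Finset.mul_sum, ← Finset.mul_sum,
      hΨ.normalized] at h0
    exact h0
  have hQ0 : 0 ≤ Q := by
    refine Finset.sum_nonneg fun s _ => Finset.sum_nonneg fun j _ => ?_
    simp only [hq]
    split_ifs
    · exact integral_nonneg fun _ => by positivity
    · exact le_rfl
  rcases hL0.eq_or_lt with h | h
  · by_contra! hlt
    have := key (1 / Q)
    rw [← h] at this hlt
    have h2 : 2 * (1 / Q) * Q = 2 := by field_simp
    rw [h2] at this
    linarith
  · have := key (1 / L)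
    have h2 : (1 / L) ^ 2 * L * Q = Q / L := by field_simp
    have h3 : 2 * (1 / L) * Q = 2 * (Q / L) := by ring
    rw [h2, h3] at this
    have : Q / L ≤ 1 := by linarith
    rwa [div_le_one h] at this

/-- Exclusion principle: the expected number of particles in a given orbital is at most the number
of spin states. -/
lemma exclusion {n : ℕ} {Ψ : (Fin (n + 1) → E3) → (Fin (n + 1) → Fin 2) → ℂ}
    (hΨ : IsWaveFun (n + 1) Ψ) {u : E3 → ℂ} (hu : Continuous u) (hc : HasCompactSupport u) :
    ∑ s, ∑ j, ∫ x, ‖slot (fun x => Ψ x s) u j x‖ ^ 2 ≤ 2 * ∫ y, ‖u y‖ ^ 2 := by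
  have h0 := exclusion_spin hΨ hu hc 0
  have h1 := exclusion_spin hΨ hu hc 1
  have : ∀ s : Fin (n + 1) → Fin 2, ∀ j, ∫ x, ‖slot (fun x => Ψ x s) u j x‖ ^ 2 =
      (if s j = 0 then ∫ x, ‖slot (fun x => Ψ x s) u j x‖ ^ 2 else 0) +
      (if s j = 1 then ∫ x, ‖slot (fun x => Ψ x s) u j x‖ ^ 2 else 0) := by
    intro s j
    generalize s j = σ
    fin_cases σ <;> simp
  rw [Finset.sum_congr rfl fun s _ => Finset.sum_congr rfl fun j _ => this s j]
  simp only [Finset.sum_add_distrib]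
  linarith

lemma sq_lintegral_le {X : Type*} [MeasurableSpace X] {μ : Measure X} [IsProbabilityMeasure μ]
    {f : X → ENNReal} (hf : AEMeasurable f μ) : (∫⁻ x, f x ∂μ) ^ 2 ≤ ∫⁻ x, f x ^ 2 ∂μ := by
  have h := ENNReal.lintegral_mul_le_Lp_mul_Lq μ Real.HolderConjugate.two_two hf
    (aemeasurable_const (b := (1 : ENNReal)))
  simp only [Pi.mul_apply, mul_one, ENNReal.one_rpow, lintegral_const, measure_univ] at h
  calc (∫⁻ x, f x ∂μ) ^ 2 ≤ ((∫⁻ x, f x ^ (2 : ℝ) ∂μ) ^ (1 / 2 : ℝ)) ^ 2 := by gcongr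
    _ = ∫⁻ x, f x ^ 2 ∂μ := by
      rw [← ENNReal.rpow_natCast, ← ENNReal.rpow_mul]
      norm_num

lemma enorm_sq_integral_le {X : Type*} [MeasurableSpace X] {μ : Measure X} [IsProbabilityMeasure μ]
    {G : Type*} [NormedAddCommGroup G] [NormedSpace ℝ G]
    {f : X → G} (hf : AEStronglyMeasurable f μ) : ‖∫ x, f x ∂μ‖ₑ ^ 2 ≤ ∫⁻ x, ‖f x‖ₑ ^ 2 ∂μ :=
  (pow_le_pow_left' (enorm_integral_le_lintegral_enorm f) 2).trans (sq_lintegral_le hf.enorm)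

lemma enorm_sq_eq_ofReal {G : Type*} [NormedAddCommGroup G] (z : G) :
    ‖z‖ₑ ^ 2 = ENNReal.ofReal (‖z‖ ^ 2) := by
  rw [← ofReal_norm, ENNReal.ofReal_pow (norm_nonneg _)]

/-- The integral of `b` along the segment from `x` to `x + v`. -/
def segInt {V : Type*} [AddCommGroup V] [Module ℝ V] (b : V → ℝ) (x v : V) (t : ℝ) : ℝ :=
  ∫ u in (0 : ℝ)..t, b (x + u • v)

lemma enorm_sq_sub_le_of_hasDerivAt {G : Type*} [NormedAddCommGroup G] [NormedSpace ℝ G]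
    [CompleteSpace G] {g g' : ℝ → G} (h : ∀ t, HasDerivAt g (g' t) t) (hg' : Continuous g') :
    ‖g 1 - g 0‖ₑ ^ 2 ≤ ∫⁻ t in Set.Ioc (0 : ℝ) 1, ‖g' t‖ₑ ^ 2 := by
  have : g 1 - g 0 = ∫ t in Set.Ioc (0 : ℝ) 1, g' t := by
    rw [← intervalIntegral.integral_of_le zero_le_one]
    exact (intervalIntegral.integral_eq_sub_of_hasDerivAt (fun t _ => h t)
      (hg'.intervalIntegrable _ _)).symm
  rw [this]
  have : IsProbabilityMeasure (volume.restrict (Set.Ioc (0 : ℝ) 1)) :=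
    ⟨by simp⟩
  exact enorm_sq_integral_le hg'.aestronglyMeasurable

section Shift

variable {V : Type*} [NormedAddCommGroup V] [NormedSpace ℝ V] [MeasurableSpace V] [BorelSpace V]

/-- The magnetic translation by `v` moves a function by at most its covariant derivative along
`v`. -/
lemma lintegral_sub_shift_le {μ : Measure V} [μ.IsAddRightInvariant] [SFinite μ] {f : V → ℂ}
    (hf : ContDiff ℝ 1 f) {b : V → ℝ} (hb : Continuous b) (v : V) :
    ∫⁻ x, ‖f x - Complex.exp (Complex.I * segInt b x v 1) * f (x + v)‖ₑ ^ 2 ∂μ ≤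
      ∫⁻ x, ‖fderiv ℝ f x v + Complex.I * b x * f x‖ₑ ^ 2 ∂μ := by
  set D : V → ℂ := fun x => fderiv ℝ f x v + Complex.I * b x * f x with hD
  have hDc : Continuous D := by
    have h1 : Continuous fun x => fderiv ℝ f x v :=
      (hf.continuous_fderiv (by simp)).clm_apply continuous_const
    have h2 := hf.continuous
    fun_prop
  have hpt : ∀ x, ‖f x - Complex.exp (Complex.I * segInt b x v 1) * f (x + v)‖ₑ ^ 2 ≤
      ∫⁻ t in Set.Ioc (0 : ℝ) 1, ‖D (x + t • v)‖ₑ ^ 2 := by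
    intro x
    set g : ℝ → ℂ := fun t => Complex.exp (Complex.I * segInt b x v t) * f (x + t • v)
    set g' : ℝ → ℂ := fun t => Complex.exp (Complex.I * segInt b x v t) * D (x + t • v)
    have hθ : ∀ t, HasDerivAt (fun t => segInt b x v t) (b (x + t • v)) t := fun t =>
      intervalIntegral.integral_hasDerivAt_right
        (Continuous.intervalIntegrable (by fun_prop) _ _)
        (Continuous.stronglyMeasurableAtFilter (by fun_prop) _ _)
        (Continuous.continuousAt (by fun_prop))
    have hder : ∀ t, HasDerivAt g (g' t) t := by
      intro t
      have h1 : HasDerivAt (fun t : ℝ => Complex.exp (Complex.I * segInt b x v t))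
          (Complex.exp (Complex.I * segInt b x v t) * (Complex.I * b (x + t • v))) t :=
        ((hθ t).ofReal_comp.const_mul Complex.I).cexp
      have h2 : HasDerivAt (fun t : ℝ => f (x + t • v)) (fderiv ℝ f (x + t • v) v) t := by
        have h3 : HasDerivAt (fun t : ℝ => x + t • v) v t := by
          simpa using ((hasDerivAt_id t).smul_const v).const_add x
        exact ((hf.differentiable (by simp)) _).hasFDerivAt.comp_hasDerivAt t h3
      have := h1.mul h2
      refine this.congr_deriv ?_
      simp only [g', hD]
      ring
    have hsc : Continuous fun t => segInt b x v t :=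
      continuous_iff_continuousAt.2 fun t => (hθ t).continuousAt
    have hg'c : Continuous g' := by fun_prop
    have := enorm_sq_sub_le_of_hasDerivAt hder hg'c
    have e0 : g 0 = f x := by simp [g, segInt]
    have e1 : g 1 = Complex.exp (Complex.I * segInt b x v 1) * f (x + v) := by simp [g]
    rw [e0, e1, ← enorm_neg, neg_sub] at this
    refine this.trans_eq ?_
    refine lintegral_congr fun t => ?_
    simp only [g', enorm_mul]
    have : ‖Complex.exp (Complex.I * segInt b x v t)‖ₑ = 1 := by
      rw [← ofReal_norm, mul_comm, Complex.norm_exp_ofReal_mul_I]; simp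
    rw [this, one_mul]
  calc _ ≤ ∫⁻ x, (∫⁻ t in Set.Ioc (0 : ℝ) 1, ‖D (x + t • v)‖ₑ ^ 2) ∂μ := lintegral_mono hpt
    _ = ∫⁻ t in Set.Ioc (0 : ℝ) 1, (∫⁻ x, ‖D (x + t • v)‖ₑ ^ 2 ∂μ) := by
      apply lintegral_lintegral_swap
      exact (Continuous.measurable (by fun_prop)).aemeasurable
    _ = ∫⁻ t in Set.Ioc (0 : ℝ) 1, (∫⁻ x, ‖D x‖ₑ ^ 2 ∂μ) := by
      refine lintegral_congr fun t => ?_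
      exact lintegral_add_right_eq_self (fun x => ‖D x‖ₑ ^ 2) _
    _ = ∫⁻ x, ‖D x‖ₑ ^ 2 ∂μ := by simp

end Shift

/-- A continuous probability density on the ball of radius `r`. -/
lemma exists_mollifier {r : ℝ} (hr : 0 < r) : ∃ k : E3 → ℝ, Continuous k ∧ (∀ y, 0 ≤ k y) ∧
    HasCompactSupport k ∧ (∀ y, k y ≠ 0 → ‖y‖ ≤ r) ∧ ∫⁻ y, ENNReal.ofReal (k y) = 1 ∧
    ∫⁻ y, ENNReal.ofReal (k y) ^ 2 ≤ ENNReal.ofReal (r⁻¹ ^ 3) := by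
  let φ : ContDiffBump (0 : E3) := ⟨r / 2, r, by positivity, by linarith⟩
  have hcont : Continuous (φ.normed volume) := φ.continuous_normed
  have hnn : ∀ y, 0 ≤ φ.normed volume y := fun y => φ.nonneg_normed y
  have hint : ∫⁻ y, ENNReal.ofReal (φ.normed volume y) = 1 := by
    rw [← ofReal_integral_eq_lintegral_ofReal φ.integrable_normed (Filter.Eventually.of_forall hnn),
      φ.integral_normed, ENNReal.ofReal_one]
  have hle : ∀ y, φ.normed volume y ≤ r⁻¹ ^ 3 := by
    intro y
    refine (φ.normed_le_div_measure_closedBall_rIn volume y).trans_eq ?_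
    have : volume.real (Metric.closedBall (0 : E3) φ.rIn) = r ^ 3 := by
      have h : φ.rIn = r / 2 := rfl
      rw [Measure.real, h, Real.volume_pi_closedBall _ (by positivity)]
      simp [Fintype.card_fin]
      rw [mul_div_cancel₀ _ (by norm_num)]; simp [hr.le]
    rw [this]; simp
  refine ⟨φ.normed volume, hcont, hnn, φ.hasCompactSupport_normed, ?_, hint, ?_⟩
  · intro y hy
    have : y ∈ Function.support (φ.normed volume) := hy
    rw [φ.support_normed_eq] at this
    simpa using (Metric.mem_ball.1 this).le
  · calc ∫⁻ y, ENNReal.ofReal (φ.normed volume y) ^ 2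
        ≤ ∫⁻ y, ENNReal.ofReal (r⁻¹ ^ 3) * ENNReal.ofReal (φ.normed volume y) := by
          refine lintegral_mono fun y => ?_
          rw [sq]
          gcongr
          exact hle y
      _ = _ := by rw [lintegral_const_mul _ (by fun_prop), hint, mul_one]

/-- The one-particle density of a wave function, as a measure on space. -/
def dens (N : ℕ) (Ψ : (Fin N → E3) → (Fin N → Fin 2) → ℂ) : Measure E3 :=
  ∑ s : Fin N → Fin 2, ∑ j : Fin N,
    Measure.map (fun x : Fin N → E3 => x j) (volume.withDensity fun x => ‖Ψ x s‖ₑ ^ 2)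

lemma lintegral_dens {N : ℕ} {Ψ : (Fin N → E3) → (Fin N → Fin 2) → ℂ}
    (hΨ : ∀ s, Continuous fun x => Ψ x s) {w : E3 → ENNReal} (hw : Measurable w) :
    ∫⁻ a, w a ∂(dens N Ψ) = ∑ s, ∑ j, ∫⁻ x, w (x j) * ‖Ψ x s‖ₑ ^ 2 := by
  unfold dens
  rw [lintegral_finsetSum_measure]
  refine Finset.sum_congr rfl fun s _ => ?_
  rw [lintegral_finsetSum_measure]
  refine Finset.sum_congr rfl fun j _ => ?_
  rw [lintegral_map hw (measurable_pi_apply j), lintegral_withDensity_eq_lintegral_mul]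
  · simp only [Pi.mul_apply, mul_comm]
  · have := hΨ s
    exact Continuous.measurable (by fun_prop)
  · exact hw.comp (measurable_pi_apply j)

lemma dens_apply {N : ℕ} {Ψ : (Fin N → E3) → (Fin N → Fin 2) → ℂ}
    (hΨ : ∀ s, Continuous fun x => Ψ x s) {Ω : Set E3} (hΩ : MeasurableSet Ω) :
    dens N Ψ Ω = ∑ s, ∑ j, ∫⁻ x, Ω.indicator 1 (x j) * ‖Ψ x s‖ₑ ^ 2 := by
  rw [← lintegral_dens hΨ (measurable_one.indicator hΩ), lintegral_indicator_one hΩ]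

/-- The circulation of `A` along the segment from `a` to `a + y`. -/
def phase (A : E3 → E3) (a y : E3) : ℝ := ∫ u in (0 : ℝ)..1, ∑ k, A (a + u • y) k * y k

lemma continuous_phase {A : E3 → E3} (hA : Continuous A) :
    Continuous fun p : E3 × E3 => phase A p.1 p.2 := by
  unfold phase
  apply intervalIntegral.continuous_parametric_intervalIntegral_of_continuous'
  have hAk : ∀ k, Continuous fun x => A x k := fun k => (continuous_apply k).comp hA
  fun_prop

/-- The average over magnetic translations of particle `j`. -/
def magAvg {N : ℕ} (A : E3 → E3) (k : E3 → ℝ) (Φ : (Fin N → E3) → ℂ) (j : Fin N)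
    (x : Fin N → E3) : ℂ :=
  ∫ y, (k y : ℂ) * (Complex.exp (Complex.I * phase A (x j) y) * Φ (x + Pi.single j y))

lemma continuous_single_apply {N : ℕ} (j : Fin N) :
    Continuous fun y : E3 => (Pi.single j y : Fin N → E3) :=
  _root_.continuous_single (A := fun _ : Fin N => E3) j

lemma continuous_magAvg {N : ℕ} {A : E3 → E3} (hA : Continuous A) {k : E3 → ℝ} (hk : Continuous k)
    (hck : HasCompactSupport k) {Φ : (Fin N → E3) → ℂ} (hΦ : Continuous Φ) (j : Fin N) :
    Continuous (magAvg A k Φ j) := by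
  have : magAvg A k Φ j = fun x => ∫ y in tsupport k,
      (k y : ℂ) * (Complex.exp (Complex.I * phase A (x j) y) * Φ (x + Pi.single j y)) := by
    ext x
    rw [setIntegral_eq_integral_of_forall_compl_eq_zero]
    · rfl
    · intro y hy
      rw [image_eq_zero_of_notMem_tsupport hy]; simp
  rw [this]
  apply continuous_parametric_integral_of_continuous _ hck
  have h1 : Continuous fun p : (Fin N → E3) × E3 => phase A (p.1 j) p.2 :=
    (continuous_phase hA).comp (f := fun p : (Fin N → E3) × E3 => (p.1 j, p.2)) (by fun_prop)
  have h2 := (continuous_single_apply j).comp (continuous_snd (X := Fin N → E3))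
  simp only [Function.uncurry_def]
  have h3 : Continuous fun p : (Fin N → E3) × E3 => Φ (p.1 + Pi.single j p.2) :=
    hΦ.comp (continuous_fst.add h2)
  fun_prop

lemma ins_add_single {n : ℕ} (j : Fin (n + 1)) (a y : E3) (x : Fin n → E3) :
    ins j a x + Pi.single j y = ins j (a + y) x := by
  ext1 i
  refine Fin.succAboveCases j ?_ ?_ i
  · simp
  · intro i
    simp [ins]

/-- The orbital whose slot integral is the magnetic average at `a`. -/
def magOrb (A : E3 → E3) (k : E3 → ℝ) (a : E3) (z : E3) : ℂ :=
  (k (z - a) : ℂ) * Complex.exp (Complex.I * phase A a (z - a))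

lemma magAvg_ins {n : ℕ} (A : E3 → E3) (k : E3 → ℝ) (Φ : (Fin (n + 1) → E3) → ℂ) (j : Fin (n + 1))
    (a : E3) (x : Fin n → E3) :
    magAvg A k Φ j (ins j a x) = slot Φ (magOrb A k a) j x := by
  unfold magAvg slot magOrb
  rw [← integral_add_right_eq_self (fun z => (k (z - a) : ℂ) *
    Complex.exp (Complex.I * phase A a (z - a)) * Φ (ins j z x)) a]
  congr 1; ext y
  rw [ins_add_single, ins_same, add_sub_cancel_right, mul_assoc, add_comm y a]

lemma continuous_magOrb {A : E3 → E3} (hA : Continuous A) {k : E3 → ℝ} (hk : Continuous k) (a : E3) :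
    Continuous (magOrb A k a) := by
  unfold magOrb
  have h1 : Continuous fun z : E3 => phase A a (z - a) :=
    (continuous_phase hA).comp (continuous_const.prodMk (continuous_id.sub continuous_const))
  fun_prop

lemma hasCompactSupport_magOrb (A : E3 → E3) {k : E3 → ℝ} (hck : HasCompactSupport k) (a : E3) :
    HasCompactSupport (magOrb A k a) := by
  have h : HasCompactSupport fun z => k (z - a) := by
    simpa [sub_eq_add_neg, Function.comp_def] using hck.comp_homeomorph (Homeomorph.addRight (-a))
  have h2 : HasCompactSupport fun z => ((k (z - a) : ℝ) : ℂ) :=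
    h.comp_left (g := fun t : ℝ => (t : ℂ)) (by simp)
  exact h2.mul_right

lemma enorm_magOrb (A : E3 → E3) (k : E3 → ℝ) (a z : E3) (hk : ∀ y, 0 ≤ k y) :
    ‖magOrb A k a z‖ₑ = ENNReal.ofReal (k (z - a)) := by
  unfold magOrb
  rw [← ofReal_norm, norm_mul, mul_comm Complex.I, Complex.norm_exp_ofReal_mul_I, mul_one,
    Complex.norm_real, Real.norm_of_nonneg (hk _)]

/-- The `ℝ≥0∞`-valued version of the exclusion principle. -/
lemma lintegral_exclusion {n : ℕ} {Ψ : (Fin (n + 1) → E3) → (Fin (n + 1) → Fin 2) → ℂ}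
    (hΨ : IsWaveFun (n + 1) Ψ) {u : E3 → ℂ} (hu : Continuous u) (hc : HasCompactSupport u) :
    ∑ s, ∑ j, ∫⁻ x, ‖slot (fun x => Ψ x s) u j x‖ₑ ^ 2 ≤ 2 * ∫⁻ y, ‖u y‖ₑ ^ 2 := by
  have hcont : ∀ s, Continuous fun x => Ψ x s := fun s => (hΨ.smooth s).continuous
  have e1 : ∀ s j, ∫⁻ x, ‖slot (fun x => Ψ x s) u j x‖ₑ ^ 2 =
      ENNReal.ofReal (∫ x, ‖slot (fun x => Ψ x s) u j x‖ ^ 2) := by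
    intro s j
    rw [ofReal_integral_eq_lintegral_ofReal]
    · simp only [enorm_sq_eq_ofReal]
    · have := continuous_slot (hcont s) hu hc j
      refine Continuous.integrable_of_hasCompactSupport (by fun_prop) ?_
      exact (hasCompactSupport_slot (hΨ.compactSupport s) j).comp_left
        (g := fun z : ℂ => ‖z‖ ^ 2) (by simp)
    · exact Filter.Eventually.of_forall fun _ => by positivity
  have e2 : ∫⁻ y, ‖u y‖ₑ ^ 2 = ENNReal.ofReal (∫ y, ‖u y‖ ^ 2) := by
    rw [ofReal_integral_eq_lintegral_ofReal]
    · simp only [enorm_sq_eq_ofReal]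
    · refine Continuous.integrable_of_hasCompactSupport (by fun_prop) ?_
      exact hc.comp_left (g := fun z : ℂ => ‖z‖ ^ 2) (by simp)
    · exact Filter.Eventually.of_forall fun _ => by positivity
  simp only [e1]
  rw [e2, show (2 : ENNReal) = ENNReal.ofReal 2 by simp, ← ENNReal.ofReal_mul (by norm_num)]
  refine le_trans (le_of_eq ?_) (ENNReal.ofReal_le_ofReal (exclusion hΨ hu hc))
  rw [ENNReal.ofReal_sum_of_nonneg]
  · refine Finset.sum_congr rfl fun s _ => ?_
    rw [ENNReal.ofReal_sum_of_nonneg]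
    exact fun _ _ => integral_nonneg fun _ => by positivity
  · exact fun _ _ => Finset.sum_nonneg fun _ _ => integral_nonneg fun _ => by positivity

/-- The magnetic averages inside `Ω` are controlled by the exclusion principle. -/
lemma lintegral_magAvg_le {n : ℕ} {Ψ : (Fin (n + 1) → E3) → (Fin (n + 1) → Fin 2) → ℂ}
    (hΨ : IsWaveFun (n + 1) Ψ) {A : E3 → E3} (hA : Continuous A) {k : E3 → ℝ} (hk : Continuous k)
    (hk0 : ∀ y, 0 ≤ k y) (hck : HasCompactSupport k) {Ω : Set E3} (hΩ : MeasurableSet Ω) :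
    ∑ s, ∑ j, ∫⁻ x, Ω.indicator 1 (x j) * ‖magAvg A k (fun x => Ψ x s) j x‖ₑ ^ 2 ≤
      2 * (∫⁻ y, ENNReal.ofReal (k y) ^ 2) * volume Ω := by
  have hcont : ∀ s, Continuous fun x => Ψ x s := fun s => (hΨ.smooth s).continuous
  have h1 : ∀ s j, ∫⁻ x, Ω.indicator 1 (x j) * ‖magAvg A k (fun x => Ψ x s) j x‖ₑ ^ 2 =
      ∫⁻ a in Ω, ∫⁻ x, ‖slot (fun x => Ψ x s) (magOrb A k a) j x‖ₑ ^ 2 := by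
    intro s j
    have hm := continuous_magAvg hA hk hck (hcont s) j
    rw [lintegral_slice j]
    · simp only [ins_same, magAvg_ins]
      rw [← lintegral_indicator hΩ, lintegral_lintegral_swap]
      · refine lintegral_congr fun a => ?_
        by_cases ha : a ∈ Ω <;> simp [ha]
      · simp only [← magAvg_ins]
        apply Measurable.aemeasurable
        apply Measurable.mul
        · exact (measurable_one.indicator hΩ).comp measurable_snd
        · have : Continuous fun p : (Fin n → E3) × E3 =>
              magAvg A k (fun x => Ψ x s) j (ins j p.2 p.1) :=
            hm.comp ((continuous_ins j).comp (continuous_snd.prodMk continuous_fst))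
          exact Continuous.measurable (by fun_prop)
    · refine Measurable.mul ((measurable_one.indicator hΩ).comp (measurable_pi_apply j)) ?_
      exact Continuous.measurable (by fun_prop)
  have hmeas : ∀ s j, Measurable fun a =>
      ∫⁻ x, ‖slot (fun x => Ψ x s) (magOrb A k a) j x‖ₑ ^ 2 := by
    intro s j
    have hm := continuous_magAvg hA hk hck (hcont s) j
    simp only [← magAvg_ins]
    apply Measurable.lintegral_prod_right'
      (f := fun p : E3 × (Fin n → E3) => ‖magAvg A k (fun x => Ψ x s) j (ins j p.1 p.2)‖ₑ ^ 2)
    have := hm.comp (continuous_ins j)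
    exact Continuous.measurable (by fun_prop)
  simp only [h1]
  simp only [← lintegral_finsetSum _ fun j _ => hmeas _ j]
  rw [← lintegral_finsetSum _ fun s _ => Finset.measurable_fun_sum _ fun j _ => hmeas s j]
  calc _ ≤ ∫⁻ a in Ω, 2 * ∫⁻ y, ENNReal.ofReal (k y) ^ 2 := by
        refine lintegral_mono fun a => ?_
        refine (lintegral_exclusion hΨ (continuous_magOrb hA hk a)
          (hasCompactSupport_magOrb A hck a)).trans_eq ?_
        simp only [enorm_magOrb A k a _ hk0]
        rw [lintegral_sub_right_eq_self (fun y => ENNReal.ofReal (k y) ^ 2) a]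
    _ = _ := by rw [setLIntegral_const]

lemma sum_single_eVec {N : ℕ} (j : Fin N) (y : E3) :
    (Pi.single j y : Fin N → E3) = ∑ k, y k • eVec N j k := by
  ext i l
  simp only [eVec, Finset.sum_apply, Pi.smul_apply]
  by_cases h : i = j
  · subst h
    simp [Pi.single_apply]
  · simp [h]

/-- The covariant derivative in direction `(j, k)`. -/
def covD {N : ℕ} (A : E3 → E3) (Φ : (Fin N → E3) → ℂ) (j : Fin N) (k : Fin 3)
    (x : Fin N → E3) : ℂ :=
  -Complex.I * fderiv ℝ Φ x (eVec N j k) + (A (x j) k : ℂ) * Φ x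

lemma continuous_covD {N : ℕ} {A : E3 → E3} (hA : Continuous A) {Φ : (Fin N → E3) → ℂ}
    (hΦ : ContDiff ℝ 1 Φ) (j : Fin N) (k : Fin 3) : Continuous (covD A Φ j k) := by
  unfold covD
  have h1 : Continuous fun x => fderiv ℝ Φ x (eVec N j k) :=
    (hΦ.continuous_fderiv (by simp)).clm_apply continuous_const
  have h2 := hΦ.continuous
  have h3 : Continuous fun x : Fin N → E3 => A (x j) k :=
    (continuous_apply k).comp (hA.comp (continuous_apply j))
  fun_prop

lemma hasCompactSupport_covD {N : ℕ} {A : E3 → E3} {Φ : (Fin N → E3) → ℂ}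
    (hΦ : HasCompactSupport Φ) (j : Fin N) (k : Fin 3) : HasCompactSupport (covD A Φ j k) := by
  unfold covD
  have h1 : HasCompactSupport fun x => fderiv ℝ Φ x (eVec N j k) :=
    hΦ.fderiv_apply ℝ _
  exact h1.mul_left.add hΦ.mul_left

lemma schKin_eq {N : ℕ} (A : E3 → E3) (j : Fin N) (Ψ : (Fin N → E3) → (Fin N → Fin 2) → ℂ) :
    schKin N A j Ψ = ∑ s, ∫ x, ∑ k, ‖covD A (fun y => Ψ y s) j k x‖ ^ 2 := rfl

lemma schKin_nonneg {N : ℕ} (A : E3 → E3) (j : Fin N) (Ψ : (Fin N → E3) → (Fin N → Fin 2) → ℂ) :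
    0 ≤ schKin N A j Ψ := by
  rw [schKin_eq]
  exact Finset.sum_nonneg fun _ _ => integral_nonneg fun _ => by positivity

lemma ofReal_schKin {N : ℕ} {A : E3 → E3} (hA : Continuous A) (j : Fin N)
    {Ψ : (Fin N → E3) → (Fin N → Fin 2) → ℂ} (hΨ : IsWaveFun N Ψ) :
    ENNReal.ofReal (schKin N A j Ψ) =
      ∑ s, ∫⁻ x, ∑ k, ‖covD A (fun y => Ψ y s) j k x‖ₑ ^ 2 := by
  rw [schKin_eq, ENNReal.ofReal_sum_of_nonneg]
  · refine Finset.sum_congr rfl fun s _ => ?_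
    rw [ofReal_integral_eq_lintegral_ofReal]
    · refine lintegral_congr fun x => ?_
      rw [ENNReal.ofReal_sum_of_nonneg]
      · simp only [enorm_sq_eq_ofReal]
      · exact fun _ _ => by positivity
    · refine integrable_finsetSum _ fun k _ => ?_
      have h1 := continuous_covD hA ((hΨ.smooth s).of_le (by simp)) j k
      refine Continuous.integrable_of_hasCompactSupport (by fun_prop) ?_
      exact (hasCompactSupport_covD (hΨ.compactSupport s) j k).comp_left
        (g := fun z : ℂ => ‖z‖ ^ 2) (by simp)
    · exact Filter.Eventually.of_forall fun _ => by positivity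
  · exact fun _ _ => integral_nonneg fun _ => by positivity

lemma enorm_sq_sum_smul_le {y : E3} {r : ℝ} (hy : ‖y‖ ≤ r) (D : Fin 3 → ℂ) :
    ‖∑ k, (y k : ℂ) * D k‖ₑ ^ 2 ≤ ENNReal.ofReal (3 * r ^ 2) * ∑ k, ‖D k‖ₑ ^ 2 := by
  simp only [enorm_sq_eq_ofReal]
  rw [← ENNReal.ofReal_sum_of_nonneg (fun _ _ => by positivity),
    ← ENNReal.ofReal_mul (by positivity)]
  apply ENNReal.ofReal_le_ofReal
  have hyk : ∀ k, |y k| ≤ r := fun k => (norm_le_pi_norm y k).trans hy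
  have h0 : ‖∑ k, (y k : ℂ) * D k‖ ≤ ∑ k, r * ‖D k‖ := by
    refine (norm_sum_le _ _).trans (Finset.sum_le_sum fun k _ => ?_)
    rw [norm_mul, Complex.norm_real]
    gcongr
    exact hyk k
  calc ‖∑ k, (y k : ℂ) * D k‖ ^ 2 ≤ (∑ k, r * ‖D k‖) ^ 2 := by gcongr
    _ ≤ 3 * r ^ 2 * ∑ k, ‖D k‖ ^ 2 := by
      have := sq_sum_le_card_mul_sum_sq (s := Finset.univ) (f := fun k : Fin 3 => ‖D k‖)
      simp only [Finset.card_univ, Fintype.card_fin] at this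
      rw [← Finset.mul_sum, mul_pow, mul_comm 3, mul_assoc]
      gcongr
      exact_mod_cast this

lemma lintegral_shift_covD_le {N : ℕ} {A : E3 → E3} (hA : Continuous A) {Φ : (Fin N → E3) → ℂ}
    (hΦ : ContDiff ℝ 1 Φ) (j : Fin N) {y : E3} {r : ℝ} (hy : ‖y‖ ≤ r) :
    ∫⁻ x, ‖Φ x - Complex.exp (Complex.I * phase A (x j) y) * Φ (x + Pi.single j y)‖ₑ ^ 2 ≤
      ENNReal.ofReal (3 * r ^ 2) * ∫⁻ x, ∑ k, ‖covD A Φ j k x‖ₑ ^ 2 := by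
  have hAk : ∀ k, Continuous fun x => A x k := fun k => (continuous_apply k).comp hA
  set b : (Fin N → E3) → ℝ := fun x => ∑ k, A (x j) k * y k with hb
  have hbc : Continuous b := by
    have h : ∀ k, Continuous fun x : Fin N → E3 => A (x j) k := fun k =>
      (hAk k).comp (continuous_apply j)
    fun_prop
  have hseg : ∀ x, segInt b x (Pi.single j y) 1 = phase A (x j) y := by
    intro x
    unfold segInt phase
    simp [hb]
  have h := lintegral_sub_shift_le (μ := volume) hΦ hbc (Pi.single j y)
  simp only [hseg] at h
  refine h.trans ?_
  rw [← lintegral_const_mul']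
  · refine lintegral_mono fun x => ?_
    refine le_trans (le_of_eq ?_) (enorm_sq_sum_smul_le hy _)
    have : fderiv ℝ Φ x (Pi.single j y) + Complex.I * b x * Φ x =
        Complex.I * ∑ k, (y k : ℂ) * covD A Φ j k x := by
      simp only [sum_single_eVec, map_sum, map_smul, hb, covD]
      push_cast
      rw [Finset.mul_sum, Finset.mul_sum, Finset.sum_mul, ← Finset.sum_add_distrib]
      refine Finset.sum_congr rfl fun k _ => ?_
      rw [Complex.real_smul]
      linear_combination ((y k : ℂ) * fderiv ℝ Φ x (eVec N j k)) * Complex.I_mul_I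
    rw [this, enorm_mul, ← ofReal_norm Complex.I, Complex.norm_I, ENNReal.ofReal_one, one_mul]
  · exact ENNReal.ofReal_ne_top

lemma enorm_sq_sub_magAvg_le {N : ℕ} {A : E3 → E3} (hA : Continuous A) {k : E3 → ℝ}
    (hk : Continuous k) (hk0 : ∀ y, 0 ≤ k y) (hck : HasCompactSupport k)
    (hk1 : ∫⁻ y, ENNReal.ofReal (k y) = 1) {Φ : (Fin N → E3) → ℂ} (hΦ : Continuous Φ) (j : Fin N)
    (x : Fin N → E3) :
    ‖Φ x - magAvg A k Φ j x‖ₑ ^ 2 ≤ ∫⁻ y, ENNReal.ofReal (k y) *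
      ‖Φ x - Complex.exp (Complex.I * phase A (x j) y) * Φ (x + Pi.single j y)‖ₑ ^ 2 := by
  set G : E3 → ℂ := fun y => Complex.exp (Complex.I * phase A (x j) y) * Φ (x + Pi.single j y) with hGdef
  have hG : Continuous G := by
    rw [hGdef]
    have h1 : Continuous fun y : E3 => phase A (x j) y :=
      (continuous_phase hA).comp (f := fun y : E3 => (x j, y)) (by fun_prop)
    have h2 : Continuous fun y : E3 => Φ (x + Pi.single j y) :=
      hΦ.comp (continuous_const.add (continuous_single_apply j))
    exact (Complex.continuous_exp.comp
      (continuous_const.mul (Complex.continuous_ofReal.comp h1))).mul h2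
  have hkint : Integrable k := hk.integrable_of_hasCompactSupport hck
  have hkone : ∫ y, k y = 1 := by
    rw [integral_eq_lintegral_of_nonneg_ae (Filter.Eventually.of_forall hk0)
      hk.aestronglyMeasurable, hk1, ENNReal.toReal_one]
  have hcC : HasCompactSupport fun y => ((k y : ℝ) : ℂ) :=
    hck.comp_left (g := fun t : ℝ => (t : ℂ)) (by simp)
  have e1 : Φ x - magAvg A k Φ j x = ∫ y, (k y : ℂ) * (Φ x - G y) := by
    have : ∀ y, (k y : ℂ) * (Φ x - G y) = (k y : ℂ) * Φ x - (k y : ℂ) * G y := fun y => by ring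
    simp only [this]
    rw [integral_sub, integral_mul_const, integral_complex_ofReal, hkone]
    · simp [magAvg, G]
    · exact hkint.ofReal.mul_const _
    · exact Continuous.integrable_of_hasCompactSupport (by fun_prop) hcC.mul_right
  have hprob : IsProbabilityMeasure (volume.withDensity fun y => ENNReal.ofReal (k y)) :=
    ⟨by simp [hk1]⟩
  have hm1 : Measurable fun y => ENNReal.ofReal (k y) := by fun_prop
  have hm2 : Measurable fun y => ‖Φ x - G y‖ₑ := Continuous.measurable (by fun_prop)
  calc ‖Φ x - magAvg A k Φ j x‖ₑ ^ 2 ≤ (∫⁻ y, ‖(k y : ℂ) * (Φ x - G y)‖ₑ) ^ 2 := by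
        rw [e1]; gcongr; exact enorm_integral_le_lintegral_enorm _
    _ = (∫⁻ y, ‖Φ x - G y‖ₑ ∂(volume.withDensity fun y => ENNReal.ofReal (k y))) ^ 2 := by
        rw [lintegral_withDensity_eq_lintegral_mul _ hm1 hm2]
        congr 1
        refine lintegral_congr fun y => ?_
        rw [enorm_mul, Pi.mul_apply, ← ofReal_norm (k y : ℂ), Complex.norm_real,
          Real.norm_of_nonneg (hk0 y)]
    _ ≤ ∫⁻ y, ‖Φ x - G y‖ₑ ^ 2 ∂(volume.withDensity fun y => ENNReal.ofReal (k y)) :=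
        sq_lintegral_le hm2.aemeasurable
    _ = _ := by
        rw [lintegral_withDensity_eq_lintegral_mul _ hm1 (hm2.pow_const 2)]
        rfl

lemma lintegral_average_le {X Y : Type*} [MeasurableSpace X] [MeasurableSpace Y] {μ : Measure X}
    {ν : Measure Y} [SFinite μ] [SFinite ν] {w : Y → ENNReal} (hw : Measurable w)
    {F : X → Y → ENNReal} (hF : Measurable (Function.uncurry F)) {M : ENNReal}
    (h : ∀ y, w y ≠ 0 → ∫⁻ x, F x y ∂μ ≤ M) :
    ∫⁻ x, ∫⁻ y, w y * F x y ∂ν ∂μ ≤ (∫⁻ y, w y ∂ν) * M := by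
  rw [lintegral_lintegral_swap ((hw.comp measurable_snd).mul hF).aemeasurable,
    ← lintegral_mul_const _ hw]
  refine lintegral_mono fun y => ?_
  rw [lintegral_const_mul _ hF.of_uncurry_right]
  by_cases hy : w y = 0
  · simp [hy]
  · gcongr
    exact h y hy

lemma lintegral_sub_magAvg_le {N : ℕ} {A : E3 → E3} (hA : Continuous A) {k : E3 → ℝ}
    (hk : Continuous k) (hk0 : ∀ y, 0 ≤ k y) (hck : HasCompactSupport k)
    (hk1 : ∫⁻ y, ENNReal.ofReal (k y) = 1) {r : ℝ} (hkr : ∀ y, k y ≠ 0 → ‖y‖ ≤ r)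
    {Φ : (Fin N → E3) → ℂ} (hΦ : ContDiff ℝ 1 Φ) (j : Fin N) :
    ∫⁻ x, ‖Φ x - magAvg A k Φ j x‖ₑ ^ 2 ≤
      ENNReal.ofReal (3 * r ^ 2) * ∫⁻ x, ∑ l, ‖covD A Φ j l x‖ₑ ^ 2 := by
  have hΦc := hΦ.continuous
  have hcont : Continuous fun p : (Fin N → E3) × E3 =>
      Φ p.1 - Complex.exp (Complex.I * phase A (p.1 j) p.2) * Φ (p.1 + Pi.single j p.2) := by
    have h1 : Continuous fun p : (Fin N → E3) × E3 => phase A (p.1 j) p.2 :=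
      (continuous_phase hA).comp (f := fun p : (Fin N → E3) × E3 => (p.1 j, p.2)) (by fun_prop)
    have h2 : Continuous fun p : (Fin N → E3) × E3 => (Pi.single j p.2 : Fin N → E3) :=
      (continuous_single_apply j).comp continuous_snd
    have h3 : Continuous fun p : (Fin N → E3) × E3 => Φ (p.1 + Pi.single j p.2) :=
      hΦc.comp (continuous_fst.add h2)
    have h4 : Continuous fun p : (Fin N → E3) × E3 => Φ p.1 := hΦc.comp continuous_fst
    exact h4.sub ((Complex.continuous_exp.comp
      (continuous_const.mul (Complex.continuous_ofReal.comp h1))).mul h3)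
  have hm1 : Measurable fun y => ENNReal.ofReal (k y) := by fun_prop
  have h1 := lintegral_mono (μ := volume) fun x =>
    enorm_sq_sub_magAvg_le hA hk hk0 hck hk1 hΦc j x
  set F : (Fin N → E3) → E3 → ENNReal := fun x y =>
    ‖Φ x - Complex.exp (Complex.I * phase A (x j) y) * Φ (x + Pi.single j y)‖ₑ ^ 2
  have hF : Measurable (Function.uncurry F) := by
    have : Measurable fun p : (Fin N → E3) × E3 => F p.1 p.2 := hcont.enorm.measurable.pow_const 2
    exact this
  have h2 := lintegral_average_le (μ := volume) (ν := volume) hm1 hF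
    (M := ENNReal.ofReal (3 * r ^ 2) * ∫⁻ x, ∑ l, ‖covD A Φ j l x‖ₑ ^ 2) fun y hy => by
      have hy' : k y ≠ 0 := fun h => hy (by simp [h])
      exact lintegral_shift_covD_le hA hΦ j (hkr y hy')
  rw [hk1, one_mul] at h2
  exact h1.trans h2

/-- The total kinetic energy. -/
def kin (N : ℕ) (A : E3 → E3) (Ψ : (Fin N → E3) → (Fin N → Fin 2) → ℂ) : ℝ := ∑ j, schKin N A j Ψ

lemma kin_nonneg {N : ℕ} (A : E3 → E3) (Ψ : (Fin N → E3) → (Fin N → Fin 2) → ℂ) :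
    0 ≤ kin N A Ψ := Finset.sum_nonneg fun j _ => schKin_nonneg A j Ψ

/-- A weak form of the magnetic Lieb-Thirring inequality. -/
lemma dens_le {N : ℕ} {Ψ : (Fin N → E3) → (Fin N → Fin 2) → ℂ} (hΨ : IsWaveFun N Ψ) {A : E3 → E3}
    (hA : Continuous A) {r : ℝ} (hr : 0 < r) {Ω : Set E3} (hΩ : MeasurableSet Ω) :
    dens N Ψ Ω ≤ ENNReal.ofReal (6 * r ^ 2 * kin N A Ψ) + ENNReal.ofReal (4 * r⁻¹ ^ 3) * volume Ω := by
  rcases N with _ | n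
  · simp [dens]
  obtain ⟨k, hk, hk0, hck, hkr, hk1, hk2⟩ := exists_mollifier hr
  have hcont : ∀ s, Continuous fun x => Ψ x s := fun s => (hΨ.smooth s).continuous
  have hC1 : ∀ s, ContDiff ℝ 1 fun x => Ψ x s := fun s => (hΨ.smooth s).of_le (by simp)
  rw [dens_apply hcont hΩ]
  have hsplit : ∀ s j, ∫⁻ x, Ω.indicator 1 (x j) * ‖Ψ x s‖ₑ ^ 2 ≤
      2 * (ENNReal.ofReal (3 * r ^ 2) * ∫⁻ x, ∑ l, ‖covD A (fun x => Ψ x s) j l x‖ₑ ^ 2) +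
      2 * ∫⁻ x, Ω.indicator 1 (x j) * ‖magAvg A k (fun x => Ψ x s) j x‖ₑ ^ 2 := by
    intro s j
    have hmc := continuous_magAvg hA hk hck (hcont s) j
    have hs := hcont s
    have h1 : ∀ x : Fin (n + 1) → E3, Ω.indicator (1 : E3 → ENNReal) (x j) * ‖Ψ x s‖ₑ ^ 2 ≤
        2 * ‖Ψ x s - magAvg A k (fun x => Ψ x s) j x‖ₑ ^ 2 +
        2 * (Ω.indicator 1 (x j) * ‖magAvg A k (fun x => Ψ x s) j x‖ₑ ^ 2) := by
      intro x
      by_cases hx : x j ∈ Ω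
      · simp only [Set.indicator_of_mem hx, Pi.one_apply, one_mul, enorm_sq_eq_ofReal]
        rw [show (2 : ENNReal) = ENNReal.ofReal 2 by simp, ← ENNReal.ofReal_mul (by norm_num),
          ← ENNReal.ofReal_mul (by norm_num), ← ENNReal.ofReal_add (by positivity) (by positivity)]
        apply ENNReal.ofReal_le_ofReal
        have : ‖Ψ x s‖ ≤ ‖Ψ x s - magAvg A k (fun x => Ψ x s) j x‖ +
            ‖magAvg A k (fun x => Ψ x s) j x‖ := by
          simpa using norm_add_le (Ψ x s - magAvg A k (fun x => Ψ x s) j x)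
            (magAvg A k (fun x => Ψ x s) j x)
        have h0 := norm_nonneg (Ψ x s)
        nlinarith [sq_nonneg (‖Ψ x s - magAvg A k (fun x => Ψ x s) j x‖ -
            ‖magAvg A k (fun x => Ψ x s) j x‖)]
      · simp [Set.indicator_of_notMem hx]
    refine (lintegral_mono h1).trans ?_
    rw [lintegral_add_left (Measurable.const_mul (Continuous.measurable (by fun_prop)) _),
      lintegral_const_mul' _ _ (by simp),
      lintegral_const_mul' _ _ (by simp)]
    gcongr
    exact lintegral_sub_magAvg_le hA hk hk0 hck hk1 hkr (hC1 s) j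
  have hK : ENNReal.ofReal (kin (n + 1) A Ψ) =
      ∑ s, ∑ j, ∫⁻ x, ∑ l, ‖covD A (fun x => Ψ x s) j l x‖ₑ ^ 2 := by
    rw [kin, ENNReal.ofReal_sum_of_nonneg fun j _ => schKin_nonneg A j Ψ, Finset.sum_comm]
    exact Finset.sum_congr rfl fun j _ => ofReal_schKin hA j hΨ
  calc _ ≤ _ := Finset.sum_le_sum fun s _ => Finset.sum_le_sum fun j _ => hsplit s j
    _ = 2 * (ENNReal.ofReal (3 * r ^ 2) * ENNReal.ofReal (kin (n + 1) A Ψ)) + 2 *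
        ∑ s, ∑ j, ∫⁻ x, Ω.indicator 1 (x j) * ‖magAvg A k (fun x => Ψ x s) j x‖ₑ ^ 2 := by
      rw [hK]
      simp only [Finset.sum_add_distrib, ← Finset.mul_sum]
    _ ≤ 2 * (ENNReal.ofReal (3 * r ^ 2) * ENNReal.ofReal (kin (n + 1) A Ψ)) + 2 *
        (2 * (∫⁻ y, ENNReal.ofReal (k y) ^ 2) * volume Ω) := by
      refine add_le_add le_rfl (mul_le_mul_right ?_ _)
      exact lintegral_magAvg_le hΨ hA hk hk0 hck hΩ
    _ ≤ 2 * (ENNReal.ofReal (3 * r ^ 2) * ENNReal.ofReal (kin (n + 1) A Ψ)) + 2 *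
        (2 * ENNReal.ofReal (r⁻¹ ^ 3) * volume Ω) := by gcongr
    _ = _ := by
      congr 1
      · rw [show (2 : ENNReal) = ENNReal.ofReal 2 by simp, ← ENNReal.ofReal_mul (by positivity),
          ← ENNReal.ofReal_mul (by norm_num)]
        congr 1
        ring
      · rw [ENNReal.ofReal_mul (by norm_num), ← mul_assoc, ← mul_assoc]
        norm_num

/-- A measure dominated by the power `2/5` of Lebesgue measure. -/
def PowBdd (ν : Measure E3) (B : ℝ) : Prop :=
  ∀ Ω : Set E3, MeasurableSet Ω → ∀ v : ℝ, 0 < v → volume Ω ≤ ENNReal.ofReal v →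
    ν Ω ≤ ENNReal.ofReal (B * v ^ (2 / 5 : ℝ))

lemma powBdd_dens {N : ℕ} {Ψ : (Fin N → E3) → (Fin N → Fin 2) → ℂ} (hΨ : IsWaveFun N Ψ)
    {A : E3 → E3} (hA : Continuous A) {K : ℝ} (hK : 0 < K) (hle : kin N A Ψ ≤ K) :
    PowBdd (dens N Ψ) (10 * K ^ (3 / 5 : ℝ)) := by
  intro Ω hΩ v hv hvol
  set r : ℝ := (v / K) ^ (1 / 5 : ℝ) with hr
  have hr0 : 0 < r := by positivity
  have hr5 : r ^ 5 * K = v := by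
    rw [hr, ← Real.rpow_natCast, ← Real.rpow_mul (by positivity)]
    norm_num
    field_simp
  have hval : r ^ 2 * K = K ^ (3 / 5 : ℝ) * v ^ (2 / 5 : ℝ) := by
    rw [hr, ← Real.rpow_natCast, ← Real.rpow_mul (by positivity), Real.div_rpow hv.le hK.le]
    have : K ^ (1 / 5 * (2 : ℕ) : ℝ) * K ^ (3 / 5 : ℝ) = K := by
      rw [← Real.rpow_add hK]; norm_num
    norm_num at this ⊢
    have h2 : 0 < K ^ (2 / 5 : ℝ) := by positivity
    field_simp
    rw [this]
  refine (dens_le hΨ hA hr0 hΩ).trans ?_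
  calc _ ≤ ENNReal.ofReal (6 * r ^ 2 * K) + ENNReal.ofReal (4 * r⁻¹ ^ 3) * ENNReal.ofReal v := by
        gcongr
    _ = ENNReal.ofReal (10 * K ^ (3 / 5 : ℝ) * v ^ (2 / 5 : ℝ)) := by
        rw [← ENNReal.ofReal_mul (by positivity), ← ENNReal.ofReal_add (by positivity)
          (by positivity)]
        congr 1
        have : r⁻¹ ^ 3 * v = r ^ 2 * K := by
          rw [← hr5]; field_simp
        rw [mul_assoc 4, this, mul_assoc 10, ← hval]
        ring

/-- Integration of a weight with small superlevel sets. -/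
lemma PowBdd.lintegral_le {ν : Measure E3} {B : ℝ} (hν : PowBdd ν B) (hB : 0 ≤ B) {Ω : Set E3}
    (hΩ : MeasurableSet Ω) {W : E3 → ℝ} (hW : Measurable W) (hW0 : ∀ x, 0 ≤ W x) {Y l : ℝ}
    (hY : 0 < Y) (hl : 0 < l)
    (h : ∀ t, l ≤ t → volume (Ω ∩ {x | t < W x}) ≤ ENNReal.ofReal (Y * t⁻¹ ^ 3)) :
    ∫⁻ x in Ω, ENNReal.ofReal (W x) ∂ν ≤ ENNReal.ofReal l * ν Ω +
      ENNReal.ofReal (5 * B * Y ^ (2 / 5 : ℝ) * l ^ (-(1 / 5) : ℝ)) := by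
  rw [lintegral_eq_lintegral_meas_lt _ (Filter.Eventually.of_forall hW0) hW.aemeasurable]
  rw [← Set.Ioc_union_Ioi_eq_Ioi hl.le, lintegral_union measurableSet_Ioi Set.Ioc_disjoint_Ioi_same]
  gcongr
  · calc _ ≤ ∫⁻ t in Set.Ioc 0 l, ν Ω := by
          refine lintegral_mono fun t => ?_
          exact (measure_mono (Set.subset_univ _)).trans (by simp)
      _ = _ := by simp [mul_comm]
  · calc _ ≤ ∫⁻ t in Set.Ioi l, ENNReal.ofReal (B * Y ^ (2 / 5 : ℝ) * t ^ (-(6 / 5) : ℝ)) := by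
          refine setLIntegral_mono (by fun_prop) fun t ht => ?_
          have ht0 : 0 < t := hl.trans ht
          rw [Measure.restrict_apply (measurableSet_lt measurable_const hW), Set.inter_comm]
          refine (hν _ (hΩ.inter (measurableSet_lt measurable_const hW)) _ (by positivity)
            (h t (le_of_lt ht))).trans (ENNReal.ofReal_le_ofReal (le_of_eq ?_))
          rw [Real.mul_rpow hY.le (by positivity), mul_assoc]
          congr 2
          rw [inv_pow, ← Real.rpow_natCast, ← Real.rpow_neg ht0.le, ← Real.rpow_mul ht0.le]
          norm_num
      _ = _ := by
          rw [← ofReal_integral_eq_lintegral_ofReal]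
          · rw [integral_const_mul, integral_Ioi_rpow_of_lt (by norm_num) hl]
            congr 1
            norm_num
            ring
          · exact (integrableOn_Ioi_rpow_of_lt (by norm_num) hl).const_mul _
          · refine (ae_restrict_iff' measurableSet_Ioi).2 (Filter.Eventually.of_forall fun t ht => ?_)
            have ht0 : 0 < t := hl.trans ht
            simp only [Pi.zero_apply]
            positivity

lemma enorm3_nonneg (x : E3) : 0 ≤ enorm3 x := Real.sqrt_nonneg _

lemma continuous_enorm3 : Continuous enorm3 := by
  unfold enorm3; fun_prop

lemma norm_le_enorm3 (x : E3) : ‖x‖ ≤ enorm3 x := by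
  rw [pi_norm_le_iff_of_nonneg (enorm3_nonneg x)]
  intro k
  rw [Real.norm_eq_abs, ← Real.sqrt_sq_eq_abs]
  exact Real.sqrt_le_sqrt (Finset.single_le_sum (f := fun k => x k ^ 2)
    (fun _ _ => by positivity) (Finset.mem_univ k))

lemma enorm3_eq_norm (x : E3) : enorm3 x = ‖WithLp.toLp 2 x‖ := by
  rw [EuclideanSpace.norm_eq]
  simp [enorm3]

lemma enorm3_sub_le (x y : E3) : enorm3 (x - y) ≤ enorm3 x + enorm3 y := by
  simp only [enorm3_eq_norm, WithLp.toLp_sub]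
  exact norm_sub_le _ _

lemma volume_inv_enorm3_lt {t : ℝ} (ht : 0 < t) :
    volume {x : E3 | t < (enorm3 x)⁻¹} ≤ ENNReal.ofReal (8 * t⁻¹ ^ 3) := by
  calc volume {x : E3 | t < (enorm3 x)⁻¹} ≤ volume (Metric.closedBall (0 : E3) t⁻¹) := by
        apply measure_mono
        intro x hx
        change t < (enorm3 x)⁻¹ at hx
        rw [mem_closedBall_zero_iff]
        refine (norm_le_enorm3 x).trans ?_
        have h0 : 0 < enorm3 x := inv_pos.1 (ht.trans hx)
        rw [le_inv_comm₀ h0 ht]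
        exact hx.le
    _ = _ := by
        rw [Real.volume_pi_closedBall _ (by positivity)]
        congr 1
        simp [Fintype.card_fin, mul_pow]
        norm_num

lemma PowBdd.lintegral_coulomb_le {ν : Measure E3} {B : ℝ} (hν : PowBdd ν B) (hB : 0 ≤ B)
    {Ω : Set E3} (hΩ : MeasurableSet Ω) {v : ℝ} (hv : 0 < v) (hvol : volume Ω ≤ ENNReal.ofReal v) :
    ∫⁻ x in Ω, ENNReal.ofReal (enorm3 x)⁻¹ ∂ν ≤ ENNReal.ofReal (16 * B * v ^ (1 / 15 : ℝ)) := by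
  set l : ℝ := v ^ (-(1 / 3) : ℝ) with hl
  have hl0 : 0 < l := by positivity
  refine (hν.lintegral_le hB hΩ (W := fun x => (enorm3 x)⁻¹) (Y := 8) (l := l)
    continuous_enorm3.measurable.inv (fun x => inv_nonneg.2 (enorm3_nonneg x)) (by norm_num) hl0
    fun t ht => (measure_mono Set.inter_subset_right).trans
      (volume_inv_enorm3_lt (hl0.trans_le ht))).trans ?_
  calc _ ≤ ENNReal.ofReal l * ENNReal.ofReal (B * v ^ (2 / 5 : ℝ)) +
        ENNReal.ofReal (5 * B * 8 ^ (2 / 5 : ℝ) * l ^ (-(1 / 5) : ℝ)) := by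
        gcongr
        exact hν Ω hΩ v hv hvol
    _ ≤ _ := by
        rw [← ENNReal.ofReal_mul (by positivity), ← ENNReal.ofReal_add (by positivity)
          (by positivity)]
        apply ENNReal.ofReal_le_ofReal
        have e1 : l * (B * v ^ (2 / 5 : ℝ)) = B * v ^ (1 / 15 : ℝ) := by
          rw [hl, mul_left_comm, ← Real.rpow_add hv]; norm_num
        have e2 : l ^ (-(1 / 5) : ℝ) = v ^ (1 / 15 : ℝ) := by
          rw [hl, ← Real.rpow_mul hv.le]; norm_num
        have e3 : (8 : ℝ) ^ (2 / 5 : ℝ) ≤ 3 := by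
          calc (8 : ℝ) ^ (2 / 5 : ℝ) = (8 ^ (2 : ℕ) : ℝ) ^ (1 / 5 : ℝ) := by
                rw [← Real.rpow_natCast, ← Real.rpow_mul (by norm_num)]; norm_num
            _ ≤ (3 ^ (5 : ℕ) : ℝ) ^ (1 / 5 : ℝ) :=
                Real.rpow_le_rpow (by norm_num) (by norm_num) (by norm_num)
            _ = 3 := by
                rw [← Real.rpow_natCast, ← Real.rpow_mul (by norm_num)]; norm_num
        rw [e1, e2]
        have : 0 ≤ B * v ^ (1 / 15 : ℝ) := by positivity
        nlinarith

lemma volume_closedBall_half : volume (Metric.closedBall (0 : E3) (1 / 2)) = 1 := by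
  rw [Real.volume_pi_closedBall _ (by positivity)]
  simp

lemma powBdd_restrict : PowBdd (volume.restrict (Metric.closedBall (0 : E3) (1 / 2))) 1 := by
  intro Ω hΩ v hv hvol
  rw [one_mul]
  rcases le_total v 1 with h | h
  · calc _ ≤ volume Ω := Measure.restrict_apply_le _ _
      _ ≤ ENNReal.ofReal v := hvol
      _ ≤ _ := by
        apply ENNReal.ofReal_le_ofReal
        calc v = v ^ (1 : ℝ) := (Real.rpow_one v).symm
          _ ≤ _ := Real.rpow_le_rpow_of_exponent_ge hv h (by norm_num)
  · calc _ ≤ (volume.restrict (Metric.closedBall (0 : E3) (1 / 2))) Set.univ :=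
          measure_mono (Set.subset_univ _)
      _ = ENNReal.ofReal 1 := by simp
      _ ≤ _ := by
        apply ENNReal.ofReal_le_ofReal
        exact Real.one_le_rpow h (by norm_num)

lemma lintegral_coulomb_ball :
    ∫⁻ x in Metric.closedBall (0 : E3) (1 / 2), ENNReal.ofReal (enorm3 x)⁻¹ ≤ ENNReal.ofReal 16 := by
  have h := powBdd_restrict.lintegral_coulomb_le (by norm_num)
    (Metric.isClosed_closedBall (x := (0 : E3)) (ε := 1 / 2)).measurableSet zero_lt_one
    (by rw [volume_closedBall_half]; simp)
  rw [Measure.restrict_restrict Metric.isClosed_closedBall.measurableSet, Set.inter_self] at h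
  simpa using h

lemma inv_enorm3_le (z : E3) : ENNReal.ofReal (enorm3 z)⁻¹ ≤
    2 + (Metric.closedBall (0 : E3) (1 / 2)).indicator (fun z => ENNReal.ofReal (enorm3 z)⁻¹) z := by
  by_cases hz : z ∈ Metric.closedBall (0 : E3) (1 / 2)
  · rw [Set.indicator_of_mem hz]; exact le_add_self
  · rw [Set.indicator_of_notMem hz, add_zero, show (2 : ENNReal) = ENNReal.ofReal 2 by simp]
    apply ENNReal.ofReal_le_ofReal
    rw [mem_closedBall_zero_iff, not_le] at hz
    have := norm_le_enorm3 z
    rw [inv_le_comm₀ (by linarith) (by norm_num)]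
    linarith

/-- Coulomb singularities are integrable against continuous compactly supported functions. -/
lemma lintegral_coulomb_lt_top {N : ℕ} (j : Fin N) {c : (Fin N → E3) → E3} (hc : Measurable c)
    (hcj : ∀ x y, c (Function.update x j y) = c x) {F : (Fin N → E3) → ℝ} (hF : Continuous F)
    (hFc : HasCompactSupport F) :
    ∫⁻ x, ENNReal.ofReal (enorm3 (x j - c x))⁻¹ * ‖F x‖ₑ < ⊤ := by
  rcases N with _ | n
  · exact j.elim0
  obtain ⟨M, hM⟩ := hFc.exists_bound_of_continuous hF
  set Bl := Metric.closedBall (0 : E3) (1 / 2) with hBl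
  have hBm : MeasurableSet Bl := Metric.isClosed_closedBall.measurableSet
  set q : E3 → ENNReal := Bl.indicator (fun z => ENNReal.ofReal (enorm3 z)⁻¹) with hq
  have hqm : Measurable q := (continuous_enorm3.measurable.inv.ennreal_ofReal).indicator hBm
  have hqint : ∫⁻ z, q z ≤ ENNReal.ofReal 16 := by
    rw [hq, lintegral_indicator hBm]; exact lintegral_coulomb_ball
  have hjm : Measurable fun x : Fin (n + 1) → E3 => x j - c x := (measurable_pi_apply j).sub hc
  have hFm : Measurable fun x => ‖F x‖ₑ := hF.measurable.enorm
  have hK : IsCompact (rem j '' tsupport F) := IsCompact.image hFc (continuous_rem j)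
  have hfin : ∫⁻ x, ‖F x‖ₑ < ⊤ := (hF.integrable_of_hasCompactSupport hFc).2
  have hsecond : ∫⁻ x, q (x j - c x) * ‖F x‖ₑ ≤
      ENNReal.ofReal 16 * ENNReal.ofReal M * volume (rem j '' tsupport F) := by
    have hm : Measurable (fun x => q (x j - c x) * ‖F x‖ₑ) := (hqm.comp hjm).mul hFm
    rw [lintegral_slice j hm]
    calc _ ≤ ∫⁻ x', (rem j '' tsupport F).indicator
          (fun _ => ENNReal.ofReal 16 * ENNReal.ofReal M) x' := by
          refine lintegral_mono fun x' => ?_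
          by_cases hx' : x' ∈ rem j '' tsupport F
          · rw [Set.indicator_of_mem hx']
            have hcc : ∀ y, c (ins j y x') = c (ins j 0 x') := fun y => by
              have := hcj (ins j 0 x') y
              rwa [← ins_rem_eq_update, rem_ins] at this
            calc _ ≤ ∫⁻ y, q (y - c (ins j 0 x')) * ENNReal.ofReal M := by
                  refine lintegral_mono fun y => ?_
                  rw [ins_same, hcc]
                  gcongr
                  rw [← ofReal_norm]
                  exact ENNReal.ofReal_le_ofReal (hM _)
              _ = (∫⁻ y, q y) * ENNReal.ofReal M := by
                  rw [lintegral_mul_const' _ _ ENNReal.ofReal_ne_top,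
                    lintegral_sub_right_eq_self q]
              _ ≤ _ := by gcongr
          · rw [Set.indicator_of_notMem hx']
            have : ∀ y, F (ins j y x') = 0 := fun y =>
              image_eq_zero_of_notMem_tsupport fun h => hx' ⟨_, h, by simp⟩
            simp [this]
      _ = _ := by
          rw [lintegral_indicator_const hK.measurableSet]
  calc _ ≤ ∫⁻ x, (2 * ‖F x‖ₑ + q (x j - c x) * ‖F x‖ₑ) := by
        refine lintegral_mono fun x => ?_
        rw [← add_mul]
        gcongr
        exact inv_enorm3_le _
    _ = 2 * (∫⁻ x, ‖F x‖ₑ) + ∫⁻ x, q (x j - c x) * ‖F x‖ₑ := by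
        rw [lintegral_add_left (hFm.const_mul _), lintegral_const_mul _ hFm]
    _ < ⊤ := by
        refine ENNReal.add_lt_top.2 ⟨ENNReal.mul_lt_top (by simp) hfin, hsecond.trans_lt ?_⟩
        exact ENNReal.mul_lt_top (ENNReal.mul_lt_top (by simp) (by simp)) hK.measure_lt_top

lemma integrable_coulomb {N : ℕ} (j : Fin N) {c : (Fin N → E3) → E3} (hc : Measurable c)
    (hcj : ∀ x y, c (Function.update x j y) = c x) {F : (Fin N → E3) → ℝ} (hF : Continuous F)
    (hFc : HasCompactSupport F) :
    Integrable fun x => (enorm3 (x j - c x))⁻¹ * F x := by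
  have hjm : Measurable fun x : Fin N → E3 => x j - c x := (measurable_pi_apply j).sub hc
  refine ⟨((continuous_enorm3.measurable.comp hjm).inv.mul hF.measurable).aestronglyMeasurable, ?_⟩
  refine lt_of_eq_of_lt (lintegral_congr fun x => ?_) (lintegral_coulomb_lt_top j hc hcj hF hFc)
  rw [enorm_mul, ← ofReal_norm, Real.norm_of_nonneg (inv_nonneg.2 (enorm3_nonneg _))]

lemma integrable_nuclear {N : ℕ} (j : Fin N) {F : (Fin N → E3) → ℝ} (hF : Continuous F)
    (hFc : HasCompactSupport F) : Integrable fun x => (enorm3 (x j))⁻¹ * F x := by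
  simpa using integrable_coulomb j (c := fun _ => 0) measurable_const (fun _ _ => rfl) hF hFc

lemma integrable_pair {N : ℕ} {i j : Fin N} (hij : i ≠ j) {F : (Fin N → E3) → ℝ} (hF : Continuous F)
    (hFc : HasCompactSupport F) : Integrable fun x => (enorm3 (x i - x j))⁻¹ * F x :=
  integrable_coulomb i (c := fun x => x j) (measurable_pi_apply j)
    (fun x y => by simp [Function.update_of_ne hij.symm]) hF hFc

section Weights

variable {N : ℕ} {Ψ : (Fin N → E3) → (Fin N → Fin 2) → ℂ}

lemma continuous_normSq (hΨ : IsWaveFun N Ψ) (s : Fin N → Fin 2) :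
    Continuous fun x => ‖Ψ x s‖ ^ 2 := (hΨ.smooth s).continuous.norm.pow 2

lemma hasCompactSupport_normSq (hΨ : IsWaveFun N Ψ) (s : Fin N → Fin 2) :
    HasCompactSupport fun x => ‖Ψ x s‖ ^ 2 :=
  (hΨ.compactSupport s).comp_left (g := fun z : ℂ => ‖z‖ ^ 2) (by simp)

/-- The weighted nuclear attraction. -/
def attW (N : ℕ) (w : E3 → ℝ) (Ψ : (Fin N → E3) → (Fin N → Fin 2) → ℂ) : ℝ :=
  ∑ j : Fin N, potInt N (fun x => w (x j) * (enorm3 (x j))⁻¹) Ψ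

/-- The weighted electronic repulsion. -/
def repW (N : ℕ) (w : E3 → ℝ) (Ψ : (Fin N → E3) → (Fin N → Fin 2) → ℂ) : ℝ :=
  ∑ i : Fin N, ∑ j : Fin N,
    if i < j then potInt N (fun x => w (x i) * w (x j) * (enorm3 (x i - x j))⁻¹) Ψ else 0

lemma clSchEnergy_eq (N : ℕ) (Z α : ℝ) (A : E3 → E3) (Ψ : (Fin N → E3) → (Fin N → Fin 2) → ℂ) :
    clSchEnergy N Z α A Ψ = kin N A Ψ - Z * attW N (fun _ => 1) Ψ + repW N (fun _ => 1) Ψ +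
      (8 * Real.pi * α ^ 2)⁻¹ * ∫ x, curlSq A x := by
  simp only [clSchEnergy, kin, attW, repW, one_mul, Finset.sum_sub_distrib, Finset.mul_sum]

lemma integrable_att (hΨ : IsWaveFun N Ψ) {w : E3 → ℝ} (hw : Measurable w) (hw1 : ∀ x, |w x| ≤ 1)
    (s : Fin N → Fin 2) (j : Fin N) :
    Integrable fun x => w (x j) * (enorm3 (x j))⁻¹ * ‖Ψ x s‖ ^ 2 := by
  have h := integrable_nuclear j (continuous_normSq hΨ s) (hasCompactSupport_normSq hΨ s)
  simp only [mul_assoc]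
  refine h.bdd_mul (c := 1) (hw.comp (measurable_pi_apply j)).aestronglyMeasurable
    (Filter.Eventually.of_forall fun x => hw1 (x j))

lemma integrable_rep (hΨ : IsWaveFun N Ψ) {w : E3 → ℝ} (hw : Measurable w) (hw1 : ∀ x, |w x| ≤ 1)
    (s : Fin N → Fin 2) {i j : Fin N} (hij : i ≠ j) :
    Integrable fun x => w (x i) * w (x j) * (enorm3 (x i - x j))⁻¹ * ‖Ψ x s‖ ^ 2 := by
  have h := integrable_pair hij (continuous_normSq hΨ s) (hasCompactSupport_normSq hΨ s)
  simp only [mul_assoc (_ * _)]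
  refine h.bdd_mul (c := 1) ((hw.comp (measurable_pi_apply i)).mul
    (hw.comp (measurable_pi_apply j))).aestronglyMeasurable
    (Filter.Eventually.of_forall fun x => ?_)
  rw [norm_mul]
  exact mul_le_one₀ (hw1 _) (norm_nonneg _) (hw1 _)

lemma attW_nonneg {w : E3 → ℝ} (hw0 : ∀ x, 0 ≤ w x) : 0 ≤ attW N w Ψ :=
  Finset.sum_nonneg fun j _ => Finset.sum_nonneg fun s _ => integral_nonneg fun x => by
    have := hw0 (x j); have := enorm3_nonneg (x j); positivity

lemma repW_nonneg {w : E3 → ℝ} (hw0 : ∀ x, 0 ≤ w x) : 0 ≤ repW N w Ψ :=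
  Finset.sum_nonneg fun i _ => Finset.sum_nonneg fun j _ => by
    split_ifs
    · exact Finset.sum_nonneg fun s _ => integral_nonneg fun x => by
        have := hw0 (x i); have := hw0 (x j); have := enorm3_nonneg (x i - x j); positivity
    · exact le_rfl

lemma ofReal_attW (hΨ : IsWaveFun N Ψ) {w : E3 → ℝ} (hw : Measurable w) (hw0 : ∀ x, 0 ≤ w x)
    (hw1 : ∀ x, w x ≤ 1) :
    ENNReal.ofReal (attW N w Ψ) = ∫⁻ x, ENNReal.ofReal (w x * (enorm3 x)⁻¹) ∂(dens N Ψ) := by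
  have hnn : ∀ (j : Fin N) (s : Fin N → Fin 2) (x : Fin N → E3),
      0 ≤ w (x j) * (enorm3 (x j))⁻¹ * ‖Ψ x s‖ ^ 2 := fun j s x => by
    have := hw0 (x j); have := enorm3_nonneg (x j); positivity
  have hm : Measurable (fun x => ENNReal.ofReal (w x * (enorm3 x)⁻¹)) :=
    (hw.mul continuous_enorm3.measurable.inv).ennreal_ofReal
  rw [lintegral_dens (fun s => (hΨ.smooth s).continuous) hm, Finset.sum_comm, attW,
    ENNReal.ofReal_sum_of_nonneg]
  · refine Finset.sum_congr rfl fun j _ => ?_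
    rw [potInt, ENNReal.ofReal_sum_of_nonneg]
    · refine Finset.sum_congr rfl fun s _ => ?_
      rw [ofReal_integral_eq_lintegral_ofReal]
      · refine lintegral_congr fun x => ?_
        rw [enorm_sq_eq_ofReal, ← ENNReal.ofReal_mul]
        exact mul_nonneg (hw0 _) (inv_nonneg.2 (enorm3_nonneg _))
      · exact integrable_att hΨ hw (fun x => by rw [abs_of_nonneg (hw0 x)]; exact hw1 x) s j
      · exact Filter.Eventually.of_forall (hnn j s)
    · exact fun s _ => integral_nonneg (hnn j s)
  · exact fun j _ => Finset.sum_nonneg fun s _ => integral_nonneg (hnn j s)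

lemma attW_add (hΨ : IsWaveFun N Ψ) {w w' : E3 → ℝ} (hw : Measurable w) (hw1 : ∀ x, |w x| ≤ 1)
    (hw' : Measurable w') (hw1' : ∀ x, |w' x| ≤ 1) :
    attW N (fun x => w x + w' x) Ψ = attW N w Ψ + attW N w' Ψ := by
  simp only [attW, potInt, ← Finset.sum_add_distrib]
  refine Finset.sum_congr rfl fun j _ => Finset.sum_congr rfl fun s _ => ?_
  rw [← integral_add (integrable_att hΨ hw hw1 s j) (integrable_att hΨ hw' hw1' s j)]
  congr 1; ext x; ring

end Weights

lemma volume_eq_eq_zero {N : ℕ} {i j : Fin N} (hij : i ≠ j) :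
    volume {x : Fin N → E3 | x i = x j} = 0 := by
  let L : (Fin N → E3) →ₗ[ℝ] E3 := LinearMap.proj (R := ℝ) (φ := fun _ : Fin N => E3) i -
    LinearMap.proj (R := ℝ) (φ := fun _ : Fin N => E3) j
  have h : {x : Fin N → E3 | x i = x j} = (LinearMap.ker L : Set (Fin N → E3)) := by
    ext x; simp [L, sub_eq_zero]
  rw [h]
  apply Measure.addHaar_submodule
  intro htop
  have : (Pi.single i (fun _ => 1) : Fin N → E3) ∈ LinearMap.ker L := by rw [htop]; trivial
  rw [LinearMap.mem_ker] at this
  have h2 := congrFun this 0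
  simp [L, Pi.single_eq_of_ne hij.symm] at h2

/-- Points far from the nucleus repel each other enough to compensate the nuclear attraction. -/
lemma far_pointwise {N : ℕ} {p : Fin N → E3} (hp : ∀ i j, i ≠ j → p i ≠ p j) (S : Finset (Fin N))
    {r : ℝ} (hr : 0 < r) (hS : ∀ i ∈ S, r ≤ enorm3 (p i)) {Z : ℝ} (hZ : 1 ≤ Z) :
    Z * ∑ i ∈ S, (enorm3 (p i))⁻¹ ≤
      ∑ i ∈ S, ∑ j ∈ S, (if i < j then (enorm3 (p i - p j))⁻¹ else 0) + 5 * Z ^ 2 / r := by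
  set m : Fin N → Finset (Fin N) := fun i =>
    {j ∈ S | j ≠ i ∧ enorm3 (p j) ≤ enorm3 (p i)} with hm
  have hpos : ∀ i ∈ S, 0 < enorm3 (p i) := fun i hi => hr.trans_le (hS i hi)
  have hsymm : ∀ i j, enorm3 (p i - p j) = enorm3 (p j - p i) := fun i j => by
    rw [enorm3_eq_norm, enorm3_eq_norm, ← norm_neg, ← WithLp.toLp_neg, neg_sub]
  have hdpos : ∀ i j, i ≠ j → 0 < enorm3 (p i - p j) := fun i j hij => by
    have h1 := norm_le_enorm3 (p i - p j)
    have h2 : 0 < ‖p i - p j‖ := norm_pos_iff.2 (sub_ne_zero.2 (hp i j hij))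
    linarith
  have hdouble : 2 * ∑ i ∈ S, ∑ j ∈ S, (if i < j then (enorm3 (p i - p j))⁻¹ else 0) =
      ∑ i ∈ S, ∑ j ∈ S, (if j ≠ i then (enorm3 (p i - p j))⁻¹ else 0) := by
    rw [two_mul]
    nth_rewrite 2 [Finset.sum_comm]
    rw [← Finset.sum_add_distrib]
    refine Finset.sum_congr rfl fun i _ => ?_
    rw [← Finset.sum_add_distrib]
    refine Finset.sum_congr rfl fun j _ => ?_
    rcases lt_trichotomy i j with h | h | h
    · simp [h, h.not_gt, h.ne']
    · simp [h]
    · simp [h, h.not_gt, h.ne, hsymm i j]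
  have hlow : ∑ i ∈ S, ((m i).card : ℝ) * (enorm3 (p i))⁻¹ / 2 ≤
      ∑ i ∈ S, ∑ j ∈ S, (if j ≠ i then (enorm3 (p i - p j))⁻¹ else 0) := by
    refine Finset.sum_le_sum fun i hi => ?_
    calc _ = ∑ j ∈ m i, (enorm3 (p i))⁻¹ / 2 := by
          rw [Finset.sum_const, nsmul_eq_mul]; ring
      _ ≤ ∑ j ∈ m i, (if j ≠ i then (enorm3 (p i - p j))⁻¹ else 0) := by
          refine Finset.sum_le_sum fun j hj => ?_
          simp only [hm, Finset.mem_filter] at hj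
          rw [if_pos hj.2.1]
          have h1 := enorm3_sub_le (p i) (p j)
          have h2 := hdpos i j hj.2.1.symm
          have h3 := hpos i hi
          rw [div_eq_mul_inv, ← mul_inv]
          apply inv_anti₀ h2
          linarith [hj.2.2]
      _ ≤ _ := by
          refine Finset.sum_le_sum_of_subset_of_nonneg (Finset.filter_subset _ _) fun j _ _ => ?_
          split_ifs
          · exact inv_nonneg.2 (enorm3_nonneg _)
          · exact le_rfl
  set T : Finset (Fin N) := {i ∈ S | ((m i).card : ℝ) < 4 * Z} with hT
  have hTcard : (T.card : ℝ) ≤ 4 * Z + 1 := by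
    rcases T.eq_empty_or_nonempty with h | h
    · rw [h]; simp; linarith
    · obtain ⟨i, hi, hmax⟩ := T.exists_max_image (fun i => enorm3 (p i)) h
      have hsub : T.erase i ⊆ m i := by
        intro j hj
        rw [Finset.mem_erase] at hj
        simp only [hm, Finset.mem_filter]
        exact ⟨(Finset.mem_filter.1 hj.2).1, hj.1, hmax j hj.2⟩
      have h1 := Finset.card_le_card hsub
      rw [Finset.card_erase_of_mem hi] at h1
      have h2 : ((m i).card : ℝ) < 4 * Z := (Finset.mem_filter.1 hi).2
      have h3 : T.card ≤ (m i).card + 1 := by omega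
      have h4 : (T.card : ℝ) ≤ (m i).card + 1 := by exact_mod_cast h3
      linarith
  have hterm : ∀ i ∈ S, Z * (enorm3 (p i))⁻¹ ≤ ((m i).card : ℝ) * (enorm3 (p i))⁻¹ / 4 +
      (if ((m i).card : ℝ) < 4 * Z then Z / r else 0) := by
    intro i hi
    have h1 := hpos i hi
    have h2 : (enorm3 (p i))⁻¹ ≤ r⁻¹ := inv_anti₀ hr (hS i hi)
    have h3 : 0 < (enorm3 (p i))⁻¹ := inv_pos.2 h1
    have h4 : (0 : ℝ) ≤ (m i).card := by positivity
    split_ifs with h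
    · rw [div_eq_mul_inv Z r]
      have : Z * (enorm3 (p i))⁻¹ ≤ Z * r⁻¹ := by gcongr
      have : 0 ≤ ((m i).card : ℝ) * (enorm3 (p i))⁻¹ / 4 := by positivity
      linarith
    · rw [not_lt] at h
      nlinarith
  have hsum : Z * ∑ i ∈ S, (enorm3 (p i))⁻¹ ≤
      ∑ i ∈ S, ((m i).card : ℝ) * (enorm3 (p i))⁻¹ / 4 + T.card * (Z / r) := by
    rw [Finset.mul_sum]
    refine (Finset.sum_le_sum hterm).trans_eq ?_
    rw [Finset.sum_add_distrib, ← Finset.sum_filter, Finset.sum_const, nsmul_eq_mul]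
  have h4 : ∑ i ∈ S, ((m i).card : ℝ) * (enorm3 (p i))⁻¹ / 2 =
      2 * ∑ i ∈ S, ((m i).card : ℝ) * (enorm3 (p i))⁻¹ / 4 := by
    rw [Finset.mul_sum]
    exact Finset.sum_congr rfl fun i _ => by ring
  have h5 : T.card * (Z / r) ≤ 5 * Z ^ 2 / r := by
    rw [mul_div_assoc', div_le_div_iff_of_pos_right hr]
    nlinarith
  linarith

section Potentials

variable {N : ℕ} {Ψ : (Fin N → E3) → (Fin N → Fin 2) → ℂ}

lemma integrable_normSq (hΨ : IsWaveFun N Ψ) (s : Fin N → Fin 2) :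
    Integrable fun x => ‖Ψ x s‖ ^ 2 :=
  (continuous_normSq hΨ s).integrable_of_hasCompactSupport (hasCompactSupport_normSq hΨ s)

/-- The weighted nuclear attraction potential. -/
def potA (N : ℕ) (w : E3 → ℝ) (x : Fin N → E3) : ℝ := ∑ j, w (x j) * (enorm3 (x j))⁻¹

/-- The weighted repulsion potential. -/
def potR (N : ℕ) (w : E3 → ℝ) (x : Fin N → E3) : ℝ :=
  ∑ i, ∑ j, if i < j then w (x i) * w (x j) * (enorm3 (x i - x j))⁻¹ else 0

lemma integrable_potA (hΨ : IsWaveFun N Ψ) {w : E3 → ℝ} (hw : Measurable w) (hw1 : ∀ x, |w x| ≤ 1)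
    (s : Fin N → Fin 2) : Integrable fun x => potA N w x * ‖Ψ x s‖ ^ 2 := by
  simp only [potA, Finset.sum_mul]
  exact integrable_finsetSum _ fun j _ => integrable_att hΨ hw hw1 s j

lemma integrable_potR (hΨ : IsWaveFun N Ψ) {w : E3 → ℝ} (hw : Measurable w) (hw1 : ∀ x, |w x| ≤ 1)
    (s : Fin N → Fin 2) : Integrable fun x => potR N w x * ‖Ψ x s‖ ^ 2 := by
  simp only [potR, Finset.sum_mul]
  refine integrable_finsetSum _ fun i _ => integrable_finsetSum _ fun j _ => ?_
  split_ifs with h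
  · exact integrable_rep hΨ hw hw1 s h.ne
  · simp

lemma attW_eq_potInt (hΨ : IsWaveFun N Ψ) {w : E3 → ℝ} (hw : Measurable w)
    (hw1 : ∀ x, |w x| ≤ 1) : attW N w Ψ = potInt N (potA N w) Ψ := by
  simp only [attW, potInt, potA]
  rw [Finset.sum_comm]
  refine Finset.sum_congr rfl fun s _ => ?_
  simp only [Finset.sum_mul]
  rw [integral_finsetSum _ fun j _ => integrable_att hΨ hw hw1 s j]

lemma repW_eq_potInt (hΨ : IsWaveFun N Ψ) {w : E3 → ℝ} (hw : Measurable w)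
    (hw1 : ∀ x, |w x| ≤ 1) : repW N w Ψ = potInt N (potR N w) Ψ := by
  have hint : ∀ (s : Fin N → Fin 2) (i j : Fin N), Integrable fun x : Fin N → E3 =>
      (if i < j then w (x i) * w (x j) * (enorm3 (x i - x j))⁻¹ else 0) * ‖Ψ x s‖ ^ 2 := by
    intro s i j
    split_ifs with h
    · exact integrable_rep hΨ hw hw1 s h.ne
    · simp
  have h1 : repW N w Ψ = ∑ i : Fin N, ∑ j : Fin N, ∑ s : Fin N → Fin 2, ∫ x : Fin N → E3,
      (if i < j then w (x i) * w (x j) * (enorm3 (x i - x j))⁻¹ else 0) * ‖Ψ x s‖ ^ 2 := by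
    refine Finset.sum_congr rfl fun i _ => Finset.sum_congr rfl fun j _ => ?_
    split_ifs
    · rfl
    · simp
  rw [h1, potInt]
  simp only [potR, Finset.sum_mul]
  have h2 : ∀ i : Fin N, ∑ j : Fin N, ∑ s : Fin N → Fin 2, ∫ x : Fin N → E3,
      (if i < j then w (x i) * w (x j) * (enorm3 (x i - x j))⁻¹ else 0) * ‖Ψ x s‖ ^ 2 =
      ∑ s : Fin N → Fin 2, ∑ j : Fin N, ∫ x : Fin N → E3,
      (if i < j then w (x i) * w (x j) * (enorm3 (x i - x j))⁻¹ else 0) * ‖Ψ x s‖ ^ 2 :=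
    fun i => Finset.sum_comm
  rw [Finset.sum_congr rfl fun i _ => h2 i, Finset.sum_comm]
  refine Finset.sum_congr rfl fun s _ => ?_
  rw [integral_finsetSum _ fun i _ => integrable_finsetSum _ fun j _ => hint s i j]
  exact Finset.sum_congr rfl fun i _ => (integral_finsetSum _ fun j _ => hint s i j).symm

lemma repW_add_le (hΨ : IsWaveFun N Ψ) {w w' : E3 → ℝ} (hw : Measurable w) (hw0 : ∀ x, 0 ≤ w x)
    (hw' : Measurable w') (hw0' : ∀ x, 0 ≤ w' x) (h : ∀ x, w x + w' x ≤ 1) :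
    repW N w Ψ + repW N w' Ψ ≤ repW N (fun _ => 1) Ψ := by
  have hw1 : ∀ x, |w x| ≤ 1 := fun x => by
    rw [abs_of_nonneg (hw0 x)]; linarith [h x, hw0' x]
  have hw1' : ∀ x, |w' x| ≤ 1 := fun x => by
    rw [abs_of_nonneg (hw0' x)]; linarith [h x, hw0 x]
  simp only [repW, ← Finset.sum_add_distrib]
  refine Finset.sum_le_sum fun i _ => Finset.sum_le_sum fun j _ => ?_
  split_ifs with hij
  · simp only [potInt, ← Finset.sum_add_distrib]
    refine Finset.sum_le_sum fun s _ => ?_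
    rw [← integral_add (integrable_rep hΨ hw hw1 s hij.ne) (integrable_rep hΨ hw' hw1' s hij.ne)]
    refine integral_mono ((integrable_rep hΨ hw hw1 s hij.ne).add
      (integrable_rep hΨ hw' hw1' s hij.ne))
      (integrable_rep hΨ measurable_const (w := fun _ => 1) (by simp) s hij.ne) fun x => ?_
    have h1 : 0 ≤ (enorm3 (x i - x j))⁻¹ := inv_nonneg.2 (enorm3_nonneg _)
    have h2 : w (x i) * w (x j) + w' (x i) * w' (x j) ≤ 1 * 1 := by
      nlinarith [h (x i), h (x j), hw0 (x i), hw0 (x j), hw0' (x i), hw0' (x j)]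
    dsimp only
    rw [← add_mul, ← add_mul]
    gcongr
  · simp

/-- Far electrons repel each other enough to compensate the nuclear attraction. -/
lemma far_le (hΨ : IsWaveFun N Ψ) {Far : Set E3} (hFar : MeasurableSet Far) {r : ℝ} (hr : 0 < r)
    (hF : ∀ x ∈ Far, r ≤ enorm3 x) {Z : ℝ} (hZ : 1 ≤ Z) :
    Z * attW N (Far.indicator fun _ => 1) Ψ ≤
      repW N (Far.indicator fun _ => 1) Ψ + 5 * Z ^ 2 / r := by
  classical
  set w : E3 → ℝ := Far.indicator fun _ => 1 with hwdef
  have hw : Measurable w := measurable_const.indicator hFar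
  have hw1 : ∀ x, |w x| ≤ 1 := fun x => by
    by_cases hx : x ∈ Far <;> simp [hwdef, hx]
  rw [attW_eq_potInt hΨ hw hw1, repW_eq_potInt hΨ hw hw1]
  have hpt : ∀ᵐ x : Fin N → E3, Z * potA N w x ≤ potR N w x + 5 * Z ^ 2 / r := by
    have hne : ∀ᵐ x : Fin N → E3, ∀ i j, i ≠ j → x i ≠ x j := by
      refine ae_all_iff.2 fun i => ae_all_iff.2 fun j => ?_
      by_cases hij : i = j
      · simp [hij]
      · filter_upwards [measure_eq_zero_iff_ae_notMem.1 (volume_eq_eq_zero hij)] with x hx _ hx'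
        exact hx hx'
    filter_upwards [hne] with x hx
    have h := far_pointwise hx {i | x i ∈ Far} hr (fun i hi => hF _ (by simpa using hi)) hZ
    convert h using 2
    · rw [Finset.sum_filter, potA]
      refine Finset.sum_congr rfl fun i _ => ?_
      by_cases hi : x i ∈ Far <;> simp [hwdef, hi]
    · rw [Finset.sum_filter, potR]
      refine Finset.sum_congr rfl fun i _ => ?_
      by_cases hi : x i ∈ Far
      · rw [if_pos hi, Finset.sum_filter]
        refine Finset.sum_congr rfl fun j _ => ?_
        by_cases hj : x j ∈ Far <;> simp [hwdef, hi, hj]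
      · rw [if_neg hi]
        exact Finset.sum_eq_zero fun j _ => by simp [hwdef, hi]
  have hn := hΨ.normalized
  have h5 : 5 * Z ^ 2 / r = ∑ s : Fin N → Fin 2, ∫ x : Fin N → E3, 5 * Z ^ 2 / r * ‖Ψ x s‖ ^ 2 := by
    simp only [integral_const_mul, ← Finset.mul_sum]
    rw [hn, mul_one]
  rw [h5]
  simp only [potInt, Finset.mul_sum, ← Finset.sum_add_distrib]
  refine Finset.sum_le_sum fun s _ => ?_
  have hi2 := (integrable_normSq hΨ s).const_mul (5 * Z ^ 2 / r)
  rw [← integral_const_mul, ← integral_add (integrable_potR hΨ hw hw1 s) hi2]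
  refine integral_mono_ae ((integrable_potA hΨ hw hw1 s).const_mul Z)
    ((integrable_potR hΨ hw hw1 s).add hi2) ?_
  filter_upwards [hpt] with x hx
  rw [← mul_assoc, ← add_mul]
  gcongr

/-- A priori bound on the nuclear attraction. -/
lemma attW_le (hΨ : IsWaveFun N Ψ) {A : E3 → E3} (hA : Continuous A) {Z : ℝ} (hZ : 1 ≤ Z) :
    Z * attW N (fun _ => 1) Ψ ≤ (1 / 4) * kin N A Ψ + (1 / 2) * repW N (fun _ => 1) Ψ +
      (1 / 4 + 20 * 640 ^ 5) * Z ^ (7 / 3 : ℝ) := by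
  have hZ0 : 0 < Z := by linarith
  set Kb : ℝ := kin N A Ψ + Z ^ (7 / 3 : ℝ) with hKb
  have hk := kin_nonneg A Ψ
  have hZp : 0 < Z ^ (7 / 3 : ℝ) := by positivity
  have hKb0 : 0 < Kb := by positivity
  have hν := powBdd_dens hΨ hA hKb0 (by linarith)
  set r : ℝ := (1 / 640) ^ 5 / 2 * Z ^ (-(1 / 3) : ℝ) with hr
  have hr0 : 0 < r := by positivity
  set Far : Set E3 := {x | r ≤ enorm3 x} with hFardef
  have hFar : MeasurableSet Far := measurableSet_le measurable_const continuous_enorm3.measurable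
  set v : ℝ := (1 / 640) ^ 15 * Z⁻¹ with hv
  have hv0 : 0 < v := by positivity
  have hrv : 8 * r ^ 3 = v := by
    rw [hr, hv, mul_pow, ← Real.rpow_natCast (Z ^ _), ← Real.rpow_mul hZ0.le]
    norm_num
    rw [Real.rpow_neg_one]; ring
  have hvol : volume Farᶜ ≤ ENNReal.ofReal v := by
    refine (measure_mono (t := Metric.closedBall (0 : E3) r) fun x hx => ?_).trans ?_
    · rw [mem_closedBall_zero_iff]
      have : enorm3 x < r := not_le.1 hx
      exact (norm_le_enorm3 x).trans this.le
    · rw [Real.volume_pi_closedBall _ hr0.le, ← hrv]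
      apply ENNReal.ofReal_le_ofReal
      simp [mul_pow]
      norm_num
  set w : E3 → ℝ := Far.indicator fun _ => 1 with hw
  set w' : E3 → ℝ := Farᶜ.indicator fun _ => 1 with hw'
  have hwm : Measurable w := measurable_const.indicator hFar
  have hwm' : Measurable w' := measurable_const.indicator hFar.compl
  have hsum : ∀ x, w x + w' x = 1 := fun x => by
    by_cases hx : x ∈ Far <;> simp [hw, hw', hx]
  have hw0 : ∀ x, 0 ≤ w x := fun x => by by_cases hx : x ∈ Far <;> simp [hw, hx]
  have hw0' : ∀ x, 0 ≤ w' x := fun x => by by_cases hx : x ∈ Far <;> simp [hw', hx]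
  have hw1 : ∀ x, |w x| ≤ 1 := fun x => by
    rw [abs_of_nonneg (hw0 x)]; linarith [hsum x, hw0' x]
  have hw1' : ∀ x, |w' x| ≤ 1 := fun x => by
    rw [abs_of_nonneg (hw0' x)]; linarith [hsum x, hw0 x]
  have hadd := attW_add hΨ hwm hw1 hwm' hw1'
  simp only [hsum] at hadd
  have hnear : Z * attW N w' Ψ ≤ Kb / 4 := by
    have h1 : attW N w' Ψ ≤ 16 * (10 * Kb ^ (3 / 5 : ℝ)) * v ^ (1 / 15 : ℝ) := by
      rw [← ENNReal.ofReal_le_ofReal_iff (by positivity),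
        ofReal_attW hΨ hwm' hw0' fun x => (le_abs_self _).trans (hw1' x)]
      refine le_of_eq_of_le ?_ (hν.lintegral_coulomb_le (by positivity) hFar.compl hv0 hvol)
      rw [← lintegral_indicator hFar.compl]
      refine lintegral_congr fun x => ?_
      by_cases hx : x ∈ Farᶜ
      · rw [Set.indicator_of_mem hx, hw', Set.indicator_of_mem hx, one_mul]
      · rw [Set.indicator_of_notMem hx, hw', Set.indicator_of_notMem hx]; simp
    have h2 : v ^ (1 / 15 : ℝ) = 1 / 640 * Z ^ (-(1 / 15) : ℝ) := by
      rw [hv, Real.mul_rpow (by positivity) (by positivity), ← Real.rpow_natCast,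
        ← Real.rpow_mul (by norm_num), Real.inv_rpow hZ0.le, ← Real.rpow_neg hZ0.le]
      norm_num
    have h3 : Z * Z ^ (-(1 / 15) : ℝ) ≤ Kb ^ (2 / 5 : ℝ) := by
      calc Z * Z ^ (-(1 / 15) : ℝ) = (Z ^ (7 / 3 : ℝ)) ^ (2 / 5 : ℝ) := by
            rw [← Real.rpow_mul hZ0.le]
            nth_rewrite 1 [← Real.rpow_one Z]
            rw [← Real.rpow_add hZ0]; norm_num
        _ ≤ _ := Real.rpow_le_rpow hZp.le (by linarith) (by norm_num)
    have h4 : Kb ^ (3 / 5 : ℝ) * Kb ^ (2 / 5 : ℝ) = Kb := by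
      rw [← Real.rpow_add hKb0]; norm_num
    calc Z * attW N w' Ψ ≤ Z * (16 * (10 * Kb ^ (3 / 5 : ℝ)) * v ^ (1 / 15 : ℝ)) := by gcongr
      _ = (1 / 4) * (Kb ^ (3 / 5 : ℝ) * (Z * Z ^ (-(1 / 15) : ℝ))) := by rw [h2]; ring
      _ ≤ (1 / 4) * (Kb ^ (3 / 5 : ℝ) * Kb ^ (2 / 5 : ℝ)) := by gcongr
      _ = Kb / 4 := by rw [h4]; ring
  have hfar := far_le hΨ hFar hr0 (fun x hx => hx) (Z := 2 * Z) (by linarith)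
  have hrep := repW_add_le hΨ hwm hw0 hwm' hw0' fun x => (hsum x).le
  have hrep' := repW_nonneg (N := N) (Ψ := Ψ) hw0'
  have herr : 5 * (2 * Z) ^ 2 / r = 2 * (20 * 640 ^ 5) * Z ^ (7 / 3 : ℝ) := by
    have : Z ^ (7 / 3 : ℝ) * Z ^ (-(1 / 3) : ℝ) = Z ^ 2 := by
      rw [← Real.rpow_add hZ0, ← Real.rpow_natCast]; norm_num
    rw [div_eq_iff hr0.ne', hr]
    linear_combination (-20 : ℝ) * this
  rw [herr] at hfar
  rw [hadd]
  linarith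

end Potentials

section EnergyDensity

variable {N : ℕ}

lemma HasCompactSupport.norm_sq {X : Type*} [TopologicalSpace X] {f : X → ℂ}
    (hf : HasCompactSupport f) : HasCompactSupport fun x => ‖f x‖ ^ 2 :=
  hf.comp_left (g := fun z : ℂ => ‖z‖ ^ 2) (by simp)

lemma integrable_norm_sq_of_hasCompactSupport {f : (Fin N → E3) → ℂ} (hf : Continuous f)
    (hc : HasCompactSupport f) : Integrable fun x => ‖f x‖ ^ 2 :=
  (hf.norm.pow 2).integrable_of_hasCompactSupport hc.norm_sq

/-- The Coulomb potential of the particles in `S`. -/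
def coulS (Z : ℝ) (S : Finset (Fin N)) (x : Fin N → E3) : ℝ :=
  -Z * ∑ j ∈ S, (enorm3 (x j))⁻¹ +
    ∑ i ∈ S, ∑ j ∈ S, if i < j then (enorm3 (x i - x j))⁻¹ else 0

/-- The nonmagnetic energy density of the particles in `S`. -/
def enDens (Z : ℝ) (S : Finset (Fin N)) (Φ : (Fin N → E3) → ℂ) (x : Fin N → E3) : ℝ :=
  ∑ j ∈ S, ∑ k, ‖fderiv ℝ Φ x (eVec N j k)‖ ^ 2 + coulS Z S x * ‖Φ x‖ ^ 2

lemma integrable_coulS (Z : ℝ) (S : Finset (Fin N)) {F : (Fin N → E3) → ℝ} (hF : Continuous F)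
    (hFc : HasCompactSupport F) : Integrable fun x => coulS Z S x * F x := by
  have h : (fun x => coulS Z S x * F x) = fun x =>
      -Z * ∑ j ∈ S, (enorm3 (x j))⁻¹ * F x +
        ∑ i ∈ S, ∑ j ∈ S, if i < j then (enorm3 (x i - x j))⁻¹ * F x else 0 := by
    ext x
    simp only [coulS, add_mul, mul_assoc, Finset.sum_mul, ite_mul, zero_mul]
  rw [h]
  refine ((integrable_finsetSum _ fun j _ => integrable_nuclear j hF hFc).const_mul _).add
    (integrable_finsetSum _ fun i _ => integrable_finsetSum _ fun j _ => ?_)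
  by_cases hij : i < j
  · simpa [hij] using integrable_pair hij.ne hF hFc
  · simp [hij]

lemma integrable_enDens (Z : ℝ) (S : Finset (Fin N)) {Φ : (Fin N → E3) → ℂ}
    (hΦ : ContDiff ℝ (⊤ : ℕ∞) Φ) (hc : HasCompactSupport Φ) {ρ : (Fin N → E3) → ℝ}
    (hρ : Continuous ρ) : Integrable fun x => ρ x * enDens Z S Φ x := by
  have h1 : (fun x => ρ x * enDens Z S Φ x) = fun x =>
      ∑ j ∈ S, ∑ k, ρ x * ‖fderiv ℝ Φ x (eVec N j k)‖ ^ 2 + coulS Z S x * (ρ x * ‖Φ x‖ ^ 2) := by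
    ext x
    simp only [enDens, mul_add, Finset.mul_sum]
    ring
  rw [h1]
  refine Integrable.add (integrable_finsetSum _ fun j _ => integrable_finsetSum _ fun k _ => ?_)
    (integrable_coulS Z S (hρ.mul (hΦ.continuous.norm.pow 2)) ?_)
  · have hd : Continuous fun x => fderiv ℝ Φ x (eVec N j k) :=
      (hΦ.continuous_fderiv (by simp)).clm_apply continuous_const
    refine (hρ.mul (hd.norm.pow 2)).integrable_of_hasCompactSupport ?_
    exact (hc.fderiv_apply ℝ (eVec N j k)).norm_sq.mul_left
  · exact hc.norm_sq.mul_left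

lemma clSchEnergy_eq_enDens {Ψ : (Fin N → E3) → (Fin N → Fin 2) → ℂ} (hΨ : IsWaveFun N Ψ)
    (Z α : ℝ) : clSchEnergy N Z α (fun _ => 0) Ψ =
      ∑ s, ∫ x, enDens Z Finset.univ (fun y => Ψ y s) x := by
  have hcurl : ∀ x, curlSq (fun _ => (0 : E3)) x = 0 := fun x => by
    simp [curlSq, curl3, pdVec, Fin.sum_univ_succ]
  rw [clSchEnergy_eq, attW_eq_potInt hΨ measurable_const (by simp),
    repW_eq_potInt hΨ measurable_const (by simp)]
  simp only [hcurl, integral_zero, mul_zero, add_zero]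
  have hkin : ∀ s : Fin N → Fin 2, Integrable fun x =>
      ∑ j, ∑ k, ‖fderiv ℝ (fun y => Ψ y s) x (eVec N j k)‖ ^ 2 := by
    intro s
    refine integrable_finsetSum _ fun j _ => integrable_finsetSum _ fun k _ => ?_
    have hd : Continuous fun x => fderiv ℝ (fun y => Ψ y s) x (eVec N j k) :=
      ((hΨ.smooth s).continuous_fderiv (by simp)).clm_apply continuous_const
    have hdc := (hΨ.compactSupport s).fderiv_apply ℝ (eVec N j k)
    exact integrable_norm_sq_of_hasCompactSupport hd hdc
  have hk : kin N (fun _ => 0) Ψ = ∑ s, ∫ x, ∑ j, ∑ k,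
      ‖fderiv ℝ (fun y => Ψ y s) x (eVec N j k)‖ ^ 2 := by
    simp only [kin, schKin_eq]
    rw [Finset.sum_comm]
    refine Finset.sum_congr rfl fun s _ => ?_
    rw [← integral_finsetSum]
    · simp [covD]
    · intro j _
      refine integrable_finsetSum _ fun k _ => ?_
      have hd : Continuous (covD (fun _ => (0 : E3)) (fun y => Ψ y s) j k) :=
        continuous_covD continuous_const ((hΨ.smooth s).of_le (by simp)) j k
      exact integrable_norm_sq_of_hasCompactSupport hd
        (hasCompactSupport_covD (hΨ.compactSupport s) j k)
  rw [hk]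
  simp only [potInt, Finset.mul_sum, ← Finset.sum_sub_distrib, ← Finset.sum_add_distrib]
  refine Finset.sum_congr rfl fun s _ => ?_
  have hA := (integrable_potA hΨ (w := fun _ => 1) measurable_const (by simp) s).const_mul Z
  have hR := integrable_potR hΨ (w := fun _ => 1) measurable_const (by simp) s
  have hsub : Integrable fun x => (∑ j, ∑ k, ‖fderiv ℝ (fun y => Ψ y s) x (eVec N j k)‖ ^ 2) -
      Z * (potA N (fun _ => 1) x * ‖Ψ x s‖ ^ 2) := (hkin s).sub hA
  rw [← integral_const_mul, ← integral_sub (hkin s) hA, ← integral_add hsub hR]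
  congr 1
  ext x
  simp only [enDens, coulS, potA, potR, one_mul]
  ring

lemma enDens_const_smul (Z : ℝ) (S : Finset (Fin N)) {Φ : (Fin N → E3) → ℂ}
    (hΦ : ContDiff ℝ (⊤ : ℕ∞) Φ) (c : ℝ) (x : Fin N → E3) :
    enDens Z S (fun y => (c : ℂ) * Φ y) x = c ^ 2 * enDens Z S Φ x := by
  have hd : fderiv ℝ (fun y => (c : ℂ) * Φ y) x = (c : ℂ) • fderiv ℝ Φ x :=
    fderiv_const_mul (hΦ.differentiable (by simp) x) _
  simp only [enDens, hd, smul_apply, smul_eq_mul, norm_mul, mul_pow,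
    Complex.norm_real, Real.norm_eq_abs, sq_abs, mul_add, Finset.mul_sum]
  ring

/-- The ground state energy bounds the energy of unnormalized wave functions. -/
lemma le_sum_integral_enDens {Z α E : ℝ} (hE : E ≤ 0)
    (hle : ∀ n, 1 ≤ n → ∀ Ψ, IsWaveFun n Ψ → E ≤ clSchEnergy n Z α (fun _ => 0) Ψ)
    {Φ : (Fin N → E3) → (Fin N → Fin 2) → ℂ} (hs : ∀ s, ContDiff ℝ (⊤ : ℕ∞) fun x => Φ x s)
    (hc : ∀ s, HasCompactSupport fun x => Φ x s)
    (ha : ∀ (π : Equiv.Perm (Fin N)) (x : Fin N → E3) (s : Fin N → Fin 2),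
      Φ (fun i => x (π i)) (fun i => s (π i)) = ((Equiv.Perm.sign π : ℤ) : ℂ) * Φ x s) :
    E * ∑ s, ∫ x, ‖Φ x s‖ ^ 2 ≤ ∑ s, ∫ x, enDens Z Finset.univ (fun y => Φ y s) x := by
  have hq0 : ∀ s, 0 ≤ ∫ x, ‖Φ x s‖ ^ 2 := fun s => integral_nonneg fun x => by positivity
  rcases Nat.eq_zero_or_pos N with rfl | hN
  · have h1 : ∀ s, ∫ x, enDens Z Finset.univ (fun y => Φ y s) x = 0 := fun s => by
      simp [enDens, coulS]
    rw [Finset.sum_congr rfl fun s _ => h1 s, Finset.sum_const_zero]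
    exact mul_nonpos_of_nonpos_of_nonneg hE (Finset.sum_nonneg fun s _ => hq0 s)
  set q := ∑ s, ∫ x, ‖Φ x s‖ ^ 2 with hq
  have hqnn : 0 ≤ q := Finset.sum_nonneg fun s _ => hq0 s
  rcases hqnn.eq_or_lt with h0 | hpos
  · have hz : ∀ s x, Φ x s = 0 := by
      intro s x
      by_contra hne
      have hcn : Continuous fun x => ‖Φ x s‖ ^ 2 := (hs s).continuous.norm.pow 2
      have := hcn.integral_pos_of_hasCompactSupport_nonneg_nonzero (μ := volume)
        (hc s).norm_sq (fun x => by positivity)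
        (x := x) (by positivity)
      have h2 := (Finset.sum_eq_zero_iff_of_nonneg fun s _ => hq0 s).1 h0.symm s (Finset.mem_univ s)
      linarith
    have hz' : ∀ s, (fun y => Φ y s) = fun _ => 0 := fun s => funext (hz s)
    rw [← h0, mul_zero]
    refine (Finset.sum_eq_zero fun s _ => ?_).ge
    rw [hz' s]
    simp [enDens]
  · set c : ℝ := (Real.sqrt q)⁻¹ with hcdef
    have hc2 : c ^ 2 = q⁻¹ := by rw [hcdef, inv_pow, Real.sq_sqrt hqnn]
    have hw : IsWaveFun N fun x s => (c : ℂ) * Φ x s := by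
      refine ⟨fun s => contDiff_const.mul (hs s), fun s => (hc s).mul_left, fun π x s => ?_, ?_⟩
      · rw [ha]; ring
      · simp only [norm_mul, mul_pow, Complex.norm_real, Real.norm_eq_abs, sq_abs,
          integral_const_mul, ← Finset.mul_sum]
        rw [hc2, ← hq, inv_mul_cancel₀ hpos.ne']
    have h := hle N hN _ hw
    rw [clSchEnergy_eq_enDens hw] at h
    simp only [enDens_const_smul Z _ (hs _), integral_const_mul, ← Finset.mul_sum] at h
    rw [hc2, inv_mul_eq_div, le_div_iff₀ hpos] at h
    exact h

end EnergyDensity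

section Join

variable {n m N : ℕ} (e : Fin n ⊕ Fin m ≃ Fin N)

/-- Assemble two families of variables along `e`. -/
def joinF {X : Type*} (x : Fin n → X) (y : Fin m → X) : Fin N → X :=
  fun i => Sum.elim x y (e.symm i)

@[simp] lemma joinF_inl {X : Type*} (x : Fin n → X) (y : Fin m → X) (a : Fin n) :
    joinF e x y (e (Sum.inl a)) = x a := by simp [joinF]

@[simp] lemma joinF_inr {X : Type*} (x : Fin n → X) (y : Fin m → X) (b : Fin m) :
    joinF e x y (e (Sum.inr b)) = y b := by simp [joinF]

/-- `joinF` as an equivalence. -/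
def joinEquiv (X : Type*) : (Fin n → X) × (Fin m → X) ≃ (Fin N → X) :=
  (Equiv.sumArrowEquivProdArrow _ _ X).symm.trans (Equiv.arrowCongr e (Equiv.refl X))

lemma joinEquiv_apply (X : Type*) (p : (Fin n → X) × (Fin m → X)) :
    joinEquiv e X p = joinF e p.1 p.2 := rfl

/-- `joinF` as a measurable equivalence. -/
def joinMeas : (Fin n → E3) × (Fin m → E3) ≃ᵐ (Fin N → E3) :=
  (MeasurableEquiv.sumPiEquivProdPi fun _ => E3).symm.trans
    (MeasurableEquiv.piCongrLeft (fun _ => E3) e)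

lemma joinMeas_apply (p : (Fin n → E3) × (Fin m → E3)) :
    joinMeas e p = joinF e p.1 p.2 := by
  ext1 i
  obtain ⟨a, rfl⟩ := e.surjective i
  have : joinMeas e p (e a) = (MeasurableEquiv.sumPiEquivProdPi fun _ => E3).symm p a := by
    rw [joinMeas, MeasurableEquiv.trans_apply, MeasurableEquiv.piCongrLeft_apply_apply]
  rw [this]
  rcases a with a | a <;> simp [MeasurableEquiv.sumPiEquivProdPi]

lemma measurePreserving_joinMeas : MeasurePreserving (joinMeas e) :=
  (volume_measurePreserving_sumPiEquivProdPi_symm _).trans (volume_measurePreserving_piCongrLeft _ e)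

lemma contDiff_joinF (y : Fin m → E3) {k : WithTop ℕ∞} :
    ContDiff ℝ k fun x : Fin n → E3 => joinF e x y := by
  rw [contDiff_pi]
  intro i
  obtain ⟨a | a, rfl⟩ := e.surjective i
  · simpa using contDiff_apply ℝ E3 a
  · simpa using contDiff_const

lemma joinF_add_smul (x v : Fin n → E3) (y : Fin m → E3) (t : ℝ) :
    joinF e (x + t • v) y = joinF e x y + t • joinF e v 0 := by
  ext1 i
  obtain ⟨a | a, rfl⟩ := e.surjective i <;> simp

lemma joinF_eVec (a : Fin n) (k : Fin 3) :
    joinF e (eVec n a k) 0 = eVec N (e (Sum.inl a)) k := by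
  ext1 i
  obtain ⟨b | b, rfl⟩ := e.surjective i
  · simp [eVec, Pi.single_apply]
  · simp [eVec]

lemma fderiv_comp_joinF {Φ : (Fin N → E3) → ℂ} (hΦ : ContDiff ℝ (⊤ : ℕ∞) Φ) (x : Fin n → E3)
    (y : Fin m → E3) (a : Fin n) (k : Fin 3) :
    fderiv ℝ (fun x' => Φ (joinF e x' y)) x (eVec n a k) =
      fderiv ℝ Φ (joinF e x y) (eVec N (e (Sum.inl a)) k) := by
  have h1 : DifferentiableAt ℝ (fun x' => Φ (joinF e x' y)) x :=
    (hΦ.comp (contDiff_joinF e y)).differentiable (by simp) x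
  have h2 : DifferentiableAt ℝ Φ (joinF e x y) := hΦ.differentiable (by simp) _
  rw [← h1.lineDeriv_eq_fderiv, ← h2.lineDeriv_eq_fderiv]
  simp only [lineDeriv, joinF_add_smul, joinF_eVec]

lemma hasCompactSupport_comp_joinF {Φ : (Fin N → E3) → ℂ} (hc : HasCompactSupport Φ)
    (y : Fin m → E3) : HasCompactSupport fun x : Fin n → E3 => Φ (joinF e x y) := by
  have hcont : Continuous fun (z : Fin N → E3) (a : Fin n) => z (e (Sum.inl a)) := by fun_prop
  refine HasCompactSupport.intro (IsCompact.image hc hcont) fun x hx => ?_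
  exact image_eq_zero_of_notMem_tsupport fun h => hx ⟨_, h, by ext1 a; simp⟩

/-- The set of indices in the first block. -/
def leftBlock : Finset (Fin N) :=
  Finset.univ.map (Function.Embedding.inl.trans e.toEmbedding)

lemma enDens_comp_joinF (he : StrictMono fun a => e (Sum.inl a)) (Z : ℝ) {Φ : (Fin N → E3) → ℂ}
    (hΦ : ContDiff ℝ (⊤ : ℕ∞) Φ) (x : Fin n → E3) (y : Fin m → E3) :
    enDens Z Finset.univ (fun x' => Φ (joinF e x' y)) x =
      enDens Z (leftBlock e) Φ (joinF e x y) := by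
  simp only [enDens, coulS, leftBlock, Finset.sum_map, Function.Embedding.trans_apply,
    Function.Embedding.inl_apply, Equiv.coe_toEmbedding, joinF_inl, fderiv_comp_joinF e hΦ]
  simp only [fun a b => he.lt_iff_lt (a := a) (b := b)]

lemma prod_compl_leftBlock (r : E3 → ℝ) (x : Fin n → E3) (y : Fin m → E3) :
    ∏ i ∈ (leftBlock e)ᶜ, r (joinF e x y i) = ∏ b, r (y b) := by
  have h : (leftBlock e)ᶜ = 
      Finset.univ.map (Function.Embedding.inr.trans e.toEmbedding) := by
    ext i
    obtain ⟨a | a, rfl⟩ := e.surjective i <;> simp [leftBlock]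
  rw [h]
  simp

/-- Freezing the particles outside a block. -/
lemma sum_integral_leftBlock_nonneg (he : StrictMono fun a => e (Sum.inl a)) {Z α E : ℝ}
    (hE : E ≤ 0) (hle : ∀ n, 1 ≤ n → ∀ Ψ, IsWaveFun n Ψ → E ≤ clSchEnergy n Z α (fun _ => 0) Ψ)
    {Φ : (Fin N → E3) → (Fin N → Fin 2) → ℂ} (hs : ∀ s, ContDiff ℝ (⊤ : ℕ∞) fun x => Φ x s)
    (hc : ∀ s, HasCompactSupport fun x => Φ x s)
    (ha : ∀ π : Equiv.Perm (Fin N), (∀ i, π i ∈ leftBlock e ↔ i ∈ leftBlock e) →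
      ∀ (x : Fin N → E3) (s : Fin N → Fin 2),
      Φ (fun i => x (π i)) (fun i => s (π i)) = ((Equiv.Perm.sign π : ℤ) : ℂ) * Φ x s)
    {r : E3 → ℝ} (hr : Continuous r) (hr0 : ∀ x, 0 ≤ r x) :
    0 ≤ ∑ s, ∫ x : Fin N → E3, (∏ i ∈ (leftBlock e)ᶜ, r (x i)) *
      (enDens Z (leftBlock e) (fun y => Φ y s) x - E * ‖Φ x s‖ ^ 2) := by
  set f : (Fin N → Fin 2) → (Fin N → E3) → ℝ := fun s x => (∏ i ∈ (leftBlock e)ᶜ, r (x i)) *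
      (enDens Z (leftBlock e) (fun y => Φ y s) x - E * ‖Φ x s‖ ^ 2) with hf
  have hρ : Continuous fun x : Fin N → E3 => ∏ i ∈ (leftBlock e)ᶜ, r (x i) :=
    continuous_finsetProd _ fun i _ => hr.comp (continuous_apply i)
  have hfi : ∀ s, Integrable (f s) := fun s => by
    have h1 := integrable_enDens Z (leftBlock e) (hs s) (hc s) hρ
    have h2 : Integrable fun x => (∏ i ∈ (leftBlock e)ᶜ, r (x i)) * (E * ‖Φ x s‖ ^ 2) := by
      refine (hρ.mul (continuous_const.mul
        ((hs s).continuous.norm.pow 2))).integrable_of_hasCompactSupport ?_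
      exact (hc s).norm_sq.mul_left.mul_left
    simp only [hf, mul_sub]
    exact h1.sub h2
  rw [← (joinEquiv e (Fin 2)).sum_comp, Fintype.sum_prod_type_right]
  refine Finset.sum_nonneg fun t _ => ?_
  simp only [joinEquiv_apply]
  rw [← integral_finsetSum _ fun s _ => hfi _,
    ← (measurePreserving_joinMeas e).integral_comp (joinMeas e).measurableEmbedding]
  have hint : Integrable (fun p => ∑ s, f (joinF e s t) (joinMeas e p)) (volume.prod volume) :=
    ((measurePreserving_joinMeas e).integrable_comp_emb (joinMeas e).measurableEmbedding).2
      (integrable_finsetSum _ fun s _ => hfi _)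
  change 0 ≤ ∫ p, ∑ s, f (joinF e s t) (joinMeas e p) ∂(volume.prod volume)
  rw [integral_prod_symm _ hint]
  refine integral_nonneg fun y => ?_
  simp only [joinMeas_apply, hf, prod_compl_leftBlock]
  have hs' : ∀ s, ContDiff ℝ (⊤ : ℕ∞) fun x => Φ (joinF e x y) (joinF e s t) := fun s =>
    (hs _).comp (contDiff_joinF e y)
  have hc' : ∀ s, HasCompactSupport fun x => Φ (joinF e x y) (joinF e s t) := fun s =>
    hasCompactSupport_comp_joinF e (hc _) y
  have hmain := le_sum_integral_enDens (N := n) hE hle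
    (Φ := fun x s => Φ (joinF e x y) (joinF e s t)) hs' hc' ?_
  · have hi1 : ∀ s, Integrable fun x => enDens Z Finset.univ
        (fun x' => Φ (joinF e x' y) (joinF e s t)) x := fun s => by
      simpa using integrable_enDens Z Finset.univ (hs' s) (hc' s)
        (continuous_const (y := (1 : ℝ)))
    have hi2 : ∀ s, Integrable fun x => E * ‖Φ (joinF e x y) (joinF e s t)‖ ^ 2 := fun s =>
      (integrable_norm_sq_of_hasCompactSupport (hs' s).continuous (hc' s)).const_mul _
    simp only [← Finset.mul_sum, integral_const_mul]
    refine mul_nonneg (Finset.prod_nonneg fun _ _ => hr0 _) ?_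
    have heq : ∀ s x, enDens Z (leftBlock e) (fun z => Φ z (joinF e s t)) (joinF e x y) =
        enDens Z Finset.univ (fun x' => Φ (joinF e x' y) (joinF e s t)) x := fun s x =>
      (enDens_comp_joinF e he Z (hs _) x y).symm
    simp only [heq]
    have hi3 : ∀ s, Integrable fun x => enDens Z Finset.univ
        (fun x' => Φ (joinF e x' y) (joinF e s t)) x - E * ‖Φ (joinF e x y) (joinF e s t)‖ ^ 2 :=
      fun s => (hi1 s).sub (hi2 s)
    rw [integral_finsetSum _ fun s _ => hi3 s,
      Finset.sum_congr rfl fun s _ => integral_sub (hi1 s) (hi2 s), Finset.sum_sub_distrib]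
    simp only [integral_const_mul, ← Finset.mul_sum]
    linarith
  · intro π x s
    set π' : Equiv.Perm (Fin N) := e.permCongr (Equiv.sumCongr π (Equiv.refl _)) with hπ'
    have hj : ∀ {X : Type} (x : Fin n → X) (y : Fin m → X),
        joinF e (fun i => x (π i)) y = fun i => joinF e x y (π' i) := by
      intro X x y
      ext1 i
      obtain ⟨a | a, rfl⟩ := e.surjective i <;> simp [hπ', Equiv.permCongr_apply]
    rw [hj, hj, ha π', hπ', Equiv.Perm.sign_permCongr]
    · congr 3
      simp
    · intro i
      obtain ⟨a | a, rfl⟩ := e.surjective i <;> simp [hπ', Equiv.permCongr_apply, leftBlock]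

end Join

section Combinatorics

variable {ι : Type*} [Fintype ι] [DecidableEq ι] (a : ι → ℝ)

lemma sum_subset_prod (T : Finset ι) :
    ∑ S : Finset ι, (if T ⊆ S then (∏ i ∈ S \ T, a i) * ∏ i ∈ Sᶜ, (1 - a i) else 0) = 1 := by
  have h := Fintype.prod_add (fun i => if i ∈ T then 1 else a i)
    (fun i => if i ∈ T then 0 else 1 - a i)
  have h1 : ∏ i, ((if i ∈ T then 1 else a i) + (if i ∈ T then 0 else 1 - a i)) = 1 :=
    Finset.prod_eq_one fun i _ => by split_ifs <;> ring
  rw [h1] at h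
  refine Eq.trans (Finset.sum_congr rfl fun S _ => ?_) h.symm
  split_ifs with hT
  · congr 1
    · rw [← Finset.prod_sdiff hT, Finset.prod_congr rfl (g := fun _ => (1 : ℝ)) fun i hi =>
        if_pos hi, Finset.prod_const_one, mul_one]
      exact Finset.prod_congr rfl fun i hi => (if_neg (Finset.mem_sdiff.1 hi).2).symm
    · exact Finset.prod_congr rfl fun i hi =>
        (if_neg fun hiT => Finset.mem_compl.1 hi (hT hiT)).symm
  · obtain ⟨i, hiT, hiS⟩ := Finset.not_subset.1 hT
    have h0 : ∏ i ∈ Sᶜ, (if i ∈ T then 0 else 1 - a i) = 0 :=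
      Finset.prod_eq_zero (Finset.mem_compl.2 hiS) (if_pos hiT)
    rw [h0, mul_zero]

lemma sum_prod_one : ∑ S : Finset ι, (∏ i ∈ Sᶜ, (1 - a i)) * ∏ i ∈ S, a i = 1 := by
  simpa [mul_comm] using sum_subset_prod a ∅

lemma sum_prod_erase (D : ι → ℝ) :
    ∑ S : Finset ι, (∏ i ∈ Sᶜ, (1 - a i)) * ∑ j ∈ S, (∏ i ∈ S.erase j, a i) * D j = ∑ j, D j := by
  have h : ∀ S : Finset ι, (∏ i ∈ Sᶜ, (1 - a i)) * ∑ j ∈ S, (∏ i ∈ S.erase j, a i) * D j =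
      ∑ j, (if {j} ⊆ S then (∏ i ∈ S \ {j}, a i) * ∏ i ∈ Sᶜ, (1 - a i) else 0) * D j := by
    intro S
    rw [Finset.mul_sum, ← Finset.sum_subset (Finset.subset_univ S)]
    · refine Finset.sum_congr rfl fun j hj => ?_
      rw [if_pos (by simpa using hj), Finset.sdiff_singleton_eq_erase]
      ring
    · intro j _ hj
      rw [if_neg (by simpa using hj), zero_mul]
  rw [Finset.sum_congr rfl fun S _ => h S, Finset.sum_comm]
  refine Finset.sum_congr rfl fun j _ => ?_
  rw [← Finset.sum_mul, sum_subset_prod, one_mul]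

lemma sum_prod_sum (c : ι → ℝ) :
    ∑ S : Finset ι, (∏ i ∈ Sᶜ, (1 - a i)) * ((∑ j ∈ S, c j) * ∏ i ∈ S, a i) =
      ∑ j, a j * c j := by
  rw [← sum_prod_erase a]
  refine Finset.sum_congr rfl fun S _ => ?_
  rw [Finset.sum_mul]
  congr 1
  refine Finset.sum_congr rfl fun j hj => ?_
  rw [← Finset.mul_prod_erase S a hj]
  ring

lemma sum_prod_sum_sum (d : ι → ι → ℝ) (hd : ∀ i, d i i = 0) :
    ∑ S : Finset ι, (∏ i ∈ Sᶜ, (1 - a i)) * ((∑ i ∈ S, ∑ j ∈ S, d i j) * ∏ i ∈ S, a i) =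
      ∑ i, ∑ j, a i * a j * d i j := by
  have h : ∀ S : Finset ι, (∏ i ∈ Sᶜ, (1 - a i)) * ((∑ i ∈ S, ∑ j ∈ S, d i j) * ∏ i ∈ S, a i) =
      ∑ i, ∑ j, (if {i, j} ⊆ S then (∏ i ∈ S \ {i, j}, a i) * ∏ i ∈ Sᶜ, (1 - a i) else 0) *
        (a i * a j * d i j) := by
    intro S
    rw [← Finset.sum_subset (Finset.subset_univ S), Finset.sum_mul, Finset.mul_sum]
    · refine Finset.sum_congr rfl fun i hi => ?_
      rw [← Finset.sum_subset (Finset.subset_univ S), Finset.sum_mul, Finset.mul_sum]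
      · refine Finset.sum_congr rfl fun j hj => ?_
        have hsub : {i, j} ⊆ S := by
          intro l; simp only [Finset.mem_insert, Finset.mem_singleton]; rintro (rfl | rfl) <;> assumption
        rw [if_pos hsub]
        by_cases hij : i = j
        · subst hij; simp [hd]
        · rw [← Finset.prod_sdiff hsub, Finset.prod_pair hij]
          ring
      · intro j _ hj
        rw [if_neg fun h => hj (h (by simp)), zero_mul]
    · intro i _ hi
      exact Finset.sum_eq_zero fun j _ => by rw [if_neg fun h => hi (h (by simp)), zero_mul]
  rw [Finset.sum_congr rfl fun S _ => h S, Finset.sum_comm]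
  refine Finset.sum_congr rfl fun i _ => ?_
  rw [Finset.sum_comm]
  refine Finset.sum_congr rfl fun j _ => ?_
  rw [← Finset.sum_mul, sum_subset_prod, one_mul]

end Combinatorics

section Localization

variable {N : ℕ}

lemma fderiv_prod_mul {g : E3 → ℂ} (hg : ContDiff ℝ (⊤ : ℕ∞) g) {Φ : (Fin N → E3) → ℂ}
    (hΦ : ContDiff ℝ (⊤ : ℕ∞) Φ) (S : Finset (Fin N)) {j : Fin N} (hj : j ∈ S) (k : Fin 3)
    (x : Fin N → E3) :
    fderiv ℝ (fun y => (∏ i ∈ S, g (y i)) * Φ y) x (eVec N j k) =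
      (∏ i ∈ S.erase j, g (x i)) * fderiv ℝ (fun y => g (y j) * Φ y) x (eVec N j k) := by
  have hgi : ∀ i, ContDiff ℝ (⊤ : ℕ∞) fun y : Fin N → E3 => g (y i) := fun i =>
    hg.comp (contDiff_apply ℝ E3 i)
  have h1 : DifferentiableAt ℝ (fun y => (∏ i ∈ S, g (y i)) * Φ y) x :=
    ((contDiff_prod fun i _ => hgi i).mul hΦ).differentiable (by simp) x
  have h2 : DifferentiableAt ℝ (fun y => g (y j) * Φ y) x :=
    ((hgi j).mul hΦ).differentiable (by simp) x
  rw [← h1.lineDeriv_eq_fderiv, ← h2.lineDeriv_eq_fderiv]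
  simp only [lineDeriv]
  rw [← deriv_const_mul_field]
  congr 1
  ext t
  rw [← Finset.mul_prod_erase S _ hj]
  have : ∏ i ∈ S.erase j, g ((x + t • eVec N j k) i) = ∏ i ∈ S.erase j, g (x i) := by
    refine Finset.prod_congr rfl fun i hi => ?_
    simp [eVec, (Finset.mem_erase.1 hi).1]
  rw [this]
  ring

/-- Geometric localization: cutting off all particles by the same function `g` bounds the
nonmagnetic ground state energy. -/
lemma localization {Z α E : ℝ} (hE : E ≤ 0)
    (hle : ∀ n, 1 ≤ n → ∀ Ψ, IsWaveFun n Ψ → E ≤ clSchEnergy n Z α (fun _ => 0) Ψ)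
    {Ψ : (Fin N → E3) → (Fin N → Fin 2) → ℂ} (hΨ : IsWaveFun N Ψ) {g : E3 → ℂ}
    (hg : ContDiff ℝ (⊤ : ℕ∞) g) (hg1 : ∀ x, ‖g x‖ ≤ 1) :
    E ≤ (∑ s, ∫ x, ∑ j, ∑ k, ‖fderiv ℝ (fun y => g (y j) * Ψ y s) x (eVec N j k)‖ ^ 2) -
      Z * attW N (fun x => ‖g x‖ ^ 2) Ψ + repW N (fun x => ‖g x‖ ^ 2) Ψ := by
  have hgi : ∀ i, ContDiff ℝ (⊤ : ℕ∞) fun y : Fin N → E3 => g (y i) := fun i =>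
    hg.comp (contDiff_apply ℝ E3 i)
  set a : E3 → ℝ := fun x => ‖g x‖ ^ 2 with ha
  have hac : Continuous a := hg.continuous.norm.pow 2
  have ha0 : ∀ x, 0 ≤ a x := fun x => by positivity
  have ha1 : ∀ x, a x ≤ 1 := fun x => pow_le_one₀ (norm_nonneg _) (hg1 x)
  have haabs : ∀ x, |a x| ≤ 1 := fun x => by rw [abs_of_nonneg (ha0 x)]; exact ha1 x
  set Φ : Finset (Fin N) → (Fin N → E3) → (Fin N → Fin 2) → ℂ :=
    fun S x s => (∏ i ∈ S, g (x i)) * Ψ x s with hΦ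
  have hΦs : ∀ S s, ContDiff ℝ (⊤ : ℕ∞) fun x => Φ S x s := fun S s =>
    (contDiff_prod fun i _ => hgi i).mul (hΨ.smooth s)
  have hΦc : ∀ S s, HasCompactSupport fun x => Φ S x s := fun S s =>
    (hΨ.compactSupport s).mul_left
  set D : (Fin N → Fin 2) → (Fin N → E3) → Fin N → ℝ := fun s x j =>
    ∑ k, ‖fderiv ℝ (fun y => g (y j) * Ψ y s) x (eVec N j k)‖ ^ 2 with hD
  set f : Finset (Fin N) → (Fin N → Fin 2) → (Fin N → E3) → ℝ := fun S s x =>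
    (∏ i ∈ Sᶜ, (1 - a (x i))) * (enDens Z S (fun y => Φ S y s) x - E * ‖Φ S x s‖ ^ 2) with hf
  have hnorm : ∀ S x s, ‖Φ S x s‖ ^ 2 = (∏ i ∈ S, a (x i)) * ‖Ψ x s‖ ^ 2 := fun S x s => by
    simp only [hΦ, ha, norm_mul, norm_prod, mul_pow, Finset.prod_pow]
  have hS : ∀ S, 0 ≤ ∑ s, ∫ x, f S s x := by
    intro S
    set e := finSumEquivOfFinset (s := S) rfl rfl with he
    have hlb : leftBlock e = S := by
      ext i
      simp only [leftBlock, Finset.mem_map, Finset.mem_univ, true_and]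
      have := S.range_orderEmbOfFin rfl
      rw [← Finset.mem_coe, ← this]
      rfl
    have h := sum_integral_leftBlock_nonneg e (Z := Z) (fun i j hij => by simpa [he] using hij) hE
      hle (hΦs S) (hΦc S) ?_ (r := fun x => 1 - a x) (by fun_prop) (fun x => by linarith [ha1 x])
    · rwa [hlb] at h
    · rw [hlb]
      intro π hπ x s
      have : ∏ i ∈ S, g (x (π i)) = ∏ i ∈ S, g (x i) :=
        Finset.prod_equiv π (fun i => (hπ i).symm) fun i _ => rfl
      simp only [hΦ]
      rw [this, hΨ.antisymm]
      ring
  have hfi : ∀ S s, Integrable (f S s) := fun S s => by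
    have hρ : Continuous fun x : Fin N → E3 => ∏ i ∈ Sᶜ, (1 - a (x i)) :=
      continuous_finsetProd _ fun i _ => continuous_const.sub (hac.comp (continuous_apply i))
    have h1 := integrable_enDens Z S (hΦs S s) (hΦc S s) hρ
    have h2 : Integrable fun x => (∏ i ∈ Sᶜ, (1 - a (x i))) * (E * ‖Φ S x s‖ ^ 2) := by
      refine (hρ.mul (continuous_const.mul
        ((hΦs S s).continuous.norm.pow 2))).integrable_of_hasCompactSupport ?_
      exact (hΦc S s).norm_sq.mul_left.mul_left
    simp only [hf, mul_sub]
    exact h1.sub h2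
  have hsum : 0 ≤ ∑ s, ∫ x, ∑ S, f S s x := by
    calc 0 ≤ ∑ S, ∑ s, ∫ x, f S s x := Finset.sum_nonneg fun S _ => hS S
      _ = _ := by
        rw [Finset.sum_comm]
        exact Finset.sum_congr rfl fun s _ => (integral_finsetSum _ fun S _ => hfi S s).symm
  have hpt : ∀ s x, ∑ S, f S s x = ∑ j, D s x j - Z * (potA N a x * ‖Ψ x s‖ ^ 2) +
      potR N a x * ‖Ψ x s‖ ^ 2 - E * ‖Ψ x s‖ ^ 2 := by
    intro s x
    have h1 : ∀ S, f S s x = (∏ i ∈ Sᶜ, (1 - a (x i))) *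
          (∑ j ∈ S, (∏ i ∈ S.erase j, a (x i)) * D s x j) -
        Z * ((∏ i ∈ Sᶜ, (1 - a (x i))) * ((∑ j ∈ S, (enorm3 (x j))⁻¹) * ∏ i ∈ S, a (x i))) *
          ‖Ψ x s‖ ^ 2 +
        (∏ i ∈ Sᶜ, (1 - a (x i))) * ((∑ i ∈ S, ∑ j ∈ S,
          if i < j then (enorm3 (x i - x j))⁻¹ else 0) * ∏ i ∈ S, a (x i)) * ‖Ψ x s‖ ^ 2 -
        E * ‖Ψ x s‖ ^ 2 * ((∏ i ∈ Sᶜ, (1 - a (x i))) * ∏ i ∈ S, a (x i)) := by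
      intro S
      have h2 : ∑ j ∈ S, ∑ k, ‖fderiv ℝ (fun y => Φ S y s) x (eVec N j k)‖ ^ 2 =
          ∑ j ∈ S, (∏ i ∈ S.erase j, a (x i)) * D s x j := by
        refine Finset.sum_congr rfl fun j hj => ?_
        simp only [hΦ, fderiv_prod_mul hg (hΨ.smooth s) S hj, hD, Finset.mul_sum, norm_mul,
          norm_prod, mul_pow, Finset.prod_pow, ha]
      simp only [hf, enDens, h2, hnorm, coulS]
      ring
    simp only [h1]
    rw [Finset.sum_sub_distrib, Finset.sum_add_distrib, Finset.sum_sub_distrib, sum_prod_erase,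
      ← Finset.sum_mul, ← Finset.mul_sum, sum_prod_sum, ← Finset.sum_mul,
      sum_prod_sum_sum _ _ (by simp), ← Finset.mul_sum, sum_prod_one]
    simp only [potA, potR, mul_ite, mul_zero]
    ring
  have hDi : ∀ s, Integrable fun x => ∑ j, D s x j := by
    intro s
    refine integrable_finsetSum _ fun j _ => integrable_finsetSum _ fun k _ => ?_
    have hsm : ContDiff ℝ (⊤ : ℕ∞) fun y => g (y j) * Ψ y s := (hgi j).mul (hΨ.smooth s)
    have hd : Continuous fun x => fderiv ℝ (fun y => g (y j) * Ψ y s) x (eVec N j k) :=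
      (hsm.continuous_fderiv (by simp)).clm_apply continuous_const
    have hdc := (HasCompactSupport.mul_left (f := fun y : Fin N → E3 => g (y j))
      (hΨ.compactSupport s)).fderiv_apply ℝ (eVec N j k)
    exact integrable_norm_sq_of_hasCompactSupport hd hdc
  have hfinal : ∑ s, ∫ x, ∑ S, f S s x = (∑ s, ∫ x, ∑ j, D s x j) - Z * attW N a Ψ +
      repW N a Ψ - E := by
    rw [attW_eq_potInt hΨ hac.measurable haabs, repW_eq_potInt hΨ hac.measurable haabs]
    have hEn : E = ∑ s, ∫ x, E * ‖Ψ x s‖ ^ 2 := by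
      simp only [integral_const_mul, ← Finset.mul_sum]
      rw [hΨ.normalized, mul_one]
    rw [hEn]
    simp only [hpt, potInt, Finset.mul_sum, ← Finset.sum_sub_distrib, ← Finset.sum_add_distrib]
    refine Finset.sum_congr rfl fun s _ => ?_
    have iA := (integrable_potA hΨ hac.measurable haabs s).const_mul Z
    have iR := integrable_potR hΨ hac.measurable haabs s
    have iE := (integrable_normSq hΨ s).const_mul E
    have i1 : Integrable fun x => ∑ j, D s x j - Z * (potA N a x * ‖Ψ x s‖ ^ 2) := (hDi s).sub iA
    have i2 : Integrable fun x => ∑ j, D s x j - Z * (potA N a x * ‖Ψ x s‖ ^ 2) +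
      potR N a x * ‖Ψ x s‖ ^ 2 := i1.add iR
    rw [integral_sub i2 iE, integral_add i1 iR, integral_sub (hDi s) iA, integral_const_mul]
  rw [hfinal] at hsum
  linarith

end Localization

/-- The square of the magnetic gradient of a localization function. -/
def magGradSq (A : E3 → E3) (g : E3 → ℂ) (x : E3) : ℝ :=
  ∑ k : Fin 3, ‖fderiv ℝ g x (Pi.single k 1) - Complex.I * (A x k : ℂ) * g x‖ ^ 2

lemma continuous_magGradSq {A : E3 → E3} (hA : Continuous A) {g : E3 → ℂ}
    (hg : ContDiff ℝ (⊤ : ℕ∞) g) : Continuous (magGradSq A g) := by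
  unfold magGradSq
  have h1 : ∀ k : Fin 3, Continuous fun x => fderiv ℝ g x (Pi.single k 1) := fun k =>
    (hg.continuous_fderiv (by simp)).clm_apply continuous_const
  have h2 : ∀ k, Continuous fun x => A x k := fun k => (continuous_apply k).comp hA
  have h3 := hg.continuous
  fun_prop

lemma norm_add_sq_le_eps (a b : ℂ) {ε : ℝ} (hε : 0 < ε) :
    ‖a + b‖ ^ 2 ≤ (1 + ε) * ‖b‖ ^ 2 + (1 + ε⁻¹) * ‖a‖ ^ 2 := by
  have h1 : ‖a + b‖ ^ 2 ≤ (‖a‖ + ‖b‖) ^ 2 := by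
    gcongr
    exact norm_add_le a b
  have h2 : 0 ≤ ε⁻¹ * (‖a‖ - ε * ‖b‖) ^ 2 := by positivity
  have h3 : ε⁻¹ * (‖a‖ - ε * ‖b‖) ^ 2 = ε⁻¹ * ‖a‖ ^ 2 - 2 * ‖a‖ * ‖b‖ + ε * ‖b‖ ^ 2 := by
    field_simp
    ring
  nlinarith

section KineticLocalization

variable {N : ℕ}

lemma fderiv_slot_mul {g : E3 → ℂ} (hg : ContDiff ℝ (⊤ : ℕ∞) g) {Φ : (Fin N → E3) → ℂ}
    (hΦ : ContDiff ℝ (⊤ : ℕ∞) Φ) (j : Fin N) (k : Fin 3) (x : Fin N → E3) :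
    fderiv ℝ (fun y => g (y j) * Φ y) x (eVec N j k) =
      g (x j) * fderiv ℝ Φ x (eVec N j k) +
        fderiv ℝ g (x j) (Pi.single k 1) * Φ x := by
  have hgd : HasFDerivAt (fun y : Fin N → E3 => g (y j))
      ((fderiv ℝ g (x j)).comp (ContinuousLinearMap.proj j)) x :=
    ((hg.differentiable (by simp)) (x j)).hasFDerivAt.comp x (hasFDerivAt_apply j x)
  have hΦd := ((hΦ.differentiable (by simp)) x).hasFDerivAt
  have h := (hgd.mul hΦd).fderiv
  change fderiv ℝ (fun y => g (y j) * Φ y) x = _ at h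
  rw [h]
  simp [eVec, mul_comm]

/-- Removing the magnetic field by localizing with a gauge-transformed cutoff. -/
lemma kin_localized_le {Ψ : (Fin N → E3) → (Fin N → Fin 2) → ℂ} (hΨ : IsWaveFun N Ψ)
    {A : E3 → E3} (hA : Continuous A) {g : E3 → ℂ} (hg : ContDiff ℝ (⊤ : ℕ∞) g)
    (hg1 : ∀ x, ‖g x‖ ≤ 1) {ε B : ℝ} (hε : 0 < ε) (hB0 : 0 ≤ B)
    (hB : ∫⁻ x, ENNReal.ofReal (magGradSq A g x) ∂(dens N Ψ) ≤ ENNReal.ofReal B) :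
    ∑ s, ∫ x, ∑ j, ∑ k, ‖fderiv ℝ (fun y => g (y j) * Ψ y s) x (eVec N j k)‖ ^ 2 ≤
      (1 + ε) * kin N A Ψ + (1 + ε⁻¹) * B := by
  have hW := continuous_magGradSq hA hg
  have hW0 : ∀ x, 0 ≤ magGradSq A g x := fun x => Finset.sum_nonneg fun k _ => by positivity
  have hpt : ∀ s x, ∑ j, ∑ k, ‖fderiv ℝ (fun y => g (y j) * Ψ y s) x (eVec N j k)‖ ^ 2 ≤
      (1 + ε) * ∑ j, ∑ k, ‖covD A (fun y => Ψ y s) j k x‖ ^ 2 +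
        (1 + ε⁻¹) * ∑ j, magGradSq A g (x j) * ‖Ψ x s‖ ^ 2 := by
    intro s x
    rw [Finset.mul_sum, Finset.mul_sum, ← Finset.sum_add_distrib]
    refine Finset.sum_le_sum fun j _ => ?_
    rw [magGradSq, Finset.sum_mul, Finset.mul_sum, Finset.mul_sum, ← Finset.sum_add_distrib]
    refine Finset.sum_le_sum fun k _ => ?_
    rw [fderiv_slot_mul hg (hΨ.smooth s)]
    have h1 : g (x j) * fderiv ℝ (fun y => Ψ y s) x (eVec N j k) +
          fderiv ℝ g (x j) (Pi.single k 1) * Ψ x s =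
        (fderiv ℝ g (x j) (Pi.single k 1) - Complex.I * (A (x j) k : ℂ) * g (x j)) * Ψ x s +
          Complex.I * g (x j) * covD A (fun y => Ψ y s) j k x := by
      simp only [covD]
      linear_combination (g (x j) * fderiv ℝ (fun y => Ψ y s) x (eVec N j k)) * Complex.I_sq
    rw [h1]
    refine (norm_add_sq_le_eps _ _ hε).trans ?_
    rw [norm_mul, norm_mul, norm_mul, Complex.norm_I, one_mul, mul_pow, mul_pow]
    have h2 : ‖g (x j)‖ ^ 2 ≤ 1 := pow_le_one₀ (norm_nonneg _) (hg1 _)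
    have h3 : ‖g (x j)‖ ^ 2 * ‖covD A (fun y => Ψ y s) j k x‖ ^ 2 ≤
        1 * ‖covD A (fun y => Ψ y s) j k x‖ ^ 2 := by gcongr
    rw [one_mul] at h3
    gcongr
  have iD : ∀ s, Integrable fun x => ∑ j, ∑ k,
      ‖fderiv ℝ (fun y => g (y j) * Ψ y s) x (eVec N j k)‖ ^ 2 := by
    intro s
    refine integrable_finsetSum _ fun j _ => integrable_finsetSum _ fun k _ => ?_
    have hsm : ContDiff ℝ (⊤ : ℕ∞) fun y => g (y j) * Ψ y s :=
      (hg.comp (contDiff_apply ℝ E3 j)).mul (hΨ.smooth s)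
    have hd : Continuous fun x => fderiv ℝ (fun y => g (y j) * Ψ y s) x (eVec N j k) :=
      (hsm.continuous_fderiv (by simp)).clm_apply continuous_const
    have hdc := (HasCompactSupport.mul_left (f := fun y : Fin N → E3 => g (y j))
      (hΨ.compactSupport s)).fderiv_apply ℝ (eVec N j k)
    exact integrable_norm_sq_of_hasCompactSupport hd hdc
  have iK' : ∀ s j, Integrable fun x => ∑ k, ‖covD A (fun y => Ψ y s) j k x‖ ^ 2 := by
    intro s j
    refine integrable_finsetSum _ fun k _ => ?_
    exact integrable_norm_sq_of_hasCompactSupport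
      (continuous_covD hA ((hΨ.smooth s).of_le (by simp)) j k)
      (hasCompactSupport_covD (hΨ.compactSupport s) j k)
  have iK : ∀ s, Integrable fun x => ∑ j, ∑ k, ‖covD A (fun y => Ψ y s) j k x‖ ^ 2 := fun s =>
    integrable_finsetSum _ fun j _ => iK' s j
  have iW' : ∀ s j, Integrable fun x => magGradSq A g (x j) * ‖Ψ x s‖ ^ 2 := by
    intro s j
    have hc : Continuous fun x : Fin N → E3 => magGradSq A g (x j) * ‖Ψ x s‖ ^ 2 :=
      (hW.comp (continuous_apply j)).mul ((hΨ.smooth s).continuous.norm.pow 2)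
    exact hc.integrable_of_hasCompactSupport (hΨ.compactSupport s).norm_sq.mul_left
  have iW : ∀ s, Integrable fun x => ∑ j, magGradSq A g (x j) * ‖Ψ x s‖ ^ 2 := fun s =>
    integrable_finsetSum _ fun j _ => iW' s j
  have hkin : kin N A Ψ = ∑ s, ∫ x, ∑ j, ∑ k, ‖covD A (fun y => Ψ y s) j k x‖ ^ 2 := by
    unfold kin
    simp only [schKin_eq]
    rw [Finset.sum_comm]
    exact Finset.sum_congr rfl fun s _ => (integral_finsetSum _ fun j _ => iK' s j).symm
  have hBr : ∑ s, ∫ x, ∑ j, magGradSq A g (x j) * ‖Ψ x s‖ ^ 2 ≤ B := by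
    have h0 : ∀ s x, 0 ≤ ∑ j, magGradSq A g (x j) * ‖Ψ x s‖ ^ 2 := fun s x =>
      Finset.sum_nonneg fun j _ => mul_nonneg (hW0 _) (by positivity)
    rw [← ENNReal.ofReal_le_ofReal_iff hB0]
    refine le_of_eq_of_le ?_ hB
    rw [lintegral_dens (fun s => (hΨ.smooth s).continuous) hW.measurable.ennreal_ofReal,
      ENNReal.ofReal_sum_of_nonneg fun s _ => integral_nonneg (h0 s)]
    refine Finset.sum_congr rfl fun s _ => ?_
    rw [integral_finsetSum _ fun j _ => iW' s j, ENNReal.ofReal_sum_of_nonneg fun j _ =>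
      integral_nonneg fun x => mul_nonneg (hW0 _) (by positivity)]
    refine Finset.sum_congr rfl fun j _ => ?_
    rw [ofReal_integral_eq_lintegral_ofReal (iW' s j) (Filter.Eventually.of_forall fun x =>
      mul_nonneg (hW0 _) (by positivity))]
    refine lintegral_congr fun x => ?_
    rw [ENNReal.ofReal_mul (hW0 _), enorm_sq_eq_ofReal]
  calc _ ≤ ∑ s, ∫ x, ((1 + ε) * ∑ j, ∑ k, ‖covD A (fun y => Ψ y s) j k x‖ ^ 2 +
        (1 + ε⁻¹) * ∑ j, magGradSq A g (x j) * ‖Ψ x s‖ ^ 2) :=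
        Finset.sum_le_sum fun s _ => integral_mono (iD s)
          (((iK s).const_mul _).add ((iW s).const_mul _)) (hpt s)
    _ = (1 + ε) * kin N A Ψ +
        (1 + ε⁻¹) * ∑ s, ∫ x, ∑ j, magGradSq A g (x j) * ‖Ψ x s‖ ^ 2 := by
        rw [hkin, Finset.mul_sum, Finset.mul_sum, ← Finset.sum_add_distrib]
        refine Finset.sum_congr rfl fun s _ => ?_
        rw [integral_add ((iK s).const_mul _) ((iW s).const_mul _), integral_const_mul,
          integral_const_mul]
    _ ≤ _ := by gcongr

end KineticLocalization

section CurlDiv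

variable {A : E3 → E3}

lemma pdVec_eq (hA : ContDiff ℝ (⊤ : ℕ∞) A) (i j : Fin 3) :
    pdVec A i j = fun x => fderiv ℝ (fun y => A y j) x (Pi.single i 1) := by
  ext x
  rw [fderiv_apply (hA.differentiable (by simp) x) j]
  rfl

lemma contDiff_comp_apply (hA : ContDiff ℝ (⊤ : ℕ∞) A) (j : Fin 3) :
    ContDiff ℝ (⊤ : ℕ∞) fun x => A x j :=
  (contDiff_apply ℝ ℝ j).comp hA

lemma hasCompactSupport_comp_apply (hA : HasCompactSupport A) (j : Fin 3) :
    HasCompactSupport fun x => A x j :=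
  hA.comp_left (g := fun v : E3 => v j) rfl

lemma contDiff_pdVec (hA : ContDiff ℝ (⊤ : ℕ∞) A) (i j : Fin 3) :
    ContDiff ℝ (⊤ : ℕ∞) (pdVec A i j) := by
  rw [pdVec_eq hA]
  exact ((contDiff_comp_apply hA j).fderiv_right (m := (⊤ : ℕ∞)) (by simp)).clm_apply
    contDiff_const

lemma hasCompactSupport_pdVec (hA : ContDiff ℝ (⊤ : ℕ∞) A) (hc : HasCompactSupport A)
    (i j : Fin 3) : HasCompactSupport (pdVec A i j) := by
  rw [pdVec_eq hA]
  exact (hasCompactSupport_comp_apply hc j).fderiv_apply ℝ _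

lemma fderiv_pdVec_comm (hA : ContDiff ℝ (⊤ : ℕ∞) A) (i j k : Fin 3) (x : E3) :
    fderiv ℝ (pdVec A j k) x (Pi.single i 1) = fderiv ℝ (pdVec A i k) x (Pi.single j 1) := by
  have hd : DifferentiableAt ℝ (fderiv ℝ fun y => A y k) x :=
    ((contDiff_comp_apply hA k).fderiv_right (m := 1) (by norm_cast)).differentiable (by simp) x
  have h : ∀ v w : E3, fderiv ℝ (fun x => fderiv ℝ (fun y => A y k) x v) x w =
      fderiv ℝ (fderiv ℝ fun y => A y k) x w v := by
    intro v w
    rw [fderiv_clm_apply hd (by fun_prop)]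
    simp
  rw [pdVec_eq hA, pdVec_eq hA, h, h]
  exact ((contDiff_comp_apply hA k).contDiffAt.isSymmSndFDerivAt (by simp; norm_cast)).eq _ _

lemma integral_mul_pdVec (hA : ContDiff ℝ (⊤ : ℕ∞) A) (hc : HasCompactSupport A)
    (i j : Fin 3) :
    ∫ x, pdVec A i j x * pdVec A j i x =
      -∫ x, A x j * fderiv ℝ (pdVec A i i) x (Pi.single j 1) := by
  have hAj := contDiff_comp_apply hA j
  have hAjc := hasCompactSupport_comp_apply hc j
  have hp := contDiff_pdVec hA j i
  have h : ∀ f : E3 → ℝ, Continuous f → Integrable fun x => A x j * f x := fun f hf =>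
    (hAj.continuous.mul hf).integrable_of_hasCompactSupport hAjc.mul_right
  have hfd : Continuous fun x => fderiv ℝ (pdVec A j i) x (Pi.single i 1) :=
    (hp.continuous_fderiv (by simp)).clm_apply continuous_const
  have key := integral_mul_fderiv_eq_neg_fderiv_mul_of_integrable (μ := volume)
    (f := fun x => A x j) (g := pdVec A j i) (v := Pi.single i (1 : ℝ)) ?_ (h _ hfd)
    (h _ hp.continuous)
    (fun x _ => hAj.differentiable (by simp) x) (fun x _ => hp.differentiable (by simp) x)
  · have h2 : (fun x => fderiv ℝ (fun y => A y j) x (Pi.single i 1) * pdVec A j i x) =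
        fun x => pdVec A i j x * pdVec A j i x := by
      rw [pdVec_eq hA i j]
    rw [h2] at key
    simp only [fderiv_pdVec_comm hA i j i] at key
    linarith
  · have h2 := pdVec_eq hA i j
    have : Integrable fun x => pdVec A i j x * pdVec A j i x :=
      ((contDiff_pdVec hA i j).continuous.mul hp.continuous).integrable_of_hasCompactSupport
        (hasCompactSupport_pdVec hA hc i j).mul_right
    rwa [h2] at this

/-- For a divergence-free field the Dirichlet integral equals the integral of the squared curl. -/
lemma integral_gradSq_eq (hA : IsVecPot A) : ∫ x, gradSq A x = ∫ x, curlSq A x := by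
  obtain ⟨hs, hc, hdiv⟩ := hA
  have hp := fun i j => (contDiff_pdVec hs i j).continuous
  have hpc := fun i j => hasCompactSupport_pdVec hs hc i j
  have hi2 : ∀ i j, Integrable fun x => pdVec A i j x * pdVec A j i x := fun i j =>
    ((hp i j).mul (hp j i)).integrable_of_hasCompactSupport (hpc i j).mul_right
  have hg : Integrable fun x => gradSq A x := by
    unfold gradSq
    refine integrable_finsetSum _ fun i _ => integrable_finsetSum _ fun j _ => ?_
    simp only [pow_two]
    exact ((hp i j).mul (hp i j)).integrable_of_hasCompactSupport (hpc i j).mul_right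
  have hpt : ∀ x, curlSq A x = gradSq A x - ∑ j, ∑ i, pdVec A i j x * pdVec A j i x := by
    intro x
    simp only [curlSq, gradSq, curl3, Fin.sum_univ_three, Matrix.cons_val_zero,
      Matrix.cons_val_one, Matrix.cons_val]
    ring
  have h0 : ∫ x, ∑ j, ∑ i, pdVec A i j x * pdVec A j i x = 0 := by
    rw [integral_finsetSum _ fun j _ => integrable_finsetSum _ fun i _ => hi2 i j]
    refine Finset.sum_eq_zero fun j _ => ?_
    rw [integral_finsetSum _ fun i _ => hi2 i j]
    simp only [integral_mul_pdVec hs hc]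
    rw [Finset.sum_neg_distrib, ← integral_finsetSum]
    · have : ∀ x, ∑ i, A x j * fderiv ℝ (pdVec A i i) x (Pi.single j 1) = 0 := by
        intro x
        rw [← Finset.mul_sum]
        have hz : (fun y => ∑ i, pdVec A i i y) = fun _ => 0 := funext hdiv
        have h1 := congrArg (fun f => fderiv ℝ f x (Pi.single j 1)) hz
        rw [fderiv_fun_sum fun i _ => (contDiff_pdVec hs i i).differentiable (by simp) x] at h1
        simp only [FunLike.coe_sum, Finset.sum_apply] at h1
        rw [h1]
        simp
      simp [this]
    · intro i _
      refine ((contDiff_comp_apply hs j).continuous.mul ?_).integrable_of_hasCompactSupport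
        (hasCompactSupport_comp_apply hc j).mul_right
      exact ((contDiff_pdVec hs i i).continuous_fderiv (by simp)).clm_apply continuous_const
  simp only [hpt]
  rw [integral_sub hg (integrable_finsetSum _ fun j _ => integrable_finsetSum _ fun i _ =>
    hi2 i j), h0, sub_zero]

lemma norm_fderiv_sq_le (A : E3 → E3) (x : E3) : ‖fderiv ℝ A x‖ ^ 2 ≤ 3 * gradSq A x := by
  have hg : 0 ≤ 3 * gradSq A x := by unfold gradSq; positivity
  rw [← Real.sq_sqrt hg]
  refine pow_le_pow_left₀ (norm_nonneg _) ?_ 2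
  refine ContinuousLinearMap.opNorm_le_bound _ (Real.sqrt_nonneg _) fun v => ?_
  rw [pi_norm_le_iff_of_nonneg (by positivity)]
  intro j
  have hv : v = ∑ i, v i • (Pi.single i (1 : ℝ) : E3) := by
    ext k
    simp [Finset.sum_apply, Pi.single_apply]
  have h1 : fderiv ℝ A x v j = ∑ i, v i * pdVec A i j x := by
    conv_lhs => rw [hv]
    simp only [map_sum, map_smul, Finset.sum_apply, Pi.smul_apply, smul_eq_mul, pdVec]
  have h2 : |∑ i, v i * pdVec A i j x| ≤ (∑ i, |pdVec A i j x|) * ‖v‖ := by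
    refine (Finset.abs_sum_le_sum_abs _ _).trans ?_
    rw [Finset.sum_mul]
    refine Finset.sum_le_sum fun i _ => ?_
    rw [abs_mul, mul_comm]
    exact mul_le_mul_of_nonneg_left (norm_le_pi_norm v i) (abs_nonneg _)
  rw [h1, Real.norm_eq_abs]
  refine h2.trans (mul_le_mul_of_nonneg_right ?_ (norm_nonneg _))
  refine Real.le_sqrt_of_sq_le ?_
  have h3 : (∑ i, |pdVec A i j x|) ^ 2 ≤ 3 * ∑ i, pdVec A i j x ^ 2 := by
    have := sq_sum_le_card_mul_sum_sq (s := Finset.univ) (f := fun i => |pdVec A i j x|)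
    simpa using this
  refine h3.trans ?_
  unfold gradSq
  gcongr with i
  exact Finset.single_le_sum (f := fun j => pdVec A i j x ^ 2) (fun _ _ => by positivity)
    (Finset.mem_univ j)

lemma lintegral_fderiv_sq_le (hA : IsVecPot A) :
    ∫⁻ x, ‖fderiv ℝ A x‖ₑ ^ 2 ≤ ENNReal.ofReal (3 * ∫ x, curlSq A x) := by
  rw [← integral_gradSq_eq hA, ← integral_const_mul]
  obtain ⟨hs, hc, -⟩ := hA
  have hg : Integrable fun x => 3 * gradSq A x := by
    unfold gradSq
    refine (integrable_finsetSum _ fun i _ => integrable_finsetSum _ fun j _ => ?_).const_mul 3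
    simp only [pow_two]
    exact ((contDiff_pdVec hs i j).continuous.mul
      (contDiff_pdVec hs i j).continuous).integrable_of_hasCompactSupport
        (hasCompactSupport_pdVec hs hc i j).mul_right
  rw [ofReal_integral_eq_lintegral_ofReal hg (Filter.Eventually.of_forall fun x => by
    unfold gradSq; positivity)]
  refine lintegral_mono fun x => ?_
  rw [enorm_sq_eq_ofReal]
  exact ENNReal.ofReal_le_ofReal (norm_fderiv_sq_le A x)

end CurlDiv

section Poincare

variable {A : E3 → E3} {S : Set E3}

lemma lintegral_contract_le (hS : Convex ℝ S) (hSm : MeasurableSet S) {G : E3 → ENNReal}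
    (hG : Measurable G) {x : E3} (hx : x ∈ S) {t : ℝ} (ht : 1 / 2 ≤ t) (ht1 : t ≤ 1) :
    ∫⁻ y in S, G (x + t • (y - x)) ≤ 8 * ∫⁻ z in S, G z := by
  have ht0 : t ≠ 0 := by linarith
  have hF : Measurable fun z => S.indicator G (z + (1 - t) • x) :=
    (hG.indicator hSm).comp (measurable_id.add_const _)
  have h8 : ENNReal.ofReal |(t ^ Module.finrank ℝ E3)⁻¹| ≤ 8 := by
    rw [show (8 : ENNReal) = ENNReal.ofReal 8 by norm_num]
    refine ENNReal.ofReal_le_ofReal ?_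
    have h3 : Module.finrank ℝ E3 = 3 := by simp
    rw [h3, abs_of_nonneg (by positivity)]
    refine inv_le_of_inv_le₀ (by norm_num) ?_
    calc (8 : ℝ)⁻¹ = (1 / 2) ^ 3 := by norm_num
      _ ≤ t ^ 3 := by gcongr
  calc ∫⁻ y in S, G (x + t • (y - x))
      = ∫⁻ y, S.indicator (fun y => G (x + t • (y - x))) y := (lintegral_indicator hSm _).symm
    _ ≤ ∫⁻ y, S.indicator G (t • y + (1 - t) • x) := by
        refine lintegral_mono fun y => ?_
        by_cases hy : y ∈ S
        · have h1 : x + t • (y - x) = t • y + (1 - t) • x := by module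
          have h2 : t • y + (1 - t) • x ∈ S :=
            hS hy hx (by linarith) (by linarith) (by ring)
          rw [Set.indicator_of_mem hy, Set.indicator_of_mem h2, h1]
        · rw [Set.indicator_of_notMem hy]
          exact zero_le
    _ = ∫⁻ z, S.indicator G (z + (1 - t) • x) ∂(Measure.map (t • ·) volume) :=
        (lintegral_map hF (measurable_const_smul t)).symm
    _ = ENNReal.ofReal |(t ^ Module.finrank ℝ E3)⁻¹| * ∫⁻ z, S.indicator G z := by
        rw [Measure.map_addHaar_smul _ ht0, lintegral_smul_measure,
          lintegral_add_right_eq_self (fun z => S.indicator G z), smul_eq_mul]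
    _ ≤ 8 * ∫⁻ z in S, G z := by
        rw [lintegral_indicator hSm]
        gcongr

lemma lintegral_segment_le (hS : Convex ℝ S) (hSm : MeasurableSet S) {G : E3 → ENNReal}
    (hG : Measurable G) {t : ℝ} (ht0 : 0 ≤ t) (ht1 : t ≤ 1) :
    ∫⁻ x in S, ∫⁻ y in S, G (x + t • (y - x)) ≤ 8 * volume S * ∫⁻ z in S, G z := by
  have key : ∀ f : E3 → ENNReal, (∀ x ∈ S, f x ≤ 8 * ∫⁻ z in S, G z) →
      ∫⁻ x in S, f x ≤ 8 * volume S * ∫⁻ z in S, G z := by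
    intro f hf
    calc ∫⁻ x in S, f x ≤ ∫⁻ x in S, 8 * ∫⁻ z in S, G z := setLIntegral_mono' hSm hf
      _ = 8 * volume S * ∫⁻ z in S, G z := by
        rw [setLIntegral_const]
        ring
  rcases le_total (1 / 2) t with h | h
  · exact key _ fun x hx => lintegral_contract_le hS hSm hG hx h ht1
  · have hmeas : Measurable (Function.uncurry fun x y : E3 => G (x + t • (y - x))) :=
      hG.comp (by fun_prop)
    rw [lintegral_lintegral_swap hmeas.aemeasurable]
    refine key _ fun y hy => ?_
    have h1 : ∀ x : E3, x + t • (y - x) = y + (1 - t) • (x - y) := fun x => by module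
    simp only [h1]
    exact lintegral_contract_le hS hSm hG hy (by linarith) (by linarith)

/-- The Poincaré inequality on a convex set. -/
lemma poincare (hA : ContDiff ℝ 1 A) (hAc : HasCompactSupport A) (hS : Convex ℝ S)
    (hSm : MeasurableSet S) (hS0 : volume S ≠ 0) (hST : volume S ≠ ⊤) {d : ℝ}
    (hd : ∀ x ∈ S, ∀ y ∈ S, ‖y - x‖ ≤ d) :
    ∫⁻ x in S, ‖A x - ⨍ y in S, A y‖ₑ ^ 2 ≤
      8 * ENNReal.ofReal d ^ 2 * ∫⁻ x in S, ‖fderiv ℝ A x‖ₑ ^ 2 := by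
  set G : E3 → ENNReal := fun x => ‖fderiv ℝ A x‖ₑ ^ 2 with hG
  have hGm : Measurable G := by
    have := hA.continuous_fderiv (by simp)
    exact Continuous.measurable (by fun_prop)
  set μ : Measure E3 := (volume S)⁻¹ • volume.restrict S with hμ
  have hprob : IsProbabilityMeasure μ := ⟨by
    simp [hμ, ENNReal.inv_mul_cancel hS0 hST]⟩
  have hAcont := hA.continuous
  have hAi : Integrable A μ :=
    ((hAcont.integrable_of_hasCompactSupport hAc).restrict).smul_measure (by simpa using hS0)
  have hav : ∀ x, A x - ⨍ y in S, A y = ∫ y, (A x - A y) ∂μ := by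
    intro x
    rw [integral_sub (integrable_const _) hAi, integral_const, average, Measure.restrict_apply_univ]
    simp [hμ]
  have h1 : ∀ x, ‖A x - ⨍ y in S, A y‖ₑ ^ 2 ≤
      (volume S)⁻¹ * ∫⁻ y in S, ‖A x - A y‖ₑ ^ 2 := by
    intro x
    rw [hav]
    refine (enorm_sq_integral_le (by fun_prop)).trans ?_
    rw [hμ, lintegral_smul_measure, smul_eq_mul]
  have h2 : ∀ x ∈ S, ∀ y ∈ S, ‖A x - A y‖ₑ ^ 2 ≤
      ∫⁻ t in Set.Ioc (0 : ℝ) 1, ENNReal.ofReal d ^ 2 * G (x + t • (y - x)) := by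
    intro x hx y hy
    have hder : ∀ t : ℝ, HasDerivAt (fun t : ℝ => A (x + t • (y - x)))
        (fderiv ℝ A (x + t • (y - x)) (y - x)) t := by
      intro t
      have hl : HasDerivAt (fun t : ℝ => x + t • (y - x)) (y - x) t := by
        simpa using ((hasDerivAt_id t).smul_const (y - x)).const_add x
      exact ((hA.differentiable (by simp) _).hasFDerivAt).comp_hasDerivAt t hl
    have hc : Continuous fun t : ℝ => fderiv ℝ A (x + t • (y - x)) (y - x) :=
      ((hA.continuous_fderiv (by simp)).comp (by fun_prop)).clm_apply continuous_const
    have := enorm_sq_sub_le_of_hasDerivAt hder hc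
    simp only [one_smul, zero_smul, add_zero, add_sub_cancel] at this
    rw [← enorm_neg, neg_sub]
    refine this.trans (lintegral_mono fun t => ?_)
    rw [hG, mul_comm, ← mul_pow]
    gcongr
    calc ‖fderiv ℝ A (x + t • (y - x)) (y - x)‖ₑ
        ≤ ‖fderiv ℝ A (x + t • (y - x))‖ₑ * ‖y - x‖ₑ := ContinuousLinearMap.le_opENorm _ _
      _ ≤ _ := by
        gcongr
        rw [← ofReal_norm]
        exact ENNReal.ofReal_le_ofReal (hd x hx y hy)
  have hm3 : Measurable fun p : (ℝ × E3) × E3 => G (p.1.2 + p.1.1 • (p.2 - p.1.2)) :=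
    hGm.comp (by fun_prop)
  calc ∫⁻ x in S, ‖A x - ⨍ y in S, A y‖ₑ ^ 2
      ≤ ∫⁻ x in S, (volume S)⁻¹ * ∫⁻ y in S,
          ∫⁻ t in Set.Ioc (0 : ℝ) 1, ENNReal.ofReal d ^ 2 * G (x + t • (y - x)) := by
        refine setLIntegral_mono' hSm fun x hx => (h1 x).trans ?_
        exact mul_le_mul' le_rfl (setLIntegral_mono' hSm (h2 x hx))
    _ = (volume S)⁻¹ * ENNReal.ofReal d ^ 2 *
          ∫⁻ t in Set.Ioc (0 : ℝ) 1, ∫⁻ x in S, ∫⁻ y in S, G (x + t • (y - x)) := by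
        rw [lintegral_const_mul' _ _ (by simpa using hS0), mul_assoc]
        congr 1
        rw [← lintegral_const_mul' _ _ (by simp)]
        have e1 : ∀ x : E3, ∫⁻ y in S, ∫⁻ t in Set.Ioc (0 : ℝ) 1,
              ENNReal.ofReal d ^ 2 * G (x + t • (y - x)) =
            ∫⁻ t in Set.Ioc (0 : ℝ) 1, ENNReal.ofReal d ^ 2 *
              ∫⁻ y in S, G (x + t • (y - x)) := by
          intro x
          rw [lintegral_lintegral_swap]
          · exact lintegral_congr fun t => lintegral_const_mul' _ _ (by simp)
          · have : Measurable fun p : E3 × ℝ => G (x + p.2 • (p.1 - x)) :=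
              hGm.comp (by fun_prop)
            exact (this.const_mul _).aemeasurable
        simp only [e1]
        rw [lintegral_lintegral_swap]
        · exact lintegral_congr fun t => lintegral_const_mul' _ _ (by simp)
        · have : Measurable fun p : ℝ × E3 => ∫⁻ y in S, G (p.2 + p.1 • (y - p.2)) :=
            hm3.lintegral_prod_right'
          exact ((this.comp measurable_swap).const_mul _).aemeasurable
    _ ≤ (volume S)⁻¹ * ENNReal.ofReal d ^ 2 *
          ∫⁻ t in Set.Ioc (0 : ℝ) 1, 8 * volume S * ∫⁻ z in S, G z := by
        exact mul_le_mul' le_rfl (setLIntegral_mono' measurableSet_Ioc fun t ht =>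
          lintegral_segment_le hS hSm hGm ht.1.le ht.2)
    _ = (volume S)⁻¹ * volume S * (8 * ENNReal.ofReal d ^ 2 * ∫⁻ z in S, G z) := by
        rw [setLIntegral_const]
        simp
        ring
    _ = _ := by rw [ENNReal.inv_mul_cancel hS0 hST, one_mul]

end Poincare

/-- A local Sobolev inequality on cubes. -/
lemma exists_sobolev_cube : ∃ C : ℝ, 0 < C ∧ ∀ A : E3 → E3, ContDiff ℝ 1 A →
    HasCompactSupport A → ∀ (c : E3) (r : ℝ), 0 < r →
      ∫⁻ x in Metric.closedBall c r, ‖A x - ⨍ y in Metric.closedBall c (3 * r), A y‖ₑ ^ 6 ≤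
        ENNReal.ofReal C * (∫⁻ x in Metric.closedBall c (3 * r), ‖fderiv ℝ A x‖ₑ ^ 2) ^ 3 := by
  let χ : ContDiffBump (0 : E3) := ⟨1, 2, one_pos, one_lt_two⟩
  obtain ⟨K, hK⟩ := (χ.hasCompactSupport.fderiv ℝ).exists_bound_of_continuous
    ((χ.contDiff (n := 1)).continuous_fderiv (by simp))
  have hK0 : 0 ≤ K := (norm_nonneg _).trans (hK 0)
  set L : NNReal := SNormLESNormFDerivOfEqConst E3 (volume : Measure E3) 2 with hL
  refine ⟨(L : ℝ) ^ 6 * (2 + 576 * K ^ 2) ^ 3 + 1, by positivity, fun A hA hAc c r hr => ?_⟩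
  set S := Metric.closedBall c (3 * r) with hS
  set a : E3 := ⨍ y in S, A y with ha
  set τ : ENNReal := ∫⁻ x in S, ‖fderiv ℝ A x‖ₑ ^ 2 with hτ
  have hSm : MeasurableSet S := Metric.isClosed_closedBall.measurableSet
  set ρ : E3 → ℝ := fun x => χ (r⁻¹ • (x - c)) with hρ
  have hρs : ContDiff ℝ 1 ρ := χ.contDiff.comp (by fun_prop)
  have hρ1 : ∀ x, ‖ρ x‖ ≤ 1 := fun x => by
    rw [Real.norm_eq_abs, abs_of_nonneg χ.nonneg]
    exact χ.le_one
  have hρD : ∀ x, ‖fderiv ℝ ρ x‖ ≤ K / r := by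
    intro x
    have hl : HasFDerivAt (fun x : E3 => r⁻¹ • (x - c)) (r⁻¹ • ContinuousLinearMap.id ℝ E3) x :=
      ((hasFDerivAt_id x).sub_const c).const_smul r⁻¹
    have h := (((χ.contDiff (n := 1)).differentiable (by simp)
      (r⁻¹ • (x - c))).hasFDerivAt.comp x hl).fderiv
    change fderiv ℝ ρ x = _ at h
    rw [h]
    refine (ContinuousLinearMap.opNorm_comp_le _ _).trans ?_
    rw [norm_smul, norm_inv, Real.norm_of_nonneg hr.le, div_eq_mul_inv]
    have := ContinuousLinearMap.norm_id_le (𝕜 := ℝ) (E := E3)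
    calc _ ≤ K * (r⁻¹ * 1) := by
          gcongr
          exact hK _
      _ = _ := by ring
  set u : E3 → E3 := fun x => ρ x • (A x - a) with hu
  have hus : ContDiff ℝ 1 u := hρs.smul (hA.sub contDiff_const)
  have hu0 : ∀ x, x ∉ Metric.closedBall c (2 * r) → u x = 0 := by
    intro x hx
    have : ρ x = 0 := by
      refine χ.zero_of_le_dist ?_
      rw [Metric.mem_closedBall, not_le, dist_eq_norm] at hx
      rw [dist_zero_right, norm_smul, norm_inv, Real.norm_of_nonneg hr.le]
      change 2 ≤ r⁻¹ * ‖x - c‖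
      rw [inv_mul_eq_div, le_div_iff₀ hr]
      exact hx.le
    rw [hu]
    simp [this]
  have huc : HasCompactSupport u := HasCompactSupport.intro (isCompact_closedBall c (2 * r)) hu0
  have hDu : ∀ x, ‖fderiv ℝ u x‖ₑ ^ 2 ≤ S.indicator (fun x => 2 * ‖fderiv ℝ A x‖ₑ ^ 2 +
      ENNReal.ofReal (2 * (K / r) ^ 2) * ‖A x - a‖ₑ ^ 2) x := by
    intro x
    by_cases hx : x ∈ S
    · rw [Set.indicator_of_mem hx]
      have h := ((hρs.differentiable (by simp) x).hasFDerivAt.smul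
        ((hA.differentiable (by simp) x).hasFDerivAt.sub_const a)).fderiv
      change fderiv ℝ u x = _ at h
      have h1 : ‖fderiv ℝ u x‖ ≤ ‖fderiv ℝ A x‖ + K / r * ‖A x - a‖ := by
        rw [h]
        refine (norm_add_le _ _).trans (add_le_add ?_ ?_)
        · rw [norm_smul]
          exact mul_le_of_le_one_left (norm_nonneg _) (hρ1 x)
        · rw [ContinuousLinearMap.norm_smulRight_apply]
          gcongr
          exact hρD x
      have h2 : ‖fderiv ℝ u x‖ ^ 2 ≤
          2 * ‖fderiv ℝ A x‖ ^ 2 + 2 * (K / r) ^ 2 * ‖A x - a‖ ^ 2 := by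
        refine (pow_le_pow_left₀ (norm_nonneg _) h1 2).trans ?_
        nlinarith [sq_nonneg (‖fderiv ℝ A x‖ - K / r * ‖A x - a‖)]
      rw [enorm_sq_eq_ofReal, enorm_sq_eq_ofReal, enorm_sq_eq_ofReal,
        ← ENNReal.ofReal_mul (by positivity),
        show (2 : ENNReal) = ENNReal.ofReal 2 by norm_num, ← ENNReal.ofReal_mul (by norm_num),
        ← ENNReal.ofReal_add (by positivity) (by positivity)]
      exact ENNReal.ofReal_le_ofReal h2
    · have h1 : x ∉ tsupport (fderiv ℝ u) := by
        intro h
        have h2 := tsupport_fderiv_subset ℝ h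
        have h3 : tsupport u ⊆ Metric.closedBall c (2 * r) :=
          closure_minimal (fun y hy => by_contra fun h => hy (hu0 y h)) Metric.isClosed_closedBall
        exact hx (Metric.closedBall_subset_closedBall (by linarith) (h3 h2))
      have h0 : ‖fderiv ℝ u x‖ = 0 := norm_eq_zero.2 (image_eq_zero_of_notMem_tsupport h1)
      rw [enorm_sq_eq_ofReal, h0, zero_pow two_ne_zero, ENNReal.ofReal_zero]
      exact zero_le
  have hvol : volume S = ENNReal.ofReal ((2 * (3 * r)) ^ 3) := by
    rw [hS, Real.volume_pi_closedBall _ (by positivity)]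
    simp
  have hP : ∫⁻ x in S, ‖A x - a‖ₑ ^ 2 ≤ 8 * ENNReal.ofReal (6 * r) ^ 2 * τ := by
    refine poincare hA hAc (convex_closedBall c _) hSm ?_ ?_ ?_
    · rw [hvol, ne_eq, ENNReal.ofReal_eq_zero, not_le]
      positivity
    · rw [hvol]
      exact ENNReal.ofReal_ne_top
    · intro x hx y hy
      rw [← dist_eq_norm]
      have h1 := dist_triangle_right y x c
      rw [Metric.mem_closedBall] at hx hy
      linarith
  have hDuL : ∫⁻ x, ‖fderiv ℝ u x‖ₑ ^ 2 ≤ ENNReal.ofReal (2 + 576 * K ^ 2) * τ := by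
    have hAm : Measurable fun x => 2 * ‖fderiv ℝ A x‖ₑ ^ 2 := by
      have := hA.continuous_fderiv (by simp)
      exact (Continuous.measurable (f := fun x => ‖fderiv ℝ A x‖ₑ ^ 2) (by fun_prop)).const_mul _
    calc ∫⁻ x, ‖fderiv ℝ u x‖ₑ ^ 2
        ≤ ∫⁻ x in S, (2 * ‖fderiv ℝ A x‖ₑ ^ 2 +
            ENNReal.ofReal (2 * (K / r) ^ 2) * ‖A x - a‖ₑ ^ 2) := by
          rw [← lintegral_indicator hSm]
          exact lintegral_mono hDu
      _ = 2 * τ + ENNReal.ofReal (2 * (K / r) ^ 2) * ∫⁻ x in S, ‖A x - a‖ₑ ^ 2 := by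
          rw [lintegral_add_left hAm, lintegral_const_mul' _ _ (by simp),
            lintegral_const_mul' _ _ ENNReal.ofReal_ne_top]
      _ ≤ 2 * τ + ENNReal.ofReal (2 * (K / r) ^ 2) * (8 * ENNReal.ofReal (6 * r) ^ 2 * τ) := by
          gcongr
      _ = ENNReal.ofReal (2 + 576 * K ^ 2) * τ := by
          rw [ENNReal.ofReal_add (by norm_num) (by positivity), add_mul,
            ← mul_assoc, ← ENNReal.ofReal_pow (by positivity),
            show (8 : ENNReal) = ENNReal.ofReal 8 by norm_num,
            ← ENNReal.ofReal_mul (by norm_num), ← ENNReal.ofReal_mul (by positivity)]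
          congr 2
          · norm_num
          · congr 1
            field_simp
            ring
  have hGNS := eLpNorm_le_eLpNorm_fderiv_of_eq (μ := (volume : Measure E3)) hus huc
    (p := 2) (p' := 6) (by norm_num) (by simp) (by simp; norm_num)
  have h6 : eLpNorm u (6 : NNReal) volume ^ 6 = ∫⁻ x, ‖u x‖ₑ ^ 6 := by
    have := eLpNorm_nnreal_pow_eq_lintegral (μ := (volume : Measure E3)) (f := u) (p := 6)
      (by norm_num)
    rw [show ((6 : NNReal) : ℝ) = ((6 : ℕ) : ℝ) by norm_num] at this
    simpa only [ENNReal.rpow_natCast] using this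
  have h2 : eLpNorm (fderiv ℝ u) (2 : NNReal) volume ^ 2 = ∫⁻ x, ‖fderiv ℝ u x‖ₑ ^ 2 := by
    have := eLpNorm_nnreal_pow_eq_lintegral (μ := (volume : Measure E3)) (f := fderiv ℝ u) (p := 2)
      (by norm_num)
    rw [show ((2 : NNReal) : ℝ) = ((2 : ℕ) : ℝ) by norm_num] at this
    simpa only [ENNReal.rpow_natCast] using this
  calc ∫⁻ x in Metric.closedBall c r, ‖A x - a‖ₑ ^ 6
      = ∫⁻ x in Metric.closedBall c r, ‖u x‖ₑ ^ 6 := by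
        refine setLIntegral_congr_fun Metric.isClosed_closedBall.measurableSet fun x hx => ?_
        have h1 : ρ x = 1 := by
          refine χ.one_of_mem_closedBall ?_
          rw [Metric.mem_closedBall, dist_eq_norm] at hx
          rw [mem_closedBall_zero_iff, norm_smul, norm_inv, Real.norm_of_nonneg hr.le]
          change r⁻¹ * ‖x - c‖ ≤ 1
          rw [inv_mul_eq_div, div_le_one hr]
          exact hx
        simp only [hu, h1, one_smul]
    _ ≤ ∫⁻ x, ‖u x‖ₑ ^ 6 := setLIntegral_le_lintegral _ _
    _ = eLpNorm u (6 : NNReal) volume ^ 6 := h6.symm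
    _ ≤ (L * eLpNorm (fderiv ℝ u) (2 : NNReal) volume) ^ 6 := by gcongr; exact hGNS
    _ = (L : ENNReal) ^ 6 * (∫⁻ x, ‖fderiv ℝ u x‖ₑ ^ 2) ^ 3 := by
        rw [← h2]
        ring
    _ ≤ (L : ENNReal) ^ 6 * (ENNReal.ofReal (2 + 576 * K ^ 2) * τ) ^ 3 := by gcongr
    _ = ENNReal.ofReal ((L : ℝ) ^ 6 * (2 + 576 * K ^ 2) ^ 3) * τ ^ 3 := by
        rw [ENNReal.ofReal_mul (by positivity), ENNReal.ofReal_pow (by positivity),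
          ENNReal.ofReal_pow (by positivity), ENNReal.ofReal_coe_nnreal]
        ring
    _ ≤ _ := by
        gcongr
        linarith

section PeriodicCutoff

lemma exists_abs_deriv_smoothTransition_le :
    ∃ C : ℝ, 0 < C ∧ ∀ u, |deriv Real.smoothTransition u| ≤ C := by
  have hs : ContDiff ℝ 1 Real.smoothTransition := Real.smoothTransition.contDiff
  have hc : HasCompactSupport (deriv Real.smoothTransition) := by
    refine HasCompactSupport.intro (isCompact_Icc (a := (0 : ℝ)) (b := 1)) fun u hu => ?_
    rw [Set.mem_Icc, not_and_or, not_le, not_le] at hu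
    rcases hu with hu | hu
    · have : Real.smoothTransition =ᶠ[nhds u] fun _ => 0 := by
        filter_upwards [gt_mem_nhds hu] with v hv
        exact Real.smoothTransition.zero_of_nonpos hv.le
      rw [this.deriv_eq, deriv_const]
    · have : Real.smoothTransition =ᶠ[nhds u] fun _ => 1 := by
        filter_upwards [lt_mem_nhds hu] with v hv
        exact Real.smoothTransition.one_of_one_le hv.le
      rw [this.deriv_eq, deriv_const]
  obtain ⟨C, hC⟩ := hc.exists_bound_of_continuous (hs.continuous_deriv le_rfl)
  exact ⟨C + 1, by linarith [(norm_nonneg _).trans (hC 0)], fun u => by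
    linarith [hC u, Real.norm_eq_abs (deriv Real.smoothTransition u)]⟩

/-- A smooth periodic cutoff vanishing near the integers and equal to one at distance `1 / (2n)`
from them. -/
def perCut (n : ℝ) (t : ℝ) : ℝ := Real.smoothTransition (2 * n ^ 2 * Real.sin (Real.pi * t) ^ 2 - 1)

lemma contDiff_perCut (n : ℝ) : ContDiff ℝ (⊤ : ℕ∞) (perCut n) := by
  refine Real.smoothTransition.contDiff.comp ?_
  have : ContDiff ℝ (⊤ : ℕ∞) fun t => Real.sin (Real.pi * t) :=
    Real.contDiff_sin.comp (contDiff_const.mul contDiff_id)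
  exact (contDiff_const.mul (this.pow 2)).sub contDiff_const

lemma perCut_nonneg (n t : ℝ) : 0 ≤ perCut n t := Real.smoothTransition.nonneg _

lemma perCut_le_one (n t : ℝ) : perCut n t ≤ 1 := Real.smoothTransition.le_one _

lemma perCut_eventually_zero (n : ℝ) (m : ℤ) : ∀ᶠ t in nhds (m : ℝ), perCut n t = 0 := by
  have hc : Continuous fun t : ℝ => 2 * n ^ 2 * Real.sin (Real.pi * t) ^ 2 - 1 := by fun_prop
  have h0 : 2 * n ^ 2 * Real.sin (Real.pi * m) ^ 2 - 1 < 0 := by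
    rw [mul_comm Real.pi, Real.sin_int_mul_pi]
    norm_num
  filter_upwards [hc.continuousAt.eventually (gt_mem_nhds h0)] with t ht
  exact Real.smoothTransition.zero_of_nonpos ht.le

lemma perCut_eq_one {n : ℝ} (hn : 0 < n) {t : ℝ} (ht : ∀ m : ℤ, 1 / (2 * n) ≤ |t - m|) :
    perCut n t = 1 := by
  refine Real.smoothTransition.one_of_one_le ?_
  set δ := t - round t with hδ
  have h1 : Real.sin (Real.pi * t) ^ 2 = Real.sin (Real.pi * |δ|) ^ 2 := by
    have e : Real.pi * t = Real.pi * δ + round t * Real.pi := by rw [hδ]; ring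
    rw [e, Real.sin_add_int_mul_pi, mul_pow, ← zpow_natCast, ← zpow_mul, mul_comm (round t),
      zpow_mul]
    norm_num
    rcases abs_cases δ with h | h
    · rw [h.1]
    · rw [h.1, mul_neg, Real.sin_neg, neg_sq]
  have h2 : |δ| ≤ 1 / 2 := abs_sub_round t
  have h3 : 1 / (2 * n) ≤ |δ| := ht (round t)
  have h4 : 2 * |δ| ≤ Real.sin (Real.pi * |δ|) := by
    have := Real.mul_le_sin (x := Real.pi * |δ|) (by positivity)
      (by nlinarith [Real.pi_pos])
    calc 2 * |δ| = 2 / Real.pi * (Real.pi * |δ|) := by field_simp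
      _ ≤ _ := this
  have h5 : 1 / n ≤ Real.sin (Real.pi * |δ|) := by
    refine le_trans ?_ h4
    calc 1 / n = 2 * (1 / (2 * n)) := by field_simp
      _ ≤ _ := by linarith
  have h6 : (1 / n) ^ 2 ≤ Real.sin (Real.pi * |δ|) ^ 2 := by gcongr
  rw [h1]
  have h7 : 2 * n ^ 2 * (1 / n) ^ 2 = 2 := by field_simp
  nlinarith [sq_nonneg n]

lemma exists_abs_deriv_perCut_le :
    ∃ C : ℝ, 0 < C ∧ ∀ n : ℝ, 0 < n → ∀ t, |deriv (perCut n) t| ≤ C * n := by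
  obtain ⟨C, hC, hb⟩ := exists_abs_deriv_smoothTransition_le
  refine ⟨C * (4 * Real.pi), by positivity, fun n hn t => ?_⟩
  set u := 2 * n ^ 2 * Real.sin (Real.pi * t) ^ 2 - 1 with hu
  have hd : HasDerivAt (fun t => 2 * n ^ 2 * Real.sin (Real.pi * t) ^ 2 - 1)
      (2 * n ^ 2 * (2 * Real.sin (Real.pi * t) * (Real.cos (Real.pi * t) * Real.pi))) t := by
    have h1 : HasDerivAt (fun t : ℝ => Real.pi * t) Real.pi t := by
      simpa using (hasDerivAt_id t).const_mul Real.pi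
    simpa using ((h1.sin.pow 2).const_mul (2 * n ^ 2)).sub_const 1
  have hs : DifferentiableAt ℝ Real.smoothTransition u :=
    (Real.smoothTransition.contDiff (n := 1)).differentiable (by simp) u
  have h := (hs.hasDerivAt.comp t hd).deriv
  change deriv (perCut n) t = _ at h
  rw [h, abs_mul]
  by_cases hu1 : 1 < u
  · have : Real.smoothTransition =ᶠ[nhds u] fun _ => 1 := by
      filter_upwards [lt_mem_nhds hu1] with v hv
      exact Real.smoothTransition.one_of_one_le hv.le
    rw [this.deriv_eq, deriv_const, abs_zero, zero_mul]
    positivity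
  · have h1 : (n * |Real.sin (Real.pi * t)|) ^ 2 ≤ 1 ^ 2 := by
      rw [mul_pow, sq_abs]
      rw [not_lt, hu] at hu1
      linarith
    have h2 : n * |Real.sin (Real.pi * t)| ≤ 1 := le_of_sq_le_sq h1 zero_le_one
    have h3 : |2 * n ^ 2 * (2 * Real.sin (Real.pi * t) * (Real.cos (Real.pi * t) * Real.pi))| ≤
        4 * Real.pi * n := by
      rw [show 2 * n ^ 2 * (2 * Real.sin (Real.pi * t) * (Real.cos (Real.pi * t) * Real.pi)) =
        4 * Real.pi * n * (n * Real.sin (Real.pi * t)) * Real.cos (Real.pi * t) by ring]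
      rw [abs_mul, abs_mul, abs_mul n, abs_of_pos hn, abs_of_pos (by positivity : 0 < 4 * Real.pi * n)]
      calc _ ≤ 4 * Real.pi * n * 1 * 1 := by
            gcongr
            exact Real.abs_cos_le_one _
        _ = _ := by ring
    calc _ ≤ C * (4 * Real.pi * n) := by
          gcongr
          exact hb _
      _ = _ := by ring

end PeriodicCutoff

section CellCutoff

/-- The index of the cube of side `ℓ` containing `x`, in the grid shifted by `s`. -/
def cellIdx (ℓ s : ℝ) (x : E3) : Fin 3 → ℤ := fun c => ⌊(x c - s) / ℓ⌋

/-- The cutoff vanishing near the walls of the grid. -/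
def cellCut (n ℓ s : ℝ) (x : E3) : ℝ := ∏ c, perCut n ((x c - s) / ℓ)

open Classical in
/-- The gauge-transformed localization to the cubes with index in `K`. -/
def cellLoc (n ℓ s : ℝ) (K : Set (Fin 3 → ℤ)) (a : (Fin 3 → ℤ) → E3) (x : E3) : ℂ :=
  if cellIdx ℓ s x ∈ K then
    (cellCut n ℓ s x : ℂ) * Complex.exp (Complex.I * (∑ k, a (cellIdx ℓ s x) k * x k : ℝ))
  else 0

variable {n ℓ s : ℝ} {K : Set (Fin 3 → ℤ)} {a : (Fin 3 → ℤ) → E3}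

lemma contDiff_cellCut : ContDiff ℝ (⊤ : ℕ∞) (cellCut n ℓ s) := by
  unfold cellCut
  exact contDiff_prod fun c _ => (contDiff_perCut n).comp
    (((contDiff_apply ℝ ℝ c).sub contDiff_const).div_const ℓ)

lemma cellCut_nonneg (x : E3) : 0 ≤ cellCut n ℓ s x :=
  Finset.prod_nonneg fun _ _ => perCut_nonneg _ _

lemma cellCut_le_one (x : E3) : cellCut n ℓ s x ≤ 1 :=
  Finset.prod_le_one (fun _ _ => perCut_nonneg _ _) fun _ _ => perCut_le_one _ _

lemma cellCut_eq_one (hn : 0 < n) {x : E3}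
    (hx : ∀ c, ∀ m : ℤ, 1 / (2 * n) ≤ |(x c - s) / ℓ - m|) : cellCut n ℓ s x = 1 :=
  Finset.prod_eq_one fun c _ => perCut_eq_one hn (hx c)

lemma cellCut_dichotomy (x : E3) : (∀ᶠ y in nhds x, cellCut n ℓ s y = 0) ∨
    ∀ᶠ y in nhds x, cellIdx ℓ s y = cellIdx ℓ s x := by
  have hc : ∀ c, Continuous fun y : E3 => (y c - s) / ℓ := fun c => by fun_prop
  by_cases h : ∃ c, ∃ m : ℤ, (x c - s) / ℓ = m
  · obtain ⟨c, m, hm⟩ := h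
    left
    have h1 := perCut_eventually_zero n m
    rw [← hm] at h1
    filter_upwards [(hc c).continuousAt.eventually h1] with y hy
    exact Finset.prod_eq_zero (Finset.mem_univ c) hy
  · right
    push Not at h
    have h1 : ∀ c, ∀ᶠ y in nhds x, ⌊(y c - s) / ℓ⌋ = ⌊(x c - s) / ℓ⌋ := by
      intro c
      have h2 : (⌊(x c - s) / ℓ⌋ : ℝ) < (x c - s) / ℓ :=
        lt_of_le_of_ne (Int.floor_le _) (h c _).symm
      filter_upwards [(hc c).continuousAt.eventually (lt_mem_nhds h2),
        (hc c).continuousAt.eventually (gt_mem_nhds (Int.lt_floor_add_one _))] with y hy hy'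
      exact Int.floor_eq_iff.2 ⟨hy.le, hy'⟩
    filter_upwards [Filter.eventually_all.2 h1] with y hy
    exact funext hy

lemma norm_cellLoc (x : E3) :
    ‖cellLoc n ℓ s K a x‖ = {x | cellIdx ℓ s x ∈ K}.indicator (cellCut n ℓ s) x := by
  unfold cellLoc
  by_cases h : cellIdx ℓ s x ∈ K
  · rw [if_pos h, Set.indicator_of_mem (show x ∈ {x | cellIdx ℓ s x ∈ K} from h), norm_mul,
      mul_comm Complex.I, Complex.norm_exp_ofReal_mul_I, mul_one, Complex.norm_real,
      Real.norm_of_nonneg (cellCut_nonneg x)]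
  · rw [if_neg h, Set.indicator_of_notMem (show x ∉ {x | cellIdx ℓ s x ∈ K} from h), norm_zero]

/-- The gauge-transformed cutoff of a single cube. -/
def gaugeCut (n ℓ s : ℝ) (b : E3) (x : E3) : ℂ :=
  (cellCut n ℓ s x : ℂ) * Complex.exp (Complex.I * (∑ k, b k * x k : ℝ))

lemma contDiff_gaugeCut (b : E3) : ContDiff ℝ (⊤ : ℕ∞) (gaugeCut n ℓ s b) := by
  unfold gaugeCut
  have h1 : ContDiff ℝ (⊤ : ℕ∞) fun x : E3 => ∑ k, b k * x k :=
    ContDiff.sum fun k _ => contDiff_const.mul (contDiff_apply ℝ ℝ k)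
  exact (Complex.ofRealCLM.contDiff.comp contDiff_cellCut).mul
    (contDiff_const.mul (Complex.ofRealCLM.contDiff.comp h1)).cexp

lemma cellLoc_dichotomy (x : E3) : cellLoc n ℓ s K a =ᶠ[nhds x] (fun _ => 0) ∨
    cellIdx ℓ s x ∈ K ∧
      cellLoc n ℓ s K a =ᶠ[nhds x] gaugeCut n ℓ s (a (cellIdx ℓ s x)) := by
  rcases cellCut_dichotomy (n := n) (ℓ := ℓ) (s := s) x with h | h
  · left
    filter_upwards [h] with y hy
    simp [cellLoc, hy]
  · by_cases hK : cellIdx ℓ s x ∈ K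
    · right
      refine ⟨hK, ?_⟩
      filter_upwards [h] with y hy
      rw [cellLoc, if_pos (by rw [hy]; exact hK), hy, gaugeCut]
    · left
      filter_upwards [h] with y hy
      rw [cellLoc, if_neg (by rw [hy]; exact hK)]

lemma contDiff_cellLoc : ContDiff ℝ (⊤ : ℕ∞) (cellLoc n ℓ s K a) := by
  rw [contDiff_iff_contDiffAt]
  intro x
  rcases cellLoc_dichotomy (n := n) (ℓ := ℓ) (s := s) (K := K) (a := a) x with h | ⟨-, h⟩
  · exact contDiffAt_const.congr_of_eventuallyEq h
  · exact (contDiff_gaugeCut _).contDiffAt.congr_of_eventuallyEq h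

lemma abs_fderiv_cellCut_le {D : ℝ} (hD : ∀ t, |deriv (perCut n) t| ≤ D) (hℓ : 0 < ℓ) (x : E3)
    (k : Fin 3) : |fderiv ℝ (cellCut n ℓ s) x (Pi.single k 1)| ≤ D / ℓ := by
  have hd : DifferentiableAt ℝ (cellCut n ℓ s) x := contDiff_cellCut.differentiable (by simp) x
  rw [← hd.lineDeriv_eq_fderiv, lineDeriv]
  have h1 : (fun t : ℝ => cellCut n ℓ s (x + t • Pi.single k 1)) = fun t =>
      perCut n ((x k + t - s) / ℓ) * ∏ c ∈ Finset.univ.erase k, perCut n ((x c - s) / ℓ) := by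
    ext t
    rw [cellCut, ← Finset.mul_prod_erase _ _ (Finset.mem_univ k)]
    congr 1
    · simp
    · refine Finset.prod_congr rfl fun c hc => ?_
      simp [(Finset.mem_erase.1 hc).1]
  have h2 : HasDerivAt (fun t : ℝ => (x k + t - s) / ℓ) (1 / ℓ) 0 :=
    (((hasDerivAt_id (0 : ℝ)).const_add (x k)).sub_const s).div_const ℓ
  have h3 := (((contDiff_perCut n).differentiable (by simp) _).hasDerivAt.comp 0 h2).mul_const
    (∏ c ∈ Finset.univ.erase k, perCut n ((x c - s) / ℓ))
  have h4 := h3.deriv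
  change deriv (fun t => perCut n ((x k + t - s) / ℓ) * _) 0 = _ at h4
  rw [h1, h4, abs_mul, abs_mul, abs_of_pos (by positivity : 0 < 1 / ℓ)]
  have h5 : |∏ c ∈ Finset.univ.erase k, perCut n ((x c - s) / ℓ)| ≤ 1 := by
    rw [abs_of_nonneg (Finset.prod_nonneg fun _ _ => perCut_nonneg _ _)]
    exact Finset.prod_le_one (fun _ _ => perCut_nonneg _ _) fun _ _ => perCut_le_one _ _
  have hD0 : 0 ≤ D := (abs_nonneg _).trans (hD 0)
  calc _ ≤ D * (1 / ℓ) * 1 := by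
        gcongr
        exact hD _
    _ = D / ℓ := by ring

lemma magGradSq_gaugeCut_le {D : ℝ} (hD : ∀ t, |deriv (perCut n) t| ≤ D) (hℓ : 0 < ℓ)
    (A : E3 → E3) (b x : E3) :
    magGradSq A (gaugeCut n ℓ s b) x ≤ 3 * (D / ℓ) ^ 2 + 3 * ‖A x - b‖ ^ 2 := by
  have hterm : ∀ k, ‖fderiv ℝ (gaugeCut n ℓ s b) x (Pi.single k 1) -
      Complex.I * (A x k : ℂ) * gaugeCut n ℓ s b x‖ ^ 2 ≤ (D / ℓ) ^ 2 + ‖A x - b‖ ^ 2 := by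
    intro k
    set p := fderiv ℝ (cellCut n ℓ s) x (Pi.single k 1) with hp
    set φ := cellCut n ℓ s x with hφ
    set e := Complex.exp (Complex.I * (∑ k, b k * x k : ℝ)) with he
    have hd : DifferentiableAt ℝ (cellCut n ℓ s) x := contDiff_cellCut.differentiable (by simp) x
    have hg : DifferentiableAt ℝ (gaugeCut n ℓ s b) x :=
      (contDiff_gaugeCut b).differentiable (by simp) x
    have hline : HasDerivAt (fun t : ℝ => cellCut n ℓ s (x + t • Pi.single k 1)) p 0 := by
      have := hd.hasFDerivAt.hasLineDerivAt (Pi.single k 1)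
      exact this
    have hsum : ∀ t : ℝ, ∑ c, b c * (x + t • (Pi.single k 1 : E3)) c = ∑ c, b c * x c + t * b k := by
      intro t
      simp only [Pi.add_apply, Pi.smul_apply, smul_eq_mul, mul_add, Finset.sum_add_distrib]
      congr 1
      simp [Pi.single_apply, mul_comm]
    have hexp : HasDerivAt (fun t : ℝ => Complex.exp (Complex.I *
        ((∑ c, b c * (x + t • (Pi.single k 1 : E3)) c : ℝ) : ℂ))) (e * (Complex.I * b k)) 0 := by
      simp only [hsum]
      have h1 : HasDerivAt (fun t : ℝ => ∑ c, b c * x c + t * b k) (b k) 0 := by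
        simpa using ((hasDerivAt_id (0 : ℝ)).mul_const (b k)).const_add (∑ c, b c * x c)
      have h2 := (h1.ofReal_comp.const_mul Complex.I).cexp
      simpa [he] using h2
    have h3 : fderiv ℝ (gaugeCut n ℓ s b) x (Pi.single k 1) =
        p * e + φ * (e * (Complex.I * b k)) := by
      rw [← hg.lineDeriv_eq_fderiv, lineDeriv]
      have h4 := (hline.ofReal_comp.mul hexp).deriv
      simp only [zero_smul, add_zero] at h4
      exact h4
    rw [h3, gaugeCut]
    have h5 : (p : ℂ) * e + φ * (e * (Complex.I * b k)) - Complex.I * (A x k : ℂ) * (φ * e) =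
        ((p : ℂ) + (φ * (b k - A x k) : ℝ) * Complex.I) * e := by
      push_cast
      ring
    have h6 : ‖e‖ = 1 := by rw [he, mul_comm, Complex.norm_exp_ofReal_mul_I]
    rw [h5, norm_mul, h6, mul_one, Complex.sq_norm, Complex.normSq_add_mul_I, mul_pow]
    have hp2 : p ^ 2 ≤ (D / ℓ) ^ 2 := sq_le_sq' (by
      linarith [neg_abs_le p, abs_fderiv_cellCut_le (s := s) hD hℓ x k])
      ((le_abs_self p).trans (abs_fderiv_cellCut_le hD hℓ x k))
    have hφ2 : φ ^ 2 ≤ 1 := pow_le_one₀ (cellCut_nonneg x) (cellCut_le_one x)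
    have hb : (b k - A x k) ^ 2 ≤ ‖A x - b‖ ^ 2 := by
      rw [← sq_abs, abs_sub_comm]
      gcongr
      exact norm_le_pi_norm (A x - b) k
    nlinarith [sq_nonneg (b k - A x k)]
  calc magGradSq A (gaugeCut n ℓ s b) x
      ≤ ∑ _k : Fin 3, ((D / ℓ) ^ 2 + ‖A x - b‖ ^ 2) := Finset.sum_le_sum fun k _ => hterm k
    _ = _ := by simp

lemma magGradSq_cellLoc_le {D : ℝ} (hD : ∀ t, |deriv (perCut n) t| ≤ D) (hℓ : 0 < ℓ)
    (A : E3 → E3) (x : E3) :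
    magGradSq A (cellLoc n ℓ s K a) x ≤ {x | cellIdx ℓ s x ∈ K}.indicator
      (fun x => 3 * (D / ℓ) ^ 2 + 3 * ‖A x - a (cellIdx ℓ s x)‖ ^ 2) x := by
  have hcongr : ∀ f : E3 → ℂ, cellLoc n ℓ s K a =ᶠ[nhds x] f →
      magGradSq A (cellLoc n ℓ s K a) x = magGradSq A f x := by
    intro f h
    simp only [magGradSq, h.fderiv_eq, h.eq_of_nhds]
  rcases cellLoc_dichotomy (n := n) (ℓ := ℓ) (s := s) (K := K) (a := a) x with h | ⟨hK, h⟩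
  · rw [hcongr _ h]
    simp only [magGradSq, fderiv_fun_const, Pi.zero_apply, zero_apply, mul_zero, sub_zero,
      norm_zero]
    refine le_trans (by simp) (Set.indicator_nonneg (fun y _ => by positivity) x)
  · rw [hcongr _ h, Set.indicator_of_mem (show x ∈ {x | cellIdx ℓ s x ∈ K} from hK)]
    exact magGradSq_gaugeCut_le hD hℓ A _ x

end CellCutoff

section CellMeasure

/-- The center of a cube of the grid. -/
def cellCtr (ℓ s : ℝ) (m : Fin 3 → ℤ) : E3 := fun c => s + ℓ * (m c + 1 / 2)

/-- The mean of a field over the threefold dilate of a cube. -/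
def cellMean (A : E3 → E3) (ℓ s : ℝ) (m : Fin 3 → ℤ) : E3 :=
  ⨍ y in Metric.closedBall (cellCtr ℓ s m) (3 * (ℓ / 2)), A y

/-- The Dirichlet energy of a field over the threefold dilate of a cube. -/
def cellEnergy (A : E3 → E3) (ℓ s : ℝ) (m : Fin 3 → ℤ) : ENNReal :=
  ∫⁻ x in Metric.closedBall (cellCtr ℓ s m) (3 * (ℓ / 2)), ‖fderiv ℝ A x‖ₑ ^ 2

variable {ℓ s : ℝ}

lemma mem_closedBall_cellCtr (hℓ : 0 < ℓ) (x : E3) :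
    x ∈ Metric.closedBall (cellCtr ℓ s (cellIdx ℓ s x)) (ℓ / 2) := by
  rw [Metric.mem_closedBall, dist_pi_le_iff (by positivity)]
  intro c
  have h1 := Int.floor_le ((x c - s) / ℓ)
  have h2 := (Int.lt_floor_add_one ((x c - s) / ℓ)).le
  rw [le_div_iff₀ hℓ] at h1
  rw [div_le_iff₀ hℓ] at h2
  rw [Real.dist_eq, abs_le]
  simp only [cellCtr, cellIdx]
  constructor <;> linarith

lemma ball_subset_cell (hℓ : 0 < ℓ) (m : Fin 3 → ℤ) :
    Metric.ball (cellCtr ℓ s m) (ℓ / 2) ⊆ {x | cellIdx ℓ s x = m} := by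
  intro x hx
  rw [Metric.mem_ball, dist_pi_lt_iff (by positivity)] at hx
  refine funext fun c => ?_
  have h := hx c
  rw [Real.dist_eq, abs_lt] at h
  simp only [cellCtr] at h
  rw [cellIdx, Int.floor_eq_iff, le_div_iff₀ hℓ, div_lt_iff₀ hℓ]
  constructor <;> linarith

lemma measurable_cellIdx : Measurable (cellIdx ℓ s) := by
  refine measurable_pi_lambda _ fun c => Int.measurable_floor.comp ?_
  have h : Continuous fun x : E3 => (x c - s) / ℓ := by fun_prop
  exact h.measurable

lemma measurableSet_cells (K : Set (Fin 3 → ℤ)) : MeasurableSet {x | cellIdx ℓ s x ∈ K} :=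
  measurable_cellIdx (Set.to_countable K).measurableSet

lemma le_volume_cell (hℓ : 0 < ℓ) (m : Fin 3 → ℤ) :
    ENNReal.ofReal (ℓ ^ 3) ≤ volume {x | cellIdx ℓ s x = m} := by
  refine le_trans ?_ (measure_mono (ball_subset_cell hℓ m))
  rw [Real.volume_pi_ball _ (by positivity)]
  refine ENNReal.ofReal_le_ofReal (le_of_eq ?_)
  rw [Fintype.card_fin]
  ring

lemma lintegral_cells_mono {K : Set (Fin 3 → ℤ)} {F G : E3 → ENNReal}
    (h : ∀ m ∈ K, ∫⁻ x in {x | cellIdx ℓ s x = m}, F x ≤ ∫⁻ x in {x | cellIdx ℓ s x = m}, G x) :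
    ∫⁻ x in {x | cellIdx ℓ s x ∈ K}, F x ≤ ∫⁻ x in {x | cellIdx ℓ s x ∈ K}, G x := by
  have hU : {x | cellIdx ℓ s x ∈ K} = ⋃ m : K, {x | cellIdx ℓ s x = m} := by
    ext x
    simp
  have hm : ∀ m : K, MeasurableSet {x | cellIdx ℓ s x = m} := fun m =>
    measurableSet_cells {(m : Fin 3 → ℤ)}
  have hd : Pairwise fun m m' : K =>
      Disjoint {x | cellIdx ℓ s x = m} {x | cellIdx ℓ s x = m'} := by
    intro m m' hne
    refine Set.disjoint_left.2 fun x hx hx' => hne (Subtype.ext ?_)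
    exact (show cellIdx ℓ s x = m from hx).symm.trans hx'
  rw [hU, lintegral_iUnion hm hd, lintegral_iUnion hm hd]
  exact ENNReal.tsum_le_tsum fun m => h m m.2

lemma lintegral_closedBall_swap {G : E3 → ENNReal} (hG : Measurable G) {r : ℝ} (hr : 0 ≤ r) :
    ∫⁻ x, ∫⁻ z in Metric.closedBall x r, G z = ENNReal.ofReal ((2 * r) ^ 3) * ∫⁻ z, G z := by
  have h1 : ∀ x : E3, ∫⁻ z in Metric.closedBall x r, G z =
      ∫⁻ u in Metric.closedBall (0 : E3) r, G (u + x) := by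
    intro x
    rw [← lintegral_indicator Metric.isClosed_closedBall.measurableSet,
      ← lintegral_indicator Metric.isClosed_closedBall.measurableSet,
      ← lintegral_add_right_eq_self _ x]
    refine lintegral_congr fun u => ?_
    by_cases hu : u ∈ Metric.closedBall (0 : E3) r
    · rw [Set.indicator_of_mem hu, Set.indicator_of_mem]
      simpa [dist_eq_norm] using hu
    · rw [Set.indicator_of_notMem hu, Set.indicator_of_notMem]
      simpa [dist_eq_norm] using hu
  simp only [h1]
  rw [lintegral_lintegral_swap]
  · simp only [lintegral_add_left_eq_self (μ := (volume : Measure E3)) G, lintegral_const,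
      Measure.restrict_apply_univ, Real.volume_pi_closedBall _ hr, Fintype.card_fin]
    rw [mul_comm]
  · exact (hG.comp (measurable_snd.add measurable_fst)).aemeasurable

lemma cellEnergy_cellIdx_le (hℓ : 0 < ℓ) (A : E3 → E3) (x : E3) :
    cellEnergy A ℓ s (cellIdx ℓ s x) ≤ ∫⁻ z in Metric.closedBall x (2 * ℓ), ‖fderiv ℝ A z‖ₑ ^ 2 := by
  refine lintegral_mono_set (Metric.closedBall_subset_closedBall' ?_)
  have := Metric.mem_closedBall'.1 (mem_closedBall_cellCtr (s := s) hℓ x)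
  linarith

lemma lintegral_cellEnergy_le (hℓ : 0 < ℓ) {A : E3 → E3} (hA : ContDiff ℝ 1 A) :
    ∫⁻ x, cellEnergy A ℓ s (cellIdx ℓ s x) ≤
      ENNReal.ofReal (64 * ℓ ^ 3) * ∫⁻ z, ‖fderiv ℝ A z‖ₑ ^ 2 := by
  refine (lintegral_mono fun x => cellEnergy_cellIdx_le hℓ A x).trans (le_of_eq ?_)
  rw [lintegral_closedBall_swap ((hA.continuous_fderiv (by simp)).enorm.measurable.pow_const 2)
    (by positivity)]
  ring_nf

/-- The cubes with large field energy have small total volume. -/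
lemma volume_lt_cellEnergy_le (hℓ : 0 < ℓ) {A : E3 → E3} (hA : ContDiff ℝ 1 A) {τ β : ℝ}
    (hτ : 0 < τ) (hβ : ∫⁻ z, ‖fderiv ℝ A z‖ₑ ^ 2 ≤ ENNReal.ofReal β) :
    volume {x | ENNReal.ofReal τ < cellEnergy A ℓ s (cellIdx ℓ s x)} ≤
      ENNReal.ofReal (64 * ℓ ^ 3 * β / τ) := by
  have h1 : ENNReal.ofReal τ * volume {x | ENNReal.ofReal τ < cellEnergy A ℓ s (cellIdx ℓ s x)} ≤
      ENNReal.ofReal (64 * ℓ ^ 3 * β) := by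
    rw [ENNReal.ofReal_mul (by positivity : (0 : ℝ) ≤ 64 * ℓ ^ 3)]
    refine le_trans ?_ ((lintegral_cellEnergy_le hℓ hA (s := s)).trans (mul_le_mul' le_rfl hβ))
    refine le_trans (mul_le_mul' le_rfl (measure_mono fun x hx => ?_))
      (mul_meas_ge_le_lintegral₀ ?_ (ENNReal.ofReal τ))
    · exact le_of_lt (show ENNReal.ofReal τ < cellEnergy A ℓ s (cellIdx ℓ s x) from hx)
    · have : Measurable (cellEnergy A ℓ s) := measurable_of_countable _
      exact (this.comp measurable_cellIdx).aemeasurable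
  rw [ENNReal.ofReal_div_of_pos hτ, ENNReal.le_div_iff_mul_le (Or.inl (by simpa using hτ))
    (Or.inl ENNReal.ofReal_ne_top), mul_comm]
  exact h1

/-- The sixth moment of the oscillation of the field over the cubes with small field energy. -/
lemma exists_lintegral_osc_le : ∃ C : ℝ, 0 < C ∧ ∀ A : E3 → E3, ContDiff ℝ 1 A →
    HasCompactSupport A → ∀ (ℓ s τ β : ℝ) (K : Set (Fin 3 → ℤ)), 0 < ℓ → 0 < τ →
      (∀ m ∈ K, cellEnergy A ℓ s m ≤ ENNReal.ofReal τ) →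
      ∫⁻ z, ‖fderiv ℝ A z‖ₑ ^ 2 ≤ ENNReal.ofReal β →
      ∫⁻ x in {x | cellIdx ℓ s x ∈ K}, ‖A x - cellMean A ℓ s (cellIdx ℓ s x)‖ₑ ^ 6 ≤
        ENNReal.ofReal (C * τ ^ 2 * β) := by
  obtain ⟨C, hC, hS⟩ := exists_sobolev_cube
  refine ⟨64 * C, by positivity, fun A hA hAc ℓ s τ β K hℓ hτ hK hβ => ?_⟩
  set c : ENNReal := ENNReal.ofReal (C * τ ^ 2 / ℓ ^ 3) with hc
  have hcell : ∀ m ∈ K,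
      ∫⁻ x in {x | cellIdx ℓ s x = m}, ‖A x - cellMean A ℓ s (cellIdx ℓ s x)‖ₑ ^ 6 ≤
      ∫⁻ x in {x | cellIdx ℓ s x = m}, c * cellEnergy A ℓ s (cellIdx ℓ s x) := by
    intro m hm
    have hms : MeasurableSet {x | cellIdx ℓ s x = m} := measurableSet_cells {m}
    calc ∫⁻ x in {x | cellIdx ℓ s x = m}, ‖A x - cellMean A ℓ s (cellIdx ℓ s x)‖ₑ ^ 6
        = ∫⁻ x in {x | cellIdx ℓ s x = m}, ‖A x - cellMean A ℓ s m‖ₑ ^ 6 :=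
          setLIntegral_congr_fun hms fun x hx => by
            rw [show cellIdx ℓ s x = m from hx]
      _ ≤ ∫⁻ x in Metric.closedBall (cellCtr ℓ s m) (ℓ / 2), ‖A x - cellMean A ℓ s m‖ₑ ^ 6 := by
          refine lintegral_mono_set fun x hx => ?_
          have := mem_closedBall_cellCtr (s := s) hℓ x
          rwa [show cellIdx ℓ s x = m from hx] at this
      _ ≤ ENNReal.ofReal C * cellEnergy A ℓ s m ^ 3 := hS A hA hAc _ _ (by positivity)
      _ ≤ ENNReal.ofReal C * (ENNReal.ofReal τ ^ 2 * cellEnergy A ℓ s m) := by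
          refine mul_le_mul' le_rfl ?_
          rw [pow_succ]
          exact mul_le_mul' (pow_le_pow_left' (hK m hm) 2) le_rfl
      _ = c * cellEnergy A ℓ s m * ENNReal.ofReal (ℓ ^ 3) := by
          have : ENNReal.ofReal C * ENNReal.ofReal τ ^ 2 = c * ENNReal.ofReal (ℓ ^ 3) := by
            rw [hc, ← ENNReal.ofReal_pow hτ.le, ← ENNReal.ofReal_mul hC.le,
              ← ENNReal.ofReal_mul (by positivity), div_mul_cancel₀ _ (by positivity)]
          rw [← mul_assoc, this]
          ring
      _ ≤ c * cellEnergy A ℓ s m * volume {x | cellIdx ℓ s x = m} :=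
          mul_le_mul' le_rfl (le_volume_cell hℓ m)
      _ = ∫⁻ x in {x | cellIdx ℓ s x = m}, c * cellEnergy A ℓ s m := by
          rw [setLIntegral_const]
      _ = _ := setLIntegral_congr_fun hms fun x hx => by
          rw [show cellIdx ℓ s x = m from hx]
  refine (lintegral_cells_mono hcell).trans ((setLIntegral_le_lintegral _ _).trans ?_)
  rw [lintegral_const_mul' _ _ ENNReal.ofReal_ne_top]
  refine (mul_le_mul' le_rfl ((lintegral_cellEnergy_le hℓ hA).trans
    (mul_le_mul' le_rfl hβ))).trans (le_of_eq ?_)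
  rw [← ENNReal.ofReal_mul (by positivity), ← ENNReal.ofReal_mul (by positivity)]
  congr 1
  field_simp

end CellMeasure

section CellSelection

/-- The neighborhood of the walls of the grid where the cutoff is not equal to one. -/
def wallSet (n ℓ s : ℝ) : Set E3 := {x | ∃ c, ∃ m : ℤ, |(x c - s) / ℓ - m| < 1 / (2 * n)}

lemma measurableSet_wallSet_coord (n ℓ s : ℝ) (c : Fin 3) :
    MeasurableSet {x : E3 | ∃ m : ℤ, |(x c - s) / ℓ - m| < 1 / (2 * n)} := by
  simp only [Set.ofPred_exists]
  refine MeasurableSet.iUnion fun m => ?_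
  have h : Continuous fun x : E3 => |(x c - s) / ℓ - m| := by fun_prop
  exact (isOpen_lt h continuous_const).measurableSet

lemma wallSet_eq_iUnion (n ℓ s : ℝ) :
    wallSet n ℓ s = ⋃ c, {x : E3 | ∃ m : ℤ, |(x c - s) / ℓ - m| < 1 / (2 * n)} := by
  ext x
  simp [wallSet]

lemma measurableSet_wallSet (n ℓ s : ℝ) : MeasurableSet (wallSet n ℓ s) := by
  rw [wallSet_eq_iUnion]
  exact MeasurableSet.iUnion fun c => measurableSet_wallSet_coord n ℓ s c

lemma disjoint_wall_coord {n : ℕ} (hn : 0 < n) {ℓ : ℝ} (hℓ : 0 < ℓ) (c : Fin 3) {k k' : ℕ}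
    (hk : k < n) (hk' : k' < n) (hne : k ≠ k') :
    Disjoint {x : E3 | ∃ m : ℤ, |(x c - k / n * ℓ) / ℓ - m| < 1 / (2 * n)}
      {x : E3 | ∃ m : ℤ, |(x c - k' / n * ℓ) / ℓ - m| < 1 / (2 * n)} := by
  refine Set.disjoint_left.2 fun x ⟨m, hm⟩ ⟨m', hm'⟩ => hne ?_
  have hn0 : (0 : ℝ) < n := by exact_mod_cast hn
  have h1 : |((k' - k + n * (m' - m) : ℤ) : ℝ)| < 1 := by
    have h2 : ((k' - k + n * (m' - m) : ℤ) : ℝ) =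
        n * (((x c - k / n * ℓ) / ℓ - m) - ((x c - k' / n * ℓ) / ℓ - m')) := by
      push_cast
      field_simp
      ring
    rw [h2, abs_mul, abs_of_pos hn0]
    have h3 := (abs_sub ((x c - k / n * ℓ) / ℓ - m) ((x c - k' / n * ℓ) / ℓ - m')).trans_lt
      (add_lt_add hm hm')
    calc _ < (n : ℝ) * (1 / (2 * n) + 1 / (2 * n)) := by gcongr
      _ = 1 := by field_simp; norm_num
  have h4 : (k' - k + n * (m' - m) : ℤ) = 0 := by
    rw [← Int.abs_lt_one_iff]
    exact_mod_cast h1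
  have h5 : (n : ℤ) ∣ k - k' := ⟨m' - m, by linarith⟩
  have h6 := Int.eq_zero_of_abs_lt_dvd h5 (by rw [abs_lt]; omega)
  omega

/-- Some shift of the grid carries little mass near its walls. -/
lemma exists_lintegral_wallSet_le (ν : Measure E3) (f : E3 → ENNReal) {n : ℕ} (hn : 0 < n)
    {ℓ : ℝ} (hℓ : 0 < ℓ) :
    ∃ s, ∫⁻ x in wallSet n ℓ s, f x ∂ν ≤ ENNReal.ofReal (3 / n) * ∫⁻ x, f x ∂ν := by
  have hn0 : (0 : ℝ) < n := by exact_mod_cast hn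
  by_contra! hcon
  have h1 := ENNReal.sum_lt_sum_of_nonempty (s := Finset.range n) ⟨0, Finset.mem_range.2 hn⟩
    fun (k : ℕ) _ => hcon (k / n * ℓ)
  refine absurd h1 (not_lt.2 ?_)
  calc ∑ k ∈ Finset.range n, ∫⁻ x in wallSet n ℓ (k / n * ℓ), f x ∂ν
      ≤ ∑ k ∈ Finset.range n, ∑ c, ∫⁻ x in {x : E3 | ∃ m : ℤ,
          |(x c - k / n * ℓ) / ℓ - m| < 1 / (2 * n)}, f x ∂ν := by
        refine Finset.sum_le_sum fun k _ => ?_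
        rw [wallSet_eq_iUnion]
        refine (lintegral_iUnion_le _ _).trans ?_
        rw [tsum_fintype]
    _ = ∑ c, ∑ k ∈ Finset.range n, ∫⁻ x in {x : E3 | ∃ m : ℤ,
          |(x c - k / n * ℓ) / ℓ - m| < 1 / (2 * n)}, f x ∂ν := Finset.sum_comm
    _ ≤ ∑ _c : Fin 3, ∫⁻ x, f x ∂ν := by
        refine Finset.sum_le_sum fun c _ => ?_
        rw [← lintegral_biUnion_finset]
        · exact setLIntegral_le_lintegral _ _
        · intro k hk k' hk' hne
          exact disjoint_wall_coord hn hℓ c (Finset.mem_range.1 hk) (Finset.mem_range.1 hk') hne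
        · exact fun k _ => measurableSet_wallSet_coord _ _ _ c
    _ = _ := by
        have h3 : (n : ENNReal) * ENNReal.ofReal (3 / n) = 3 := by
          rw [← ENNReal.ofReal_natCast, ← ENNReal.ofReal_mul hn0.le, mul_div_cancel₀ _ hn0.ne']
          simp
        simp only [Finset.sum_const, Finset.card_univ, Fintype.card_fin, Finset.card_range,
          nsmul_eq_mul]
        rw [← mul_assoc, h3]
        norm_num

lemma exists_lintegral_magGradSq_le : ∃ C : ℝ, 0 < C ∧ ∀ A : E3 → E3, ContDiff ℝ 1 A →
    HasCompactSupport A → ∀ (n ℓ s τ β D l B V : ℝ) (K : Set (Fin 3 → ℤ)) (ν : Measure E3),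
      0 < ℓ → 0 < τ → 0 < β → 0 < l → 0 ≤ B → 0 ≤ V →
      (∀ t, |deriv (perCut n) t| ≤ D) → (∀ m ∈ K, cellEnergy A ℓ s m ≤ ENNReal.ofReal τ) →
      ∫⁻ z, ‖fderiv ℝ A z‖ₑ ^ 2 ≤ ENNReal.ofReal β → PowBdd ν B →
      ν {x | cellIdx ℓ s x ∈ K} ≤ ENNReal.ofReal V →
      ∫⁻ x, ENNReal.ofReal (magGradSq A (cellLoc n ℓ s K (cellMean A ℓ s)) x) ∂ν ≤
        ENNReal.ofReal ((3 * (D / ℓ) ^ 2 + l) * V +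
          5 * B * (C * τ ^ 2 * β) ^ (2 / 5 : ℝ) * l ^ (-(1 / 5) : ℝ)) := by
  obtain ⟨C, hC, hosc⟩ := exists_lintegral_osc_le
  refine ⟨27 * C, by positivity, fun A hA hAc n ℓ s τ β D l B V K ν hℓ hτ hβ0 hl hB hV hD hK hβ
    hν hνV => ?_⟩
  set Ω := {x | cellIdx ℓ s x ∈ K} with hΩ
  have hΩm : MeasurableSet Ω := measurableSet_cells K
  set W : E3 → ℝ := fun x => 3 * ‖A x - cellMean A ℓ s (cellIdx ℓ s x)‖ ^ 2 with hW
  have hWm : Measurable W := by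
    have h1 : Measurable (cellMean A ℓ s) := measurable_of_countable _
    exact ((hA.continuous.measurable.sub (h1.comp measurable_cellIdx)).norm.pow_const 2).const_mul 3
  have hW0 : ∀ x, 0 ≤ W x := fun x => by positivity
  have hmarkov : ∀ t, l ≤ t → volume (Ω ∩ {x | t < W x}) ≤
      ENNReal.ofReal (27 * C * τ ^ 2 * β * t⁻¹ ^ 3) := by
    intro t ht
    have ht0 : 0 < t := hl.trans_le ht
    have h1 : ENNReal.ofReal (t ^ 3) * volume (Ω ∩ {x | t < W x}) ≤
        ENNReal.ofReal (27 * C * τ ^ 2 * β) := by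
      calc ENNReal.ofReal (t ^ 3) * volume (Ω ∩ {x | t < W x})
          = ∫⁻ x in Ω ∩ {x | t < W x}, ENNReal.ofReal (t ^ 3) := by rw [setLIntegral_const]
        _ ≤ ∫⁻ x in Ω ∩ {x | t < W x}, ENNReal.ofReal 27 *
            ‖A x - cellMean A ℓ s (cellIdx ℓ s x)‖ₑ ^ 6 := by
          refine setLIntegral_mono' (hΩm.inter (measurableSet_lt measurable_const hWm))
            fun x hx => ?_
          have h2 : ‖A x - cellMean A ℓ s (cellIdx ℓ s x)‖ₑ ^ 6 =
              ENNReal.ofReal ((‖A x - cellMean A ℓ s (cellIdx ℓ s x)‖ ^ 2) ^ 3) := by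
            rw [ENNReal.ofReal_pow (by positivity), ← enorm_sq_eq_ofReal, ← pow_mul]
          rw [h2, ← ENNReal.ofReal_mul (by norm_num)]
          refine ENNReal.ofReal_le_ofReal ?_
          have h3 : t ^ 3 ≤ W x ^ 3 := pow_le_pow_left₀ ht0.le (le_of_lt hx.2) 3
          rw [hW, mul_pow] at h3
          linarith
        _ ≤ ∫⁻ x in Ω, ENNReal.ofReal 27 * ‖A x - cellMean A ℓ s (cellIdx ℓ s x)‖ₑ ^ 6 :=
          lintegral_mono_set Set.inter_subset_left
        _ ≤ ENNReal.ofReal 27 * ENNReal.ofReal (C * τ ^ 2 * β) := by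
          rw [lintegral_const_mul' _ _ ENNReal.ofReal_ne_top]
          exact mul_le_mul' le_rfl (hosc A hA hAc ℓ s τ β K hℓ hτ hK hβ)
        _ = _ := by
          rw [← ENNReal.ofReal_mul (by norm_num)]
          congr 1
          ring
    have ht3 : 0 < t ^ 3 := by positivity
    rw [inv_pow, ← div_eq_mul_inv, ENNReal.ofReal_div_of_pos ht3,
      ENNReal.le_div_iff_mul_le (Or.inl (by simpa using ht3)) (Or.inl ENNReal.ofReal_ne_top),
      mul_comm]
    exact h1
  calc ∫⁻ x, ENNReal.ofReal (magGradSq A (cellLoc n ℓ s K (cellMean A ℓ s)) x) ∂ν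
      ≤ ∫⁻ x, Ω.indicator (fun x => ENNReal.ofReal (3 * (D / ℓ) ^ 2) + ENNReal.ofReal (W x)) x
          ∂ν := by
        refine lintegral_mono fun x => ?_
        have h1 := magGradSq_cellLoc_le (s := s) (K := K) (a := cellMean A ℓ s) hD hℓ A x
        by_cases hx : x ∈ Ω
        · rw [Set.indicator_of_mem hx] at h1 ⊢
          rw [← ENNReal.ofReal_add (by positivity) (hW0 x)]
          exact ENNReal.ofReal_le_ofReal h1
        · rw [Set.indicator_of_notMem hx] at h1 ⊢
          rw [ENNReal.ofReal_of_nonpos h1]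
    _ = ENNReal.ofReal (3 * (D / ℓ) ^ 2) * ν Ω + ∫⁻ x in Ω, ENNReal.ofReal (W x) ∂ν := by
        rw [lintegral_indicator hΩm, lintegral_add_left measurable_const, setLIntegral_const]
    _ ≤ ENNReal.ofReal (3 * (D / ℓ) ^ 2) * ν Ω + (ENNReal.ofReal l * ν Ω + ENNReal.ofReal
          (5 * B * (27 * C * τ ^ 2 * β) ^ (2 / 5 : ℝ) * l ^ (-(1 / 5) : ℝ))) :=
        add_le_add le_rfl (hν.lintegral_le hB hΩm hWm hW0 (by positivity) hl hmarkov)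
    _ ≤ ENNReal.ofReal (3 * (D / ℓ) ^ 2) * ENNReal.ofReal V +
          (ENNReal.ofReal l * ENNReal.ofReal V + ENNReal.ofReal
          (5 * B * (27 * C * τ ^ 2 * β) ^ (2 / 5 : ℝ) * l ^ (-(1 / 5) : ℝ))) :=
        add_le_add (mul_le_mul' le_rfl hνV) (add_le_add (mul_le_mul' le_rfl hνV) le_rfl)
    _ = _ := by
        rw [← ENNReal.ofReal_mul (by positivity), ← ENNReal.ofReal_mul hl.le,
          ← ENNReal.ofReal_add (by positivity) (by positivity),
          ← ENNReal.ofReal_add (by positivity) (by positivity)]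
        congr 1
        ring

end CellSelection

section LowerBound

variable {N : ℕ} {Ψ : (Fin N → E3) → (Fin N → Fin 2) → ℂ}

lemma attW_indicator_le (hΨ : IsWaveFun N Ψ) {S : Set E3} (hS : MeasurableSet S) {b : ℝ}
    (hb : 0 ≤ b) (h : ∫⁻ x in S, ENNReal.ofReal (enorm3 x)⁻¹ ∂(dens N Ψ) ≤ ENNReal.ofReal b) :
    attW N (S.indicator fun _ => 1) Ψ ≤ b := by
  rw [← ENNReal.ofReal_le_ofReal_iff hb, ofReal_attW hΨ (measurable_const.indicator hS)
    (fun x => Set.indicator_nonneg (fun _ _ => zero_le_one) x)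
    (fun x => Set.indicator_le_self' (fun _ _ => zero_le_one) x)]
  refine le_trans (le_of_eq ?_) h
  rw [← lintegral_indicator hS]
  refine lintegral_congr fun x => ?_
  by_cases hx : x ∈ S <;> simp [hx]

lemma attW_le_add (hΨ : IsWaveFun N Ψ) {w w' w'' : E3 → ℝ} (hw : Measurable w)
    (hw0 : ∀ x, 0 ≤ w x) (hw1 : ∀ x, w x ≤ 1) (hw' : Measurable w') (hw0' : ∀ x, 0 ≤ w' x)
    (hw1' : ∀ x, w' x ≤ 1) (hw'' : Measurable w'') (hw0'' : ∀ x, 0 ≤ w'' x)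
    (hw1'' : ∀ x, w'' x ≤ 1) (h : ∀ x, w x ≤ w' x + w'' x) :
    attW N w Ψ ≤ attW N w' Ψ + attW N w'' Ψ := by
  have h' := attW_nonneg (N := N) hw0' (Ψ := Ψ)
  have h'' := attW_nonneg (N := N) hw0'' (Ψ := Ψ)
  rw [← ENNReal.ofReal_le_ofReal_iff (add_nonneg h' h''), ENNReal.ofReal_add h' h'',
    ofReal_attW hΨ hw hw0 hw1, ofReal_attW hΨ hw' hw0' hw1', ofReal_attW hΨ hw'' hw0'' hw1'',
    ← lintegral_add_left (f := fun x => ENNReal.ofReal (w' x * (enorm3 x)⁻¹))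
      (hw'.mul continuous_enorm3.measurable.inv).ennreal_ofReal]
  refine lintegral_mono fun x => ?_
  have hx := inv_nonneg.2 (enorm3_nonneg x)
  rw [← ENNReal.ofReal_add (mul_nonneg (hw0' x) hx) (mul_nonneg (hw0'' x) hx), ← add_mul]
  exact ENNReal.ofReal_le_ofReal (mul_le_mul_of_nonneg_right (h x) hx)

lemma norm_cellLoc_le_one {n ℓ s : ℝ} {K : Set (Fin 3 → ℤ)} {a : (Fin 3 → ℤ) → E3} (x : E3) :
    ‖cellLoc n ℓ s K a x‖ ≤ 1 := by
  rw [norm_cellLoc]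
  by_cases hx : x ∈ {x | cellIdx ℓ s x ∈ K}
  · rw [Set.indicator_of_mem hx]
    exact cellCut_le_one x
  · rw [Set.indicator_of_notMem hx]
    exact zero_le_one

lemma indicator_one_mem_Icc (S : Set E3) (x : E3) :
    0 ≤ S.indicator (fun _ => (1 : ℝ)) x ∧ S.indicator (fun _ => (1 : ℝ)) x ≤ 1 := by
  by_cases hx : x ∈ S <;> simp [hx]

lemma indicator_one_union_le (S T : Set E3) (x : E3) :
    (S ∪ T).indicator (fun _ => (1 : ℝ)) x ≤
      S.indicator (fun _ => (1 : ℝ)) x + T.indicator (fun _ => (1 : ℝ)) x := by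
  by_cases hx : x ∈ S <;> by_cases hx' : x ∈ T <;> simp [hx, hx']

/-- The attraction lost outside the kept cubes. -/
lemma attW_le_of_cover (hΨ : IsWaveFun N Ψ) {w : E3 → ℝ} (hw : Measurable w)
    (hw0 : ∀ x, 0 ≤ w x) (hw1 : ∀ x, w x ≤ 1) {S T U : Set E3} (hS : MeasurableSet S)
    (hT : MeasurableSet T) (hU : MeasurableSet U)
    (h : ∀ x, x ∉ S → x ∉ T → x ∉ U → w x = 1) :
    attW N (fun _ => 1) Ψ ≤ attW N w Ψ + (attW N (S.indicator fun _ => 1) Ψ +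
      (attW N (T.indicator fun _ => 1) Ψ + attW N (U.indicator fun _ => 1) Ψ)) := by
  have hm : ∀ {S : Set E3}, MeasurableSet S → Measurable (S.indicator fun _ => (1 : ℝ)) :=
    fun hS => measurable_const.indicator hS
  have h0 : ∀ (S : Set E3) x, 0 ≤ S.indicator (fun _ => (1 : ℝ)) x := fun S x =>
    (indicator_one_mem_Icc S x).1
  have h1 : ∀ (S : Set E3) x, S.indicator (fun _ => (1 : ℝ)) x ≤ 1 := fun S x =>
    (indicator_one_mem_Icc S x).2
  have hTU := hT.union hU
  have hSTU := hS.union hTU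
  refine (attW_le_add hΨ measurable_const (fun _ => zero_le_one) (fun _ => le_rfl) hw hw0 hw1
    (hm hSTU) (h0 _) (h1 _) fun x => ?_).trans (add_le_add le_rfl
    ((attW_le_add hΨ (hm hSTU) (h0 _) (h1 _) (hm hS) (h0 _) (h1 _) (hm hTU) (h0 _) (h1 _)
      (indicator_one_union_le S _)).trans (add_le_add le_rfl
    (attW_le_add hΨ (hm hTU) (h0 _) (h1 _) (hm hT) (h0 _) (h1 _) (hm hU) (h0 _) (h1 _)
      (indicator_one_union_le T U)))))
  by_cases hx : x ∈ S ∪ (T ∪ U)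
  · rw [Set.indicator_of_mem hx]
    linarith [hw0 x]
  · rw [Set.mem_union, Set.mem_union, not_or, not_or] at hx
    rw [h x hx.1 hx.2.1 hx.2.2]
    linarith [h0 (S ∪ (T ∪ U)) x]

/-- The cubes meeting the ball of radius `R`. -/
def nearCells (ℓ s R : ℝ) : Set (Fin 3 → ℤ) := {m | ∃ x, cellIdx ℓ s x = m ∧ ‖x‖ < R}

lemma volume_nearCells_le {ℓ s R : ℝ} (hℓ : 0 < ℓ) (hR : ℓ ≤ R) {K : Set (Fin 3 → ℤ)}
    (hK : K ⊆ nearCells ℓ s R) :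
    volume {x | cellIdx ℓ s x ∈ K} ≤ ENNReal.ofReal ((4 * R) ^ 3) := by
  have hsub : {x | cellIdx ℓ s x ∈ K} ⊆ Metric.closedBall (0 : E3) (2 * R) := by
    intro x hx
    obtain ⟨y, hy, hyR⟩ := hK hx
    have h1 := mem_closedBall_cellCtr (s := s) hℓ x
    have h2 := mem_closedBall_cellCtr (s := s) hℓ y
    rw [hy] at h2
    have h3 := dist_triangle_right x y (cellCtr ℓ s (cellIdx ℓ s x))
    have h4 := dist_triangle x y 0
    rw [Metric.mem_closedBall] at h1 h2 ⊢
    rw [dist_zero_right y] at h4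
    linarith
  refine (measure_mono hsub).trans (le_of_eq ?_)
  rw [Real.volume_pi_closedBall _ (by linarith), Fintype.card_fin]
  congr 1
  ring

lemma exists_energy_lower_bound : ∃ C D : ℝ, 0 < C ∧ 0 < D ∧ ∀ (N : ℕ)
    (Ψ : (Fin N → E3) → (Fin N → Fin 2) → ℂ) (A : E3 → E3) (Z α E Kb β ε ℓ R τ l : ℝ) (n : ℕ),
    IsWaveFun N Ψ → IsVecPot A → 1 ≤ Z → E ≤ 0 →
    (∀ n, 1 ≤ n → ∀ Ψ, IsWaveFun n Ψ → E ≤ clSchEnergy n Z α (fun _ => 0) Ψ) →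
    0 < Kb → kin N A Ψ ≤ Kb → 0 < β → ∫⁻ z, ‖fderiv ℝ A z‖ₑ ^ 2 ≤ ENNReal.ofReal β →
    0 < ε → 0 < ℓ → ℓ ≤ R → 0 < τ → 0 < l → 0 < n →
    E ≤ kin N A Ψ - Z * attW N (fun _ => 1) Ψ + repW N (fun _ => 1) Ψ + ε * Kb +
      (1 + ε⁻¹) * ((3 * (D * n / ℓ) ^ 2 + l) *
          (10 * Kb ^ (3 / 5 : ℝ) * ((4 * R) ^ 3) ^ (2 / 5 : ℝ)) +
        5 * (10 * Kb ^ (3 / 5 : ℝ)) * (C * τ ^ 2 * β) ^ (2 / 5 : ℝ) * l ^ (-(1 / 5) : ℝ)) +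
      3 / n * (Z * attW N (fun _ => 1) Ψ) +
      Z * (16 * (10 * Kb ^ (3 / 5 : ℝ)) * (64 * ℓ ^ 3 * β / τ) ^ (1 / 15 : ℝ)) +
      5 * Z ^ 2 / R := by
  obtain ⟨C, hC, hmag⟩ := exists_lintegral_magGradSq_le
  obtain ⟨D, hD, hcut⟩ := exists_abs_deriv_perCut_le
  refine ⟨C, D, hC, hD, ?_⟩
  intro N Ψ A Z α E Kb β ε ℓ R τ l n hΨ hA hZ hE hle hKb hkin hβ0 hβ hε hℓ hR hτ hl hn
  have hn0 : (0 : ℝ) < n := by exact_mod_cast hn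
  have hR0 : 0 < R := hℓ.trans_le hR
  have hAc := hA.1.continuous
  have hA1 : ContDiff ℝ 1 A := hA.1.of_le (by simp)
  have hν : PowBdd (dens N Ψ) (10 * Kb ^ (3 / 5 : ℝ)) := powBdd_dens hΨ hAc hKb hkin
  have hB0 : 0 ≤ 10 * Kb ^ (3 / 5 : ℝ) := by positivity
  generalize 10 * Kb ^ (3 / 5 : ℝ) = B at hν hB0 ⊢
  have hatt0 : 0 ≤ attW N (fun _ => 1) Ψ := attW_nonneg fun _ => zero_le_one
  obtain ⟨s, hs⟩ := exists_lintegral_wallSet_le (dens N Ψ)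
    (fun x => ENNReal.ofReal (enorm3 x)⁻¹) hn hℓ
  have hwallm := measurableSet_wallSet n ℓ s
  have hbadm : MeasurableSet {x | ENNReal.ofReal τ < cellEnergy A ℓ s (cellIdx ℓ s x)} :=
    measurableSet_cells {m | ENNReal.ofReal τ < cellEnergy A ℓ s m}
  have hfarm : MeasurableSet {x | cellIdx ℓ s x ∈ (nearCells ℓ s R)ᶜ} := measurableSet_cells _
  have hbadv := volume_lt_cellEnergy_le (s := s) hℓ hA1 hτ hβ
  have hfar : ∀ x ∈ {x | cellIdx ℓ s x ∈ (nearCells ℓ s R)ᶜ}, R ≤ enorm3 x := by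
    intro x hx
    by_contra! hcon
    exact hx ⟨x, rfl, (norm_le_enorm3 x).trans_lt hcon⟩
  have hnear : ∀ x, x ∉ {x | ENNReal.ofReal τ < cellEnergy A ℓ s (cellIdx ℓ s x)} →
      x ∉ {x | cellIdx ℓ s x ∈ (nearCells ℓ s R)ᶜ} → x ∈ {x | cellIdx ℓ s x ∈
        {m | m ∈ nearCells ℓ s R ∧ cellEnergy A ℓ s m ≤ ENNReal.ofReal τ}} :=
    fun x h2 h3 => ⟨not_not.1 h3, not_lt.1 h2⟩
  have hfarK : ∀ x ∈ {x | cellIdx ℓ s x ∈ (nearCells ℓ s R)ᶜ}, x ∉ {x | cellIdx ℓ s x ∈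
      {m | m ∈ nearCells ℓ s R ∧ cellEnergy A ℓ s m ≤ ENNReal.ofReal τ}} :=
    fun x hx hxK => hx hxK.1
  have hKsub : {m | m ∈ nearCells ℓ s R ∧ cellEnergy A ℓ s m ≤ ENNReal.ofReal τ} ⊆
      nearCells ℓ s R := fun m hm => hm.1
  have hKτ : ∀ m ∈ {m | m ∈ nearCells ℓ s R ∧ cellEnergy A ℓ s m ≤ ENNReal.ofReal τ},
      cellEnergy A ℓ s m ≤ ENNReal.ofReal τ := fun m hm => hm.2
  generalize {x | ENNReal.ofReal τ < cellEnergy A ℓ s (cellIdx ℓ s x)} = Bad at *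
  generalize {m | m ∈ nearCells ℓ s R ∧ cellEnergy A ℓ s m ≤ ENNReal.ofReal τ} = K at *
  generalize {x | cellIdx ℓ s x ∈ (nearCells ℓ s R)ᶜ} = Far at *
  have hmass : dens N Ψ {x | cellIdx ℓ s x ∈ K} ≤
      ENNReal.ofReal (B * ((4 * R) ^ 3) ^ (2 / 5 : ℝ)) :=
    hν _ (measurableSet_cells K) _ (by positivity) (volume_nearCells_le hℓ hR hKsub)
  have hkinB := hmag A hA1 hA.2.1 n ℓ s τ β (D * n) l B (B * ((4 * R) ^ 3) ^ (2 / 5 : ℝ)) K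
    (dens N Ψ) hℓ hτ hβ0 hl hB0 (by positivity) (hcut n hn0) hKτ hβ hν hmass
  have hgs : ContDiff ℝ (⊤ : ℕ∞) (cellLoc n ℓ s K (cellMean A ℓ s)) := contDiff_cellLoc
  have hg1 : ∀ x, ‖cellLoc n ℓ s K (cellMean A ℓ s) x‖ ≤ 1 := norm_cellLoc_le_one
  have hgone : ∀ x, x ∉ wallSet n ℓ s → x ∉ Bad → x ∉ Far →
      ‖cellLoc n ℓ s K (cellMean A ℓ s) x‖ ^ 2 = 1 := by
    intro x h1 h2 h3
    rw [norm_cellLoc, Set.indicator_of_mem (hnear x h2 h3), cellCut_eq_one hn0, one_pow]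
    intro c m
    by_contra! hcon
    exact h1 ⟨c, m, hcon⟩
  have hgfar : ∀ x ∈ Far, ‖cellLoc n ℓ s K (cellMean A ℓ s) x‖ ^ 2 = 0 := by
    intro x hx
    rw [norm_cellLoc, Set.indicator_of_notMem (hfarK x hx)]
    norm_num
  generalize cellLoc n ℓ s K (cellMean A ℓ s) = g at *
  have hloc := localization hE hle hΨ hgs hg1
  have hkl := kin_localized_le hΨ hAc hgs hg1 hε (by positivity) hkinB
  have hwm : Measurable fun x => ‖g x‖ ^ 2 := hgs.continuous.norm.measurable.pow_const 2
  have hw0 : ∀ x, 0 ≤ ‖g x‖ ^ 2 := fun x => by positivity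
  have hw1 : ∀ x, ‖g x‖ ^ 2 ≤ 1 := fun x => pow_le_one₀ (norm_nonneg _) (hg1 x)
  have hcover := attW_le_of_cover hΨ hwm hw0 hw1 hwallm hbadm hfarm hgone
  have hrep := repW_add_le hΨ hwm hw0 (measurable_const.indicator hfarm)
    (fun x => (indicator_one_mem_Icc Far x).1) (fun x => by
      by_cases hx : x ∈ Far
      · rw [hgfar x hx, Set.indicator_of_mem hx, zero_add]
      · rw [Set.indicator_of_notMem hx, add_zero]
        exact hw1 x)
  have hfarle := far_le hΨ hfarm hR0 hfar hZ
  have hbad := attW_indicator_le hΨ hbadm (by positivity)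
    (hν.lintegral_coulomb_le hB0 hbadm (by positivity) hbadv)
  have hwall : attW N ((wallSet n ℓ s).indicator fun _ => 1) Ψ ≤
      3 / n * attW N (fun _ => 1) Ψ := by
    refine attW_indicator_le hΨ hwallm (by positivity) (hs.trans (le_of_eq ?_))
    rw [ENNReal.ofReal_mul (by positivity), ofReal_attW hΨ measurable_const
      (fun _ => zero_le_one) (fun _ => le_rfl)]
    simp only [one_mul]
  have hZ0 : 0 ≤ Z := by linarith
  have h1 := mul_le_mul_of_nonneg_left hcover hZ0
  have h2 := mul_le_mul_of_nonneg_left hbad hZ0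
  have h3 := mul_le_mul_of_nonneg_left hwall hZ0
  have h4 := mul_le_mul_of_nonneg_left hkin hε.le
  simp only [mul_add] at h1
  have h5 : (1 + ε) * kin N A Ψ = kin N A Ψ + ε * kin N A Ψ := by ring
  have h6 : Z * (3 / n * attW N (fun _ => 1) Ψ) = 3 / n * (Z * attW N (fun _ => 1) Ψ) := by ring
  linarith

end LowerBound

section Parameters

lemma rpow_ceil_bounds {Z : ℝ} (hZ : 1 ≤ Z) (θ : ℝ) (hθ : 0 ≤ θ) :
    Z ^ θ ≤ (⌈Z ^ θ⌉₊ : ℝ) ∧ (⌈Z ^ θ⌉₊ : ℝ) ≤ 2 * Z ^ θ := by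
  have h1 : 1 ≤ Z ^ θ := Real.one_le_rpow hZ hθ
  exact ⟨Nat.le_ceil _, by linarith [Nat.ceil_lt_add_one (zero_le_one.trans h1)]⟩

/-- The choice of the localization parameters. -/
lemma exists_parameters (C D M : ℝ) (hC : 0 < C) (hD : 0 < D) (hM : 0 < M) :
    ∃ C' : ℝ, 0 < C' ∧ ∀ Z P : ℝ, 1 ≤ Z → 0 ≤ P → P ≤ M * Z ^ (7 / 3 : ℝ) →
      ∃ (ε ℓ R τ l : ℝ) (n : ℕ), 0 < ε ∧ 0 < ℓ ∧ ℓ ≤ R ∧ 0 < τ ∧ 0 < l ∧ 0 < n ∧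
      ε * (M * Z ^ (7 / 3 : ℝ)) +
      (1 + ε⁻¹) * ((3 * (D * n / ℓ) ^ 2 + l) *
          (10 * (M * Z ^ (7 / 3 : ℝ)) ^ (3 / 5 : ℝ) * ((4 * R) ^ 3) ^ (2 / 5 : ℝ)) +
        5 * (10 * (M * Z ^ (7 / 3 : ℝ)) ^ (3 / 5 : ℝ)) *
          (C * τ ^ 2 * (M * Z ^ (4 / 3 : ℝ))) ^ (2 / 5 : ℝ) * l ^ (-(1 / 5) : ℝ)) +
      3 / n * P +
      Z * (16 * (10 * (M * Z ^ (7 / 3 : ℝ)) ^ (3 / 5 : ℝ)) *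
        (64 * ℓ ^ 3 * (M * Z ^ (4 / 3 : ℝ)) / τ) ^ (1 / 15 : ℝ)) +
      5 * Z ^ 2 / R ≤ C' * Z ^ ((7 : ℝ) / 3 - 1 / 63) := by
  refine ⟨M + 2 * ((12 * D ^ 2 + 1) * (10 * M ^ (3 / 5 : ℝ) * (64 : ℝ) ^ (2 / 5 : ℝ)) +
    50 * M ^ (3 / 5 : ℝ) * (C * M) ^ (2 / 5 : ℝ)) + 3 * M +
    160 * M ^ (3 / 5 : ℝ) * (64 * M) ^ (1 / 15 : ℝ) + 5, by positivity,
    fun Z P hZ hP0 hP => ?_⟩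
  have hZ0 : 0 < Z := by linarith
  have hadd : ∀ a b : ℝ, Z ^ a * Z ^ b = Z ^ (a + b) := fun a b => (Real.rpow_add hZ0 a b).symm
  have hpow : ∀ a b : ℝ, (Z ^ a) ^ b = Z ^ (a * b) := fun a b => (Real.rpow_mul hZ0.le a b).symm
  have hnat : ∀ (a : ℝ) (k : ℕ), (Z ^ a) ^ k = Z ^ (a * k) := fun a k => by
    rw [← Real.rpow_natCast, hpow]
  have hle : ∀ {a b : ℝ}, a ≤ b → Z ^ a ≤ Z ^ b := fun h => Real.rpow_le_rpow_of_exponent_le hZ h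
  have hpos : ∀ a : ℝ, 0 < Z ^ a := fun a => Real.rpow_pos_of_pos hZ0 a
  have hinv : ∀ a : ℝ, (Z ^ a)⁻¹ = Z ^ (-a) := fun a => (Real.rpow_neg hZ0.le a).symm
  obtain ⟨hn1, hn2⟩ := rpow_ceil_bounds hZ (1 / 63) (by norm_num)
  have hnpos : (0 : ℝ) < ⌈Z ^ (1 / 63 : ℝ)⌉₊ := (hpos _).trans_le hn1
  refine ⟨Z ^ (-(1 / 63) : ℝ), Z ^ (-(11 / 18) : ℝ), Z ^ (-(1 / 3) + 1 / 63 : ℝ),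
    Z ^ (31 / 42 : ℝ), Z ^ (5 / 4 : ℝ), ⌈Z ^ (1 / 63 : ℝ)⌉₊, hpos _, hpos _,
    hle (by norm_num), hpos _, hpos _, by exact_mod_cast hnpos, ?_⟩
  generalize (⌈Z ^ (1 / 63 : ℝ)⌉₊ : ℝ) = n at hn1 hn2 hnpos ⊢
  have hKb : (M * Z ^ (7 / 3 : ℝ)) ^ (3 / 5 : ℝ) = M ^ (3 / 5 : ℝ) * Z ^ (7 / 5 : ℝ) := by
    rw [Real.mul_rpow hM.le (hpos _).le, hpow]
    norm_num
  have hR : ((4 * Z ^ (-(1 / 3) + 1 / 63 : ℝ)) ^ 3) ^ (2 / 5 : ℝ) =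
      (64 : ℝ) ^ (2 / 5 : ℝ) * Z ^ (-(8 / 21) : ℝ) := by
    rw [mul_pow, Real.mul_rpow (by norm_num) (by positivity), hnat, hpow]
    norm_num
  have hosc : (C * (Z ^ (31 / 42 : ℝ)) ^ 2 * (M * Z ^ (4 / 3 : ℝ))) ^ (2 / 5 : ℝ) =
      (C * M) ^ (2 / 5 : ℝ) * Z ^ (118 / 105 : ℝ) := by
    rw [hnat, show C * Z ^ ((31 / 42 : ℝ) * (2 : ℕ)) * (M * Z ^ (4 / 3 : ℝ)) =
      (C * M) * (Z ^ ((31 / 42 : ℝ) * (2 : ℕ)) * Z ^ (4 / 3 : ℝ)) by ring, hadd,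
      Real.mul_rpow (by positivity) (hpos _).le, hpow]
    norm_num
  have hbad : (64 * (Z ^ (-(11 / 18) : ℝ)) ^ 3 * (M * Z ^ (4 / 3 : ℝ)) / Z ^ (31 / 42 : ℝ)) ^
      (1 / 15 : ℝ) = (64 * M) ^ (1 / 15 : ℝ) * Z ^ (-(26 / 315) : ℝ) := by
    rw [hnat, div_eq_mul_inv, hinv, show 64 * Z ^ (-(11 / 18 : ℝ) * (3 : ℕ)) *
      (M * Z ^ (4 / 3 : ℝ)) * Z ^ (-(31 / 42) : ℝ) = (64 * M) *
      (Z ^ (-(11 / 18 : ℝ) * (3 : ℕ)) * Z ^ (4 / 3 : ℝ) * Z ^ (-(31 / 42) : ℝ)) by ring,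
      hadd, hadd, Real.mul_rpow (by positivity) (hpos _).le, hpow]
    norm_num
  have hl : (Z ^ (5 / 4 : ℝ)) ^ (-(1 / 5) : ℝ) = Z ^ (-(1 / 4) : ℝ) := by
    rw [hpow]
    norm_num
  have hε : 1 + (Z ^ (-(1 / 63) : ℝ))⁻¹ ≤ 2 * Z ^ (1 / 63 : ℝ) := by
    rw [hinv, neg_neg]
    linarith [Real.one_le_rpow hZ (by norm_num : (0 : ℝ) ≤ 1 / 63)]
  have hcut : 3 * (D * n / Z ^ (-(11 / 18) : ℝ)) ^ 2 + Z ^ (5 / 4 : ℝ) ≤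
      (12 * D ^ 2 + 1) * Z ^ (79 / 63 : ℝ) := by
    have h1 : D * n / Z ^ (-(11 / 18) : ℝ) ≤ 2 * D * Z ^ (79 / 126 : ℝ) := by
      rw [div_eq_mul_inv, hinv, neg_neg]
      calc D * n * Z ^ (11 / 18 : ℝ) ≤ D * (2 * Z ^ (1 / 63 : ℝ)) * Z ^ (11 / 18 : ℝ) := by
            have := hpos (11 / 18)
            gcongr
        _ = 2 * D * (Z ^ (1 / 63 : ℝ) * Z ^ (11 / 18 : ℝ)) := by ring
        _ = _ := by rw [hadd]; norm_num
    have h2 : (D * n / Z ^ (-(11 / 18) : ℝ)) ^ 2 ≤ (2 * D * Z ^ (79 / 126 : ℝ)) ^ 2 :=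
      pow_le_pow_left₀ (by have := hpos (-(11 / 18)); positivity) h1 2
    have h3 : (2 * D * Z ^ (79 / 126 : ℝ)) ^ 2 = 4 * D ^ 2 * Z ^ (79 / 63 : ℝ) := by
      rw [mul_pow, hnat, mul_pow, show (79 / 126 : ℝ) * (2 : ℕ) = 79 / 63 by norm_num]
      norm_num
    have h4 : Z ^ (5 / 4 : ℝ) ≤ Z ^ (79 / 63 : ℝ) := hle (by norm_num)
    linarith
  rw [hKb, hR, hosc, hbad, hl]
  set X : ℝ := Z ^ ((7 : ℝ) / 3 - 1 / 63) with hX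
  have t1 : Z ^ (-(1 / 63) : ℝ) * (M * Z ^ (7 / 3 : ℝ)) = M * X := by
    rw [mul_left_comm, hadd, hX]
    norm_num
  have t2 : (3 * (D * n / Z ^ (-(11 / 18) : ℝ)) ^ 2 + Z ^ (5 / 4 : ℝ)) *
      (10 * (M ^ (3 / 5 : ℝ) * Z ^ (7 / 5 : ℝ)) * ((64 : ℝ) ^ (2 / 5 : ℝ) * Z ^ (-(8 / 21) : ℝ))) ≤
      (12 * D ^ 2 + 1) * (10 * M ^ (3 / 5 : ℝ) * (64 : ℝ) ^ (2 / 5 : ℝ)) *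
        Z ^ ((7 : ℝ) / 3 - 2 / 63) := by
    have h1 := hpos (7 / 5)
    have h2 := hpos (-(8 / 21))
    calc _ ≤ (12 * D ^ 2 + 1) * Z ^ (79 / 63 : ℝ) * (10 * (M ^ (3 / 5 : ℝ) * Z ^ (7 / 5 : ℝ)) *
          ((64 : ℝ) ^ (2 / 5 : ℝ) * Z ^ (-(8 / 21) : ℝ))) :=
          mul_le_mul_of_nonneg_right hcut (by positivity)
      _ = (12 * D ^ 2 + 1) * (10 * M ^ (3 / 5 : ℝ) * (64 : ℝ) ^ (2 / 5 : ℝ)) *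
          (Z ^ (79 / 63 : ℝ) * Z ^ (7 / 5 : ℝ) * Z ^ (-(8 / 21) : ℝ)) := by ring
      _ ≤ _ := by
          rw [hadd, hadd]
          exact mul_le_mul_of_nonneg_left (hle (by norm_num)) (by positivity)
  have t3 : 5 * (10 * (M ^ (3 / 5 : ℝ) * Z ^ (7 / 5 : ℝ))) *
      ((C * M) ^ (2 / 5 : ℝ) * Z ^ (118 / 105 : ℝ)) * Z ^ (-(1 / 4) : ℝ) ≤
      50 * M ^ (3 / 5 : ℝ) * (C * M) ^ (2 / 5 : ℝ) * Z ^ ((7 : ℝ) / 3 - 2 / 63) := by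
    calc _ = 50 * M ^ (3 / 5 : ℝ) * (C * M) ^ (2 / 5 : ℝ) *
          (Z ^ (7 / 5 : ℝ) * Z ^ (118 / 105 : ℝ) * Z ^ (-(1 / 4) : ℝ)) := by ring
      _ ≤ _ := by
          rw [hadd, hadd]
          exact mul_le_mul_of_nonneg_left (hle (by norm_num)) (by positivity)
  have t4 : Z ^ (1 / 63 : ℝ) * Z ^ ((7 : ℝ) / 3 - 2 / 63) = X := by
    rw [hadd, hX]
    norm_num
  have t5 : 3 / n * P ≤ 3 * M * X := by
    calc 3 / n * P ≤ 3 / Z ^ (1 / 63 : ℝ) * (M * Z ^ (7 / 3 : ℝ)) := by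
          have := hpos (1 / 63)
          gcongr
      _ = 3 * M * (Z ^ (7 / 3 : ℝ) * Z ^ (-(1 / 63) : ℝ)) := by
          rw [div_eq_mul_inv, hinv]
          ring
      _ = 3 * M * X := by
          rw [hadd, hX]
          norm_num
  have t6 : Z * (16 * (10 * (M ^ (3 / 5 : ℝ) * Z ^ (7 / 5 : ℝ))) *
      ((64 * M) ^ (1 / 15 : ℝ) * Z ^ (-(26 / 315) : ℝ))) =
      160 * M ^ (3 / 5 : ℝ) * (64 * M) ^ (1 / 15 : ℝ) * X := by
    calc _ = 160 * M ^ (3 / 5 : ℝ) * (64 * M) ^ (1 / 15 : ℝ) *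
          (Z ^ (1 : ℝ) * Z ^ (7 / 5 : ℝ) * Z ^ (-(26 / 315) : ℝ)) := by
          rw [Real.rpow_one]
          ring
      _ = _ := by
          rw [hadd, hadd, hX]
          norm_num
  have t7 : 5 * Z ^ 2 / Z ^ (-(1 / 3) + 1 / 63 : ℝ) = 5 * X := by
    rw [div_eq_mul_inv, hinv, ← Real.rpow_natCast, mul_assoc, hadd, hX]
    norm_num
  have t8 := mul_le_mul hε (add_le_add t2 t3) (by positivity) (by positivity)
  have t9 : 2 * Z ^ (1 / 63 : ℝ) * ((12 * D ^ 2 + 1) * (10 * M ^ (3 / 5 : ℝ) *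
      (64 : ℝ) ^ (2 / 5 : ℝ)) * Z ^ ((7 : ℝ) / 3 - 2 / 63) +
      50 * M ^ (3 / 5 : ℝ) * (C * M) ^ (2 / 5 : ℝ) * Z ^ ((7 : ℝ) / 3 - 2 / 63)) =
      2 * ((12 * D ^ 2 + 1) * (10 * M ^ (3 / 5 : ℝ) * (64 : ℝ) ^ (2 / 5 : ℝ)) +
        50 * M ^ (3 / 5 : ℝ) * (C * M) ^ (2 / 5 : ℝ)) * X := by
    rw [← t4]
    ring
  rw [t9] at t8
  rw [t1, t6, t7]
  linarith

end Parameters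

section Conclusion

lemma IsVecPot.zero : IsVecPot fun _ => 0 := by
  refine ⟨contDiff_const, HasCompactSupport.zero, fun x => ?_⟩
  simp [pdVec]

lemma curlSq_nonneg (A : E3 → E3) (x : E3) : 0 ≤ curlSq A x :=
  Finset.sum_nonneg fun _ _ => sq_nonneg _

lemma nfSchSet_subset_clSchSet (Z α : ℝ) : nfSchSet Z α ⊆ clSchSet Z α := by
  rintro E ⟨N, hN, Ψ, hΨ, rfl⟩
  exact ⟨N, hN, _, IsVecPot.zero, Ψ, hΨ, rfl⟩

lemma exists_isWaveFun_one : ∃ Ψ : (Fin 1 → E3) → (Fin 1 → Fin 2) → ℂ, IsWaveFun 1 Ψ := by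
  let χ : ContDiffBump (0 : Fin 1 → E3) := ⟨1, 2, one_pos, one_lt_two⟩
  have hχ : 0 < ∫ x, χ x ^ 2 := by
    refine Continuous.integral_pos_of_hasCompactSupport_nonneg_nonzero (x := 0)
      (χ.continuous.pow 2) ?_ (fun x => by positivity) ?_
    · simp only [sq]
      exact χ.hasCompactSupport.mul_left (f := χ)
    · simp [χ.one_of_mem_closedBall (Metric.mem_closedBall_self χ.rIn_pos.le)]
  set c : ℝ := (Real.sqrt (2 * ∫ x, χ x ^ 2))⁻¹ with hc
  refine ⟨fun x _ => (c * χ x : ℝ), fun s => ?_, fun s => ?_, fun π x s => ?_, ?_⟩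
  · exact Complex.ofRealCLM.contDiff.comp (contDiff_const.mul χ.contDiff)
  · exact (χ.hasCompactSupport.mul_left (f := fun _ => c)).comp_left Complex.ofReal_zero
  · rw [Subsingleton.elim π 1]
    simp
  · have h1 : ∀ x, ‖((c * χ x : ℝ) : ℂ)‖ ^ 2 = c ^ 2 * χ x ^ 2 := fun x => by
      rw [Complex.norm_real, Real.norm_eq_abs, sq_abs, mul_pow]
    have h2 : c ^ 2 * (2 * ∫ x, χ x ^ 2) = 1 := by
      rw [hc, inv_pow, Real.sq_sqrt (by positivity), inv_mul_cancel₀ (by positivity)]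
    simp only [h1, integral_const_mul, Finset.sum_const, Finset.card_univ, Fintype.card_fun,
      Fintype.card_fin, pow_one, nsmul_eq_mul]
    push_cast
    linarith

lemma exists_nfSchSet_le : ∃ C : ℝ, 0 ≤ C ∧ ∀ Z α : ℝ, 0 ≤ Z → ∃ E ∈ nfSchSet Z α, E ≤ C := by
  obtain ⟨Ψ, hΨ⟩ := exists_isWaveFun_one
  refine ⟨kin 1 (fun _ => 0) Ψ, kin_nonneg _ _, fun Z α hZ =>
    ⟨_, ⟨1, le_rfl, Ψ, hΨ, rfl⟩, ?_⟩⟩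
  have h1 : 0 ≤ attW 1 (fun _ => 1) Ψ := attW_nonneg fun _ => zero_le_one
  have h2 : repW 1 (fun _ => 1) Ψ = 0 := by simp [repW]
  have h3 : ∫ x, curlSq (fun _ : E3 => (0 : E3)) x = 0 := by
    simp [curlSq, curl3, pdVec, Fin.sum_univ_three]
  rw [clSchEnergy_eq, h2, h3]
  linarith [mul_nonneg hZ h1]

lemma le_clSchEnergy {N : ℕ} {Ψ : (Fin N → E3) → (Fin N → Fin 2) → ℂ} (hΨ : IsWaveFun N Ψ)
    {A : E3 → E3} (hA : Continuous A) {Z : ℝ} (hZ : 1 ≤ Z) (α : ℝ) :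
    -((1 / 4 + 20 * 640 ^ 5) * Z ^ (7 / 3 : ℝ)) ≤ clSchEnergy N Z α A Ψ := by
  have h1 := attW_le hΨ hA hZ
  have h2 := kin_nonneg A Ψ
  have h3 : 0 ≤ repW N (fun _ => 1) Ψ := repW_nonneg fun _ => zero_le_one
  have h4 : 0 ≤ (8 * Real.pi * α ^ 2)⁻¹ * ∫ x, curlSq A x :=
    mul_nonneg (by positivity) (integral_nonneg (curlSq_nonneg A))
  rw [clSchEnergy_eq]
  linarith

lemma bddBelow_clSchSet {Z : ℝ} (hZ : 1 ≤ Z) (α : ℝ) : BddBelow (clSchSet Z α) := by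
  refine ⟨-((1 / 4 + 20 * 640 ^ 5) * Z ^ (7 / 3 : ℝ)), ?_⟩
  rintro E ⟨N, -, A, hA, Ψ, hΨ, rfl⟩
  exact le_clSchEnergy hΨ hA.1.continuous hZ α

lemma lintegral_fderiv_sq_le_of_field {A : E3 → E3} (hA : IsVecPot A) {Z α F : ℝ} (hZ : 1 ≤ Z)
    (hα : 0 < α) (hκ : Z * α ^ 2 ≤ 1)
    (hF : (8 * Real.pi * α ^ 2)⁻¹ * ∫ x, curlSq A x ≤ F * Z ^ (7 / 3 : ℝ)) :
    ∫⁻ z, ‖fderiv ℝ A z‖ₑ ^ 2 ≤ ENNReal.ofReal (96 * F * Z ^ (4 / 3 : ℝ)) := by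
  refine (lintegral_fderiv_sq_le hA).trans (ENNReal.ofReal_le_ofReal ?_)
  have hZ0 : 0 < Z := by linarith
  have hI : 0 ≤ ∫ x, curlSq A x := integral_nonneg (curlSq_nonneg A)
  have hZp : Z ^ (7 / 3 : ℝ) = Z * Z ^ (4 / 3 : ℝ) := by
    conv_rhs => rw [← Real.rpow_one_add' hZ0.le (by norm_num)]
    norm_num
  have hp : 0 < 8 * Real.pi * α ^ 2 := by positivity
  rw [inv_mul_le_iff₀ hp, hZp] at hF
  have hF0 : 0 ≤ F * Z ^ (4 / 3 : ℝ) := by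
    by_contra! hneg
    have : 8 * Real.pi * α ^ 2 * (F * (Z * Z ^ (4 / 3 : ℝ))) < 0 := by
      rw [mul_left_comm F]
      exact mul_neg_of_pos_of_neg hp (mul_neg_of_pos_of_neg hZ0 hneg)
    linarith
  calc 3 * ∫ x, curlSq A x ≤ 3 * (8 * Real.pi * α ^ 2 * (F * (Z * Z ^ (4 / 3 : ℝ)))) := by linarith
    _ = 24 * Real.pi * (Z * α ^ 2) * (F * Z ^ (4 / 3 : ℝ)) := by ring
    _ ≤ 24 * 4 * 1 * (F * Z ^ (4 / 3 : ℝ)) := by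
        have := Real.pi_le_four
        gcongr
    _ = _ := by ring

lemma exists_clSchEnergy_lower_bound : ∃ C : ℝ, 0 < C ∧ ∀ Z α : ℝ, 1 ≤ Z → 0 < α →
    Z * α ^ 2 ≤ 1 → ∀ E ∈ clSchSet Z α,
      sInf (nfSchSet Z α) - C * Z ^ ((7 : ℝ) / 3 - 1 / 63) ≤ E := by
  obtain ⟨C₀, hC₀, hnf⟩ := exists_nfSchSet_le
  obtain ⟨C, D, hC, hD, hlow⟩ := exists_energy_lower_bound
  set c : ℝ := C₀ + (1 / 4 + 20 * 640 ^ 5) with hc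
  have hc0 : 0 < c := by positivity
  obtain ⟨C', hC', hpar⟩ := exists_parameters C D (96 * c) hC hD (by positivity)
  refine ⟨C₀ + C', by positivity, ?_⟩
  rintro Z α hZ hα hκ E ⟨N, hN, A, hA, Ψ, hΨ, rfl⟩
  have hbdd : BddBelow (nfSchSet Z α) := (bddBelow_clSchSet hZ α).mono (nfSchSet_subset_clSchSet Z α)
  obtain ⟨E₁, hE₁, hE₁C⟩ := hnf Z α (by linarith)
  have hinf : sInf (nfSchSet Z α) ≤ C₀ := (csInf_le hbdd hE₁).trans hE₁C
  have hX : 1 ≤ Z ^ ((7 : ℝ) / 3 - 1 / 63) := Real.one_le_rpow hZ (by norm_num)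
  have hX' : C₀ ≤ C₀ * Z ^ ((7 : ℝ) / 3 - 1 / 63) := le_mul_of_one_le_right hC₀ hX
  have hX'' : 0 ≤ C' * Z ^ ((7 : ℝ) / 3 - 1 / 63) := by positivity
  rw [add_mul]
  rcases le_or_gt C₀ (clSchEnergy N Z α A Ψ) with hcase | hcase
  · linarith
  have hY : 1 ≤ Z ^ (7 / 3 : ℝ) := Real.one_le_rpow hZ (by norm_num)
  have hY' : C₀ ≤ C₀ * Z ^ (7 / 3 : ℝ) := le_mul_of_one_le_right hC₀ hY
  have hatt := attW_le hΨ hA.1.continuous hZ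
  have hk := kin_nonneg A Ψ
  have hrep : 0 ≤ repW N (fun _ => 1) Ψ := repW_nonneg fun _ => zero_le_one
  have hfield : 0 ≤ (8 * Real.pi * α ^ 2)⁻¹ * ∫ x, curlSq A x :=
    mul_nonneg (by positivity) (integral_nonneg (curlSq_nonneg A))
  have hatt0 : 0 ≤ attW N (fun _ => 1) Ψ := attW_nonneg fun _ => zero_le_one
  rw [clSchEnergy_eq] at hcase ⊢
  have hcY : c * Z ^ (7 / 3 : ℝ) =
      C₀ * Z ^ (7 / 3 : ℝ) + (1 / 4 + 20 * 640 ^ 5) * Z ^ (7 / 3 : ℝ) := by rw [hc]; ring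
  have hcY0 : 0 ≤ c * Z ^ (7 / 3 : ℝ) := by positivity
  have hβ := lintegral_fderiv_sq_le_of_field hA hZ hα hκ (F := c) (by linarith)
  have hkin : kin N A Ψ ≤ 96 * c * Z ^ (7 / 3 : ℝ) := by linarith
  have hP : Z * attW N (fun _ => 1) Ψ ≤ 96 * c * Z ^ (7 / 3 : ℝ) := by linarith
  obtain ⟨ε, ℓ, R, τ, l, n, hε, hℓ, hR, hτ, hl, hn, herr⟩ :=
    hpar Z (Z * attW N (fun _ => 1) Ψ) hZ (by positivity) hP
  have hfinal := hlow N Ψ A Z α (sInf (nfSchSet Z α) - C₀) (96 * c * Z ^ (7 / 3 : ℝ))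
    (96 * c * Z ^ (4 / 3 : ℝ)) ε ℓ R τ l n hΨ hA hZ (by linarith)
    (fun n hn Ψ hΨ => by linarith [csInf_le hbdd ⟨n, hn, Ψ, hΨ, rfl⟩])
    (by positivity) hkin (by positivity) hβ hε hℓ hR hτ hl hn
  linarith

end Conclusion

/-- Thomas-Fermi theory is correct to leading order for the absolute ground state
energy of a large atom in a self-generated classical magnetic field, in the
magnetic Schrödinger model: E^{nf,S}_Z ≥ E^{cl,S}_{Z,α} ≥ E^{nf,S}_Z − C·Z^{7/3−1/63}
whenever Zα² ≤ κ. -/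
theorem atom_self_generated_field_TF_schroedinger :
    ∃ κ C : ℝ, 0 < κ ∧ 0 < C ∧ ∀ Z α : ℝ, 1 ≤ Z → 0 < α → Z * α ^ 2 ≤ κ →
      sInf (nfSchSet Z α) ≥ sInf (clSchSet Z α) ∧
      sInf (clSchSet Z α) ≥ sInf (nfSchSet Z α) - C * Z ^ ((7 : ℝ) / 3 - 1 / 63) := by
  obtain ⟨C, hC, hlow⟩ := exists_clSchEnergy_lower_bound
  obtain ⟨C₀, -, hnf⟩ := exists_nfSchSet_le
  refine ⟨1, C, one_pos, hC, fun Z α hZ hα hκ => ?_⟩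
  obtain ⟨E, hE, -⟩ := hnf Z α (by linarith)
  have hne : (nfSchSet Z α).Nonempty := ⟨E, hE⟩
  have hsub := nfSchSet_subset_clSchSet Z α
  exact ⟨csInf_le_csInf (bddBelow_clSchSet hZ α) hne hsub,
    le_csInf (hne.mono hsub) (hlow Z α hZ hα hκ)⟩
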